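/- arXiv:1603.06080 — 2 statements merged into one kernel-verified Lean document; each statement's English description precedes it below -/
import Mathlib

section
/- (Pieri rule for Schubert polynomials) For every permutation w and all integers i ≥ 1, d ≥ 0, one has 𝔖_w · h_d(x₁,…,x_i) = Σ_{ζ ∈ X_{i,d}(w)} 𝔖_{wζ}, where h_d is the complete homogeneous symmetric polynomial of degree d. -/
open scoped Classical

noncomputable section

/-- Permutations of the positive integers. -/
abbrev PPerm := Equiv.Perm ℕ+

/-- A permutation fixes all but finitely many points. -/
def HasFinSupp (w : PPerm) : Prop := {k : ℕ+ | w k ≠ k}.Finite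

/-- The transposition `t_{pq}`. -/
def tr (p q : ℕ+) : PPerm := Equiv.swap p q

/-- The set of inversions `I(w)`. -/
def invSet (w : PPerm) : Set (ℕ+ × ℕ+) := {x | x.1 < x.2 ∧ w x.2 < w x.1}

/-- The length `ℓ(w)` (number of inversions). -/
def len (w : PPerm) : ℕ := (invSet w).ncard

/-- `m_{pq}(z) = #{r > q : z(p) < z(r) < z(q)}`. -/
def mCnt (z : PPerm) (p q : ℕ+) : ℕ := {r : ℕ+ | q < r ∧ z p < z r ∧ z r < z q}.ncard

/-- `m'_{qp}(z) = #{r < p : z(p) < z(r) < z(q)}`. -/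
def m'Cnt (z : PPerm) (q p : ℕ+) : ℕ := {r : ℕ+ | r < p ∧ z p < z r ∧ z r < z q}.ncard

/-- The list of transpositions `t_{p₁q₁}, …, t_{p_dq_d}`. -/
def trList (d : ℕ) (p q : Fin d → ℕ+) : List PPerm := List.ofFn fun j => tr (p j) (q j)

/-- `w_{j+1} = w t_{p₁q₁} ⋯ t_{p_jq_j}` (so `wSeq w d p q 0 = w₁ = w`). -/
def wSeq (w : PPerm) (d : ℕ) (p q : Fin d → ℕ+) (j : ℕ) : PPerm :=
  w * ((trList d p q).take j).prod

/-- The defining conditions on a factorization for membership in `X_{i,d}(w)`. -/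
def IsXFact (w : PPerm) (i d : ℕ) (p q : Fin d → ℕ+) : Prop :=
  (∀ j, (p j : ℕ) ≤ i ∧ i < (q j : ℕ)) ∧
  (∀ j : Fin d, len (wSeq w d p q (j + 1)) = len (wSeq w d p q j) + 1) ∧
  (∀ j k : Fin d, j < k → wSeq w d p q j (p j) < wSeq w d p q k (p k))

/-- The defining conditions on a factorization for membership in `Y_{i,d}(w)`. -/
def IsYFact (w : PPerm) (i d : ℕ) (p q : Fin d → ℕ+) : Prop :=
  (∀ j, (p j : ℕ) ≤ i ∧ i < (q j : ℕ)) ∧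
  (∀ j : Fin d, len (wSeq w d p q (j + 1)) = len (wSeq w d p q j) + 1) ∧
  (∀ j k : Fin d, j < k → wSeq w d p q k (q k) < wSeq w d p q j (q j))

/-- The set `X_{i,d}(w)`. -/
def XSet (w : PPerm) (i d : ℕ) : Set PPerm :=
  {ζ | ∃ p q : Fin d → ℕ+, ζ = (trList d p q).prod ∧ IsXFact w i d p q}

/-- The set `Y_{i,d}(w)`. -/
def YSet (w : PPerm) (i d : ℕ) : Set PPerm :=
  {ζ | ∃ p q : Fin d → ℕ+, ζ = (trList d p q).prod ∧ IsYFact w i d p q}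

/-- `w ∈ S^{(n)}`, i.e. `w(n+1) < w(n+2) < ⋯`. -/
def InSn (n : ℕ) (w : PPerm) : Prop := ∀ k l : ℕ+, (n : ℕ) < (k : ℕ) → k < l → w k < w l

/-- `x₁^{m-1} x₂^{m-2} ⋯ x_{m-1}`, the Schubert polynomial of the longest element of `S_m`. -/
def schubBase (m : ℕ) : MvPolynomial ℕ+ ℤ :=
  ∏ k ∈ Finset.range m, MvPolynomial.X (k.succPNat) ^ (m - 1 - k)

/-- The defining property of the family of Schubert polynomials `w ↦ 𝔖_w`:
the value on dominant "staircase" permutations, together with the divided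
difference recursion `𝔖_{w s_i} = ∂_i 𝔖_w` whenever `ℓ(w s_i) < ℓ(w)`, stated
in the product form `(x_i - x_{i+1}) · 𝔖_{w s_i} = 𝔖_w - s_i 𝔖_w`. -/
def IsSchubertFamily (S : PPerm → MvPolynomial ℕ+ ℤ) : Prop :=
  (∀ m : ℕ, ∀ w : PPerm, (∀ k : ℕ+, (k : ℕ) ≤ m → (w k : ℕ) = m + 1 - (k : ℕ)) →
      (∀ k : ℕ+, m < (k : ℕ) → w k = k) → S w = schubBase m) ∧
  (∀ w : PPerm, ∀ i : ℕ+, len (w * tr i (i + 1)) < len w →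
      (MvPolynomial.X i - MvPolynomial.X (i + 1)) * S (w * tr i (i + 1)) =
        S w - MvPolynomial.rename (Equiv.swap i (i + 1)) (S w))

/-- The complete homogeneous symmetric polynomial `h_d(x₁, …, x_i)`. -/
def hPoly (i d : ℕ) : MvPolynomial ℕ+ ℤ :=
  ∑ m : Sym (Fin i) d, ((m : Multiset (Fin i)).map fun k => MvPolynomial.X (k.val.succPNat)).prod

/-- The elementary symmetric polynomial `e_d(x₁, …, x_i)`. -/
def ePoly (i d : ℕ) : MvPolynomial ℕ+ ℤ :=
  ∑ s ∈ Finset.powersetCard d (Finset.univ : Finset (Fin i)),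
    ∏ k ∈ s, MvPolynomial.X (k.val.succPNat)

/-- Lexicographic order on permutations. -/
def lexLT (u v : PPerm) : Prop := ∃ k : ℕ+, (∀ l, l < k → u l = v l) ∧ u k < v k

/-- Reverse lexicographic order on permutations. -/
def rlexLT (u v : PPerm) : Prop := ∃ k : ℕ+, (∀ l, k < l → u l = v l) ∧ u k < v k



namespace Pieri

/-- `w` fixes every position larger than `n`. -/
def FixedAbove (n : ℕ) (w : PPerm) : Prop := ∀ k : ℕ+, n < (k : ℕ) → w k = k

/-- The combinatorial form of the covering relation `w ⋖ w t_{pq}` with `p < q`. -/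
def Cov (w : PPerm) (p q : ℕ+) : Prop :=
  p < q ∧ w p < w q ∧ ∀ z, p < z → z < q → ¬ (w p < w z ∧ w z < w q)

theorem FixedAbove.mono {m n : ℕ} {w : PPerm} (h : FixedAbove m w) (hmn : m ≤ n) :
    FixedAbove n w := fun k hk => h k (by omega)

theorem FixedAbove.apply_le {n : ℕ} {w : PPerm} (h : FixedAbove n w) {k : ℕ+}
    (hk : (k : ℕ) ≤ n) : (w k : ℕ) ≤ n := by
  by_contra hc
  have h1 := w.injective (h (w k) (by omega))
  rw [h1] at hc
  exact hc hk

theorem FixedAbove.inv {n : ℕ} {w : PPerm} (h : FixedAbove n w) : FixedAbove n w⁻¹ :=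
  fun k hk => by rw [Equiv.Perm.inv_eq_iff_eq]; exact (h k hk).symm

theorem FixedAbove.mul_tr {n : ℕ} {w : PPerm} (h : FixedAbove n w) {p q : ℕ+}
    (hp : (p : ℕ) ≤ n) (hq : (q : ℕ) ≤ n) : FixedAbove n (w * tr p q) := by
  intro k hk
  have h1 : k ≠ p := by rintro rfl; omega
  have h2 : k ≠ q := by rintro rfl; omega
  simp [tr, Equiv.swap_apply_of_ne_of_ne h1 h2, h k hk]

theorem _root_.HasFinSupp.exists_fixedAbove {w : PPerm} (hw : HasFinSupp w) :
    ∃ n, FixedAbove n w := by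
  obtain ⟨b, hb⟩ := hw.bddAbove
  refine ⟨b, fun k hk => ?_⟩
  by_contra hc
  have : k ≤ b := hb hc
  have : (k : ℕ) ≤ b := this
  omega

theorem FixedAbove.invSet_subset {n : ℕ} {w : PPerm} (h : FixedAbove n w) :
    invSet w ⊆ Set.Iic n.succPNat ×ˢ Set.Iic n.succPNat := by
  rintro ⟨a, b⟩ ⟨hab, hw⟩
  simp only at hab hw
  have hab' : (a : ℕ) < b := hab
  have hw' : (w b : ℕ) < w a := hw
  have hb : (b : ℕ) ≤ n := by
    by_contra hc
    have h1 := h b (by omega)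
    rw [h1] at hw'
    have h2 := w.injective (h (w a) (by omega))
    rw [h2] at hw'
    omega
  constructor <;> rw [Set.mem_Iic, ← PNat.coe_le_coe] <;> simp <;> omega

theorem FixedAbove.invSet_finite {n : ℕ} {w : PPerm} (h : FixedAbove n w) :
    (invSet w).Finite :=
  ((Set.finite_Iic _).prod (Set.finite_Iic _)).subset h.invSet_subset

/-- The involution on pairs that matches inversions of `w` with inversions of `w t_{pq}`. -/
def pairFlip (p q : ℕ+) (x : ℕ+ × ℕ+) : ℕ+ × ℕ+ :=
  if tr p q x.1 < tr p q x.2 then (tr p q x.1, tr p q x.2) else x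

theorem tr_tr (p q x : ℕ+) : tr p q (tr p q x) = x := Equiv.swap_apply_self p q x

theorem pairFlip_pairFlip {p q : ℕ+} {x : ℕ+ × ℕ+} (hx : x.1 < x.2) :
    pairFlip p q (pairFlip p q x) = x := by
  unfold pairFlip
  by_cases h : tr p q x.1 < tr p q x.2
  · simp [h, tr_tr, hx]
  · simp [h]

theorem tr_left (p q : ℕ+) : tr p q p = q := Equiv.swap_apply_left p q
theorem tr_right (p q : ℕ+) : tr p q q = p := Equiv.swap_apply_right p q
theorem tr_ne {p q x : ℕ+} (h1 : x ≠ p) (h2 : x ≠ q) : tr p q x = x :=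
  Equiv.swap_apply_of_ne_of_ne h1 h2

theorem tr_cases (p q x : ℕ+) :
    (x = p ∧ tr p q x = q) ∨ (x = q ∧ tr p q x = p) ∨ (x ≠ p ∧ x ≠ q ∧ tr p q x = x) := by
  by_cases h1 : x = p
  · left; subst h1; exact ⟨rfl, tr_left _ _⟩
  by_cases h2 : x = q
  · right; left; subst h2; exact ⟨rfl, tr_right _ _⟩
  · exact Or.inr (Or.inr ⟨h1, h2, tr_ne h1 h2⟩)

theorem mul_tr_apply (w : PPerm) (p q x : ℕ+) : (w * tr p q) x = w (tr p q x) := rfl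

theorem pairFlip_mem {w : PPerm} {p q : ℕ+} (hpq : p < q) (hw : w p < w q) {x : ℕ+ × ℕ+}
    (hx : x ∈ invSet w) : pairFlip p q x ∈ invSet (w * tr p q) := by
  obtain ⟨a, b⟩ := x
  obtain ⟨h1, h2⟩ := hx
  simp only at h1 h2
  unfold pairFlip
  by_cases h : tr p q a < tr p q b
  · simp only [h, if_true, invSet, Set.mem_ofPred_eq, mul_tr_apply, tr_tr]
    exact ⟨trivial, h2⟩
  · simp only [h, if_false, invSet, Set.mem_ofPred_eq, mul_tr_apply]
    refine ⟨h1, ?_⟩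
    rcases tr_cases p q a with ha | ha | ha <;> rcases tr_cases p q b with hb | hb | hb <;> grind

theorem pairFlip_mem_of_cov {w : PPerm} {p q : ℕ+} (hw : Cov w p q) {x : ℕ+ × ℕ+}
    (hx : x ∈ invSet (w * tr p q)) (hne : x ≠ (p, q)) : pairFlip p q x ∈ invSet w := by
  obtain ⟨a, b⟩ := x
  obtain ⟨h1, h2⟩ := hx
  obtain ⟨hpq, hwpq, hz⟩ := hw
  simp only [mul_tr_apply] at h1 h2
  unfold pairFlip
  by_cases h : tr p q a < tr p q b
  · simp only [h, if_true, invSet, Set.mem_ofPred_eq]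
    exact ⟨trivial, h2⟩
  · simp only [h, if_false, invSet, Set.mem_ofPred_eq]
    refine ⟨h1, ?_⟩
    have hia : ∀ x y, (w x : ℕ) = w y → x = y := fun x y h => w.injective (PNat.coe_injective h)
    have h3 := @PNat.coe_inj b q
    have h4 := @PNat.coe_inj a p
    have h5 := hia a p
    have h6 := hia b q
    have h9 := hia b p
    have h10 := hia a q
    have h7 := hz a
    have h8 := hz b
    clear hia hz
    simp only [← PNat.coe_lt_coe] at *
    rcases tr_cases p q a with ha | ha | ha <;> rcases tr_cases p q b with hb | hb | hb <;>
      grind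

theorem len_mul_tr_of_cov {n : ℕ} {w : PPerm} (h : FixedAbove n w) {p q : ℕ+}
    (hw : Cov w p q) : len (w * tr p q) = len w + 1 := by
  have hself : pairFlip p q (p, q) = (p, q) := by
    unfold pairFlip
    simp [tr_left, tr_right, not_lt.mpr hw.1.le]
  have key : invSet (w * tr p q) = insert (p, q) (pairFlip p q '' invSet w) := by
    ext x
    constructor
    · intro hx
      by_cases hne : x = (p, q)
      · exact Or.inl hne
      · exact Or.inr ⟨_, pairFlip_mem_of_cov hw hx hne, pairFlip_pairFlip hx.1⟩
    · rintro (rfl | ⟨y, hy, rfl⟩)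
      · refine ⟨hw.1, ?_⟩
        simp only [mul_tr_apply, tr_left, tr_right]
        exact hw.2.1
      · exact pairFlip_mem hw.1 hw.2.1 hy
  have hnot : (p, q) ∉ pairFlip p q '' invSet w := by
    rintro ⟨y, hy, hyq⟩
    have h1 := pairFlip_pairFlip (p := p) (q := q) hy.1
    rw [hyq, hself] at h1
    subst h1
    exact absurd hy.2 (not_lt.mpr hw.2.1.le)
  unfold len
  rw [key, Set.ncard_insert_of_notMem hnot (h.invSet_finite.image _), Set.InjOn.ncard_image]
  intro x hx y hy hxy
  rw [← pairFlip_pairFlip (p := p) (q := q) hx.1, hxy, pairFlip_pairFlip hy.1]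

theorem FixedAbove.exists_mul_tr {n : ℕ} {w : PPerm} (h : FixedAbove n w) (p q : ℕ+) :
    ∃ m, FixedAbove m (w * tr p q) :=
  ⟨max n (max p q), (h.mono (by omega)).mul_tr (by omega) (by omega)⟩

theorem len_lt_len_mul_tr {n : ℕ} {w : PPerm} (h : FixedAbove n w) {p q : ℕ+}
    (hpq : p < q) (hw : w p < w q) : len w < len (w * tr p q) := by
  obtain ⟨m, hm⟩ := h.exists_mul_tr p q
  have hself : pairFlip p q (p, q) = (p, q) := by
    unfold pairFlip
    simp [tr_left, tr_right, not_lt.mpr hpq.le]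
  have hinj : Set.InjOn (pairFlip p q) (invSet w) := by
    intro x hx y hy hxy
    rw [← pairFlip_pairFlip (p := p) (q := q) hx.1, hxy, pairFlip_pairFlip hy.1]
  unfold len
  rw [← hinj.ncard_image]
  refine Set.ncard_lt_ncard (Set.ssubset_iff_of_subset ?_ |>.mpr ⟨(p, q), ?_, ?_⟩) hm.invSet_finite
  · rintro _ ⟨y, hy, rfl⟩
    exact pairFlip_mem hpq hw hy
  · refine ⟨hpq, ?_⟩
    simp only [mul_tr_apply, tr_left, tr_right]
    exact hw
  · rintro ⟨y, hy, hyq⟩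
    have h1 := pairFlip_pairFlip (p := p) (q := q) hy.1
    rw [hyq, hself] at h1
    subst h1
    exact absurd hy.2 (not_lt.mpr hw.le)

theorem mul_tr_mul_tr (w : PPerm) (p q : ℕ+) : w * tr p q * tr p q = w := by
  simp [tr, mul_assoc]

theorem len_mul_tr_lt_len {n : ℕ} {w : PPerm} (h : FixedAbove n w) {p q : ℕ+}
    (hpq : p < q) (hw : w q < w p) : len (w * tr p q) < len w := by
  obtain ⟨m, hm⟩ := h.exists_mul_tr p q
  have := len_lt_len_mul_tr hm hpq (by simpa [mul_tr_apply, tr_left, tr_right] using hw)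
  rwa [mul_tr_mul_tr] at this

theorem len_mul_tr_eq_iff_cov {n : ℕ} {w : PPerm} (h : FixedAbove n w) {p q : ℕ+}
    (hpq : p < q) : len (w * tr p q) = len w + 1 ↔ Cov w p q := by
  refine ⟨fun hl => ?_, len_mul_tr_of_cov h⟩
  have hw : w p < w q := by
    by_contra hc
    have hne : w p ≠ w q := fun he => hpq.ne (w.injective he)
    have := len_mul_tr_lt_len h hpq (lt_of_le_of_ne (not_lt.mp hc) hne.symm)
    omega
  refine ⟨hpq, hw, fun z hpz hzq hz => ?_⟩
  -- factor the transposition through the intermediate position `z`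
  obtain ⟨m₁, h1⟩ := h.exists_mul_tr p z
  obtain ⟨m₂, h2⟩ := h1.exists_mul_tr z q
  have e : w * tr p q = w * tr p z * tr z q * tr p z := by
    refine Equiv.ext fun x => congrArg w ?_
    change tr p q x = tr p z (tr z q (tr p z x))
    rcases tr_cases p q x with hx | hx | hx <;> rcases tr_cases p z x with hx' | hx' | hx' <;>
      rcases tr_cases z q (tr p z x) with hx'' | hx'' | hx'' <;>
      rcases tr_cases p z (tr z q (tr p z x)) with hy | hy | hy <;> grind
  have a1 := len_lt_len_mul_tr h hpz hz.1
  have q1 : tr p z q = q := tr_ne hpq.ne' hzq.ne'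
  have a2 := len_lt_len_mul_tr h1 hzq (by
    simp only [mul_tr_apply, tr_right, q1]; exact hw)
  have p2 : tr z q p = p := tr_ne hpz.ne hpq.ne
  have a3 := len_lt_len_mul_tr h2 hpz (by
    simp only [mul_tr_apply, tr_left, q1, p2]; exact hz.2)
  rw [← e] at a3
  omega

open MvPolynomial in
theorem schubert_descent {S : PPerm → MvPolynomial ℕ+ ℤ} (hS : IsSchubertFamily S) {n : ℕ}
    {u : PPerm} (hu : FixedAbove n u) {k : ℕ+} (hk : u (k + 1) < u k) :
    S u - rename (tr k (k + 1)) (S u) = (X k - X (k + 1)) * S (u * tr k (k + 1)) :=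
  (hS.2 u k (len_mul_tr_lt_len hu (PNat.lt_add_right k 1) hk)).symm

theorem X_sub_X_ne_zero (k : ℕ+) :
    (MvPolynomial.X k - MvPolynomial.X (k + 1) : MvPolynomial ℕ+ ℤ) ≠ 0 := by
  rw [sub_ne_zero]
  intro h
  exact (PNat.lt_add_right k 1).ne (MvPolynomial.X_injective h)

theorem rename_tr_rename_tr (p q : ℕ+) (f : MvPolynomial ℕ+ ℤ) :
    MvPolynomial.rename (tr p q) (MvPolynomial.rename (tr p q) f) = f := by
  rw [MvPolynomial.rename_rename]
  have : (tr p q : ℕ+ → ℕ+) ∘ tr p q = id := funext (tr_tr p q)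
  rw [this, MvPolynomial.rename_id_apply]

open MvPolynomial in
theorem schubert_ascent {S : PPerm → MvPolynomial ℕ+ ℤ} (hS : IsSchubertFamily S) {n : ℕ}
    {u : PPerm} (hu : FixedAbove n u) {k : ℕ+} (hk : u k < u (k + 1)) :
    rename (tr k (k + 1)) (S u) = S u := by
  obtain ⟨m, hm⟩ := hu.exists_mul_tr k (k + 1)
  have h1 := schubert_descent hS hm (k := k) (by simpa [mul_tr_apply, tr_left, tr_right] using hk)
  rw [mul_tr_mul_tr] at h1
  have h2 := congrArg (rename (tr k (k + 1))) h1
  simp only [map_sub, map_mul, rename_X, tr_left, tr_right, rename_tr_rename_tr] at h2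
  apply mul_left_cancel₀ (X_sub_X_ne_zero k)
  linear_combination h1 + h2

theorem tr_succ_lt {k x y : ℕ+} (hxy : x < y) (h : ¬ (x = k ∧ y = k + 1)) :
    tr k (k + 1) x < tr k (k + 1) y := by
  rcases tr_cases k (k + 1) x with ⟨h1, h2⟩ | ⟨h1, h2⟩ | ⟨h1, h1', h2⟩ <;>
  rcases tr_cases k (k + 1) y with ⟨h3, h4⟩ | ⟨h3, h4⟩ | ⟨h3, h3', h4⟩ <;>
  rw [h2, h4] <;> simp only [← PNat.coe_inj, ← PNat.coe_lt_coe, PNat.add_coe, PNat.one_coe, ne_eq] at * <;>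
  omega

theorem tr_conj (k a b : ℕ+) :
    tr (tr k (k + 1) a) (tr k (k + 1) b) = tr k (k + 1) * tr a b * tr k (k + 1) := by
  unfold tr
  have := Equiv.swap_apply_apply (Equiv.swap k (k+1)) a b
  rw [this]
  simp

theorem mul_tr_tr_conj (w : PPerm) (k a b : ℕ+) :
    w * tr k (k + 1) * tr (tr k (k + 1) a) (tr k (k + 1) b) = w * tr a b * tr k (k + 1) := by
  rw [tr_conj]
  simp [tr, mul_assoc]

theorem Cov.tr_succ {w : PPerm} {k a b : ℕ+} (hk : w k < w (k + 1)) (hab : ¬ (a = k ∧ b = k + 1))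
    (h : Cov w a b) : Cov (w * tr k (k + 1)) (tr k (k + 1) a) (tr k (k + 1) b) ∧
      (w * tr a b) k < (w * tr a b) (k + 1) := by
  obtain ⟨h1, h2, h3⟩ := h
  refine ⟨⟨tr_succ_lt h1 hab, by simpa only [mul_tr_apply, tr_tr] using h2, ?_⟩, ?_⟩
  · intro z hz1 hz2
    rw [mul_tr_apply, mul_tr_apply, mul_tr_apply, tr_tr, tr_tr]
    intro hw
    by_cases c1 : tr k (k + 1) a = k ∧ z = k + 1
    · obtain ⟨c1, rfl⟩ := c1
      rw [tr_right] at hw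
      have : a = k + 1 := by rw [← tr_tr k (k+1) a, c1, tr_left]
      subst this
      exact absurd hw.1 (not_lt.mpr hk.le)
    by_cases c2 : z = k ∧ tr k (k + 1) b = k + 1
    · obtain ⟨rfl, c2⟩ := c2
      rw [tr_left] at hw
      have : b = z := by rw [← tr_tr z (z+1) b, c2, tr_right]
      subst this
      exact absurd hw.2 (not_lt.mpr hk.le)
    have e1 := tr_succ_lt hz1 c1
    have e2 := tr_succ_lt hz2 c2
    rw [tr_tr] at e1 e2
    exact h3 _ e1 e2 hw
  · have hi : ∀ x y, (w x : ℕ) = w y → x = y := fun x y h => w.injective (PNat.coe_injective h)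
    have i1 := hi b (k + 1)
    have i2 := hi a k
    have j1 : k = a → w k = w a := congrArg w
    have j2 : k = b → w k = w b := congrArg w
    have j3 : k + 1 = a → w (k + 1) = w a := congrArg w
    have j4 : k + 1 = b → w (k + 1) = w b := congrArg w
    have h4 := h3 k
    have h5 := h3 (k + 1)
    simp only [mul_tr_apply]
    clear h3 hi
    simp only [← PNat.coe_inj, ← PNat.coe_lt_coe, PNat.add_coe, PNat.one_coe] at *
    rcases tr_cases a b k with ⟨h1, h2⟩ | ⟨h1, h2⟩ | ⟨h1, h1', h2⟩ <;>
    rcases tr_cases a b (k + 1) with ⟨h3, h4⟩ | ⟨h3, h4⟩ | ⟨h3, h3', h4⟩ <;>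
    rw [h2, h4] <;> simp only [← PNat.coe_inj, PNat.add_coe, PNat.one_coe, ne_eq] at * <;>
    grind

theorem Cov.of_tr_succ {w : PPerm} {k a b : ℕ+} (hk : w k < w (k + 1))
    (h : Cov (w * tr k (k + 1)) (tr k (k + 1) a) (tr k (k + 1) b))
    (h' : (w * tr a b) k < (w * tr a b) (k + 1)) : Cov w a b := by
  obtain ⟨h1, h2, h3⟩ := h
  simp only [mul_tr_apply, tr_tr] at h2
  have h0 : ¬ (tr k (k + 1) a = k ∧ tr k (k + 1) b = k + 1) := by
    rintro ⟨c1, c2⟩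
    have e1 : a = k + 1 := by rw [← tr_tr k (k+1) a, c1, tr_left]
    have e2 : b = k := by rw [← tr_tr k (k+1) b, c2, tr_right]
    subst e1 e2
    exact absurd hk (not_lt.mpr h2.le)
  have hab := tr_succ_lt h1 h0
  rw [tr_tr, tr_tr] at hab
  refine ⟨hab, h2, fun z hz1 hz2 hw => ?_⟩
  by_cases c1 : a = k ∧ z = k + 1
  · obtain ⟨rfl, rfl⟩ := c1
    rw [mul_tr_apply, mul_tr_apply, tr_left, tr_ne hz1.ne' hz2.ne] at h'
    exact absurd hw.2 (not_lt.mpr h'.le)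
  by_cases c2 : z = k ∧ b = k + 1
  · obtain ⟨rfl, rfl⟩ := c2
    rw [mul_tr_apply, mul_tr_apply, tr_right, tr_ne hz1.ne' hz2.ne] at h'
    exact absurd hw.1 (not_lt.mpr h'.le)
  refine h3 _ (tr_succ_lt hz1 c1) (tr_succ_lt hz2 c2) ?_
  simpa only [mul_tr_apply, tr_tr] using hw

/-- The contribution of the transposition `t_{ab}` to the Monk rule. -/
def covTerm (S : PPerm → MvPolynomial ℕ+ ℤ) (u : PPerm) (a b : ℕ+) : MvPolynomial ℕ+ ℤ :=
  if Cov u a b then S (u * tr a b) else 0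

theorem covTerm_tr_succ {S : PPerm → MvPolynomial ℕ+ ℤ} (hS : IsSchubertFamily S) {n : ℕ}
    {w : PPerm} (hw : FixedAbove n w) {k a b : ℕ+} (hk : w k < w (k + 1))
    (hab : ¬ (a = k ∧ b = k + 1)) :
    covTerm S (w * tr k (k + 1)) (tr k (k + 1) a) (tr k (k + 1) b) -
      MvPolynomial.rename (tr k (k + 1))
        (covTerm S (w * tr k (k + 1)) (tr k (k + 1) a) (tr k (k + 1) b)) =
      (MvPolynomial.X k - MvPolynomial.X (k + 1)) * covTerm S w a b := by
  obtain ⟨m, hm⟩ := hw.exists_mul_tr a b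
  obtain ⟨l, hl⟩ := hm.exists_mul_tr k (k + 1)
  unfold covTerm
  rw [mul_tr_tr_conj]
  by_cases c : Cov w a b
  · obtain ⟨h1, h2⟩ := c.tr_succ hk hab
    rw [if_pos c, if_pos h1]
    have := schubert_descent hS hl (k := k) (by simpa only [mul_tr_apply, tr_left, tr_right] using h2)
    rwa [mul_tr_mul_tr] at this
  · rw [if_neg c]
    by_cases c' : Cov (w * tr k (k + 1)) (tr k (k + 1) a) (tr k (k + 1) b)
    · rw [if_pos c', schubert_ascent hS hl, sub_self, mul_zero]
      have h3 : ¬ (w * tr a b) k < (w * tr a b) (k + 1) := fun h => c (c'.of_tr_succ hk h)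
      have h4 : (w * tr a b) k ≠ (w * tr a b) (k + 1) := fun h =>
        (PNat.lt_add_right k 1).ne ((w * tr a b).injective h)
      rw [mul_tr_apply, mul_tr_apply _ _ _ (k + 1), tr_left, tr_right]
      exact lt_of_le_of_ne (not_lt.mp h3) h4.symm
    · simp [if_neg c']

/-- The monomial `x₁^{c 0} x₂^{c 1} ⋯ x_M^{c (M-1)}`. -/
def xPow (M : ℕ) (c : ℕ → ℕ) : MvPolynomial ℕ+ ℤ :=
  ∏ a ∈ Finset.range M, MvPolynomial.X a.succPNat ^ c a

theorem xPow_congr {M : ℕ} {c c' : ℕ → ℕ} (h : ∀ a < M, c a = c' a) : xPow M c = xPow M c' :=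
  Finset.prod_congr rfl fun a ha => by rw [h a (Finset.mem_range.mp ha)]

theorem xPow_add_single {M : ℕ} {c c' : ℕ → ℕ} {a : ℕ} (ha : a < M)
    (h1 : c a = c' a + 1) (h2 : ∀ b, b ≠ a → c b = c' b) :
    xPow M c = MvPolynomial.X a.succPNat * xPow M c' := by
  unfold xPow
  have hm := Finset.mem_range.mpr ha
  rw [← Finset.mul_prod_erase _ _ hm, ← Finset.mul_prod_erase _ _ hm, h1, pow_succ',
    mul_assoc]
  congr 2
  exact Finset.prod_congr rfl fun b hb => by rw [h2 b (Finset.ne_of_mem_erase hb)]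

theorem succPNat_succ (a : ℕ) : a.succPNat + 1 = (a + 1).succPNat := rfl

theorem rename_xPow {M : ℕ} {c : ℕ → ℕ} {a : ℕ} (ha : a + 1 < M) (h : c a = c (a + 1)) :
    MvPolynomial.rename (tr a.succPNat (a.succPNat + 1)) (xPow M c) = xPow M c := by
  unfold xPow
  rw [map_prod]
  refine Finset.prod_equiv (Equiv.swap a (a + 1)) (fun b => ?_) (fun b _ => ?_)
  · rw [Finset.mem_range, Finset.mem_range, Equiv.swap_apply_def]
    split_ifs <;> omega
  · rw [map_pow, MvPolynomial.rename_X]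
    by_cases h1 : b = a
    · subst h1
      rw [tr_left, Equiv.swap_apply_left, h, succPNat_succ]
    by_cases h2 : b = a + 1
    · subst h2
      rw [← succPNat_succ, tr_right, Equiv.swap_apply_right, h]
    · rw [Equiv.swap_apply_of_ne_of_ne h1 h2, tr_ne]
      · exact fun e => h1 (Nat.succPNat_injective e)
      · exact fun e => h2 (Nat.succPNat_injective e)

theorem schubert_eq_xPow_of_descent {S : PPerm → MvPolynomial ℕ+ ℤ} (hS : IsSchubertFamily S)
    {n M a : ℕ} {c c' : ℕ → ℕ} {u : PPerm} (hu : FixedAbove n u) (ha : a + 1 < M)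
    (hk : u (a + 1).succPNat < u a.succPNat)
    (hc : S u = xPow M c) (h1 : c a = c' a + 1) (h2 : ∀ b, b ≠ a → c b = c' b)
    (h3 : c' a = c' (a + 1)) :
    S (u * tr a.succPNat (a + 1).succPNat) = xPow M c' := by
  have h := schubert_descent hS hu (k := a.succPNat) hk
  rw [hc, xPow_add_single (by omega) h1 h2, map_mul, rename_xPow ha h3, MvPolynomial.rename_X,
    tr_left, ← sub_mul] at h
  exact (mul_left_cancel₀ (X_sub_X_ne_zero _) h).symm

theorem mul_tr_succ_coe (u : PPerm) (a : ℕ) (k : ℕ+) :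
    ((u * tr a.succPNat (a + 1).succPNat) k : ℕ) =
      if (k : ℕ) = a + 1 then (u (a + 1).succPNat : ℕ)
      else if (k : ℕ) = a + 2 then (u a.succPNat : ℕ) else u k := by
  rw [mul_tr_apply]
  rcases tr_cases a.succPNat (a + 1).succPNat k with ⟨h1, h2⟩ | ⟨h1, h2⟩ | ⟨h1, h1', h2⟩
  · rw [h2, if_pos]; rw [h1]; rfl
  · rw [h2, if_neg, if_pos] <;> rw [h1] <;> simp
  · rw [h2, if_neg, if_neg]
    · intro e; exact h1' (PNat.coe_injective (by simpa using e))
    · intro e; exact h1 (PNat.coe_injective (by simpa using e))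

theorem schubert_staircase_insert_max {S : PPerm → MvPolynomial ℕ+ ℤ} (hS : IsSchubertFamily S)
    (m j : ℕ) (hj : j ≤ m) (u : PPerm)
    (hu : ∀ k : ℕ+, (u k : ℕ) = if (k : ℕ) ≤ j then m + 1 - (k : ℕ) else
      if (k : ℕ) = j + 1 then m + 1 else if (k : ℕ) ≤ m + 1 then m + 2 - (k : ℕ) else k) :
    S u = xPow (m + 1) fun a => if a < j then m - 1 - a else m - a := by
  induction j generalizing u with
  | zero =>
    rw [hS.1 (m + 1) u]
    · rfl
    · intro k hk
      have := k.pos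
      rw [hu]
      split_ifs <;> omega
    · intro k hk
      apply PNat.coe_injective
      rw [hu]
      split_ifs <;> omega
  | succ j ih =>
    have hspec : ∀ k : ℕ+, ((u * tr j.succPNat (j + 1).succPNat) k : ℕ) =
        if (k : ℕ) ≤ j then m + 1 - (k : ℕ) else
        if (k : ℕ) = j + 1 then m + 1 else if (k : ℕ) ≤ m + 1 then m + 2 - (k : ℕ) else k := by
      intro k
      rw [mul_tr_succ_coe]
      simp only [hu, Nat.succPNat_coe, Nat.succ_eq_add_one]
      grind
    have h := ih (by omega) _ hspec
    have hfix : FixedAbove (m + 1) (u * tr j.succPNat (j + 1).succPNat) := by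
      intro k hk
      apply PNat.coe_injective
      rw [hspec]
      split_ifs <;> omega
    have := schubert_eq_xPow_of_descent hS (a := j) hfix
      (c' := fun a => if a < j + 1 then m - 1 - a else m - a) (by omega) (by
        rw [← PNat.coe_lt_coe, hspec, hspec]
        simp only [Nat.succPNat_coe, Nat.succ_eq_add_one]
        grind) h
      (by split_ifs <;> omega) (by intro b hb; split_ifs <;> omega)
      (by split_ifs <;> omega)
    rwa [mul_tr_mul_tr] at this

theorem schubert_staircase_move_value {S : PPerm → MvPolynomial ℕ+ ℤ} (hS : IsSchubertFamily S)
    (m r j : ℕ) (hrj : r + 1 ≤ j) (hj : j ≤ m) (u : PPerm)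
    (hu : ∀ k : ℕ+, (u k : ℕ) = if (k : ℕ) = r + 1 then m + 1 else
      if (k : ℕ) ≤ j then m + 1 - (k : ℕ) else
      if (k : ℕ) = j + 1 then m - r else if (k : ℕ) ≤ m + 1 then m + 2 - (k : ℕ) else k) :
    S u = xPow (m + 1) fun a => if a = r then m - a else if a < j then m - 1 - a else m - a := by
  induction j, hrj using Nat.le_induction generalizing u with
  | base =>
    rw [schubert_staircase_insert_max hS m r (by omega) u]
    · refine xPow_congr fun a _ => ?_
      split_ifs <;> omega
    · intro k
      rw [hu]
      split_ifs <;> omega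
  | succ j hrj ih =>
    have hspec : ∀ k : ℕ+, ((u * tr j.succPNat (j + 1).succPNat) k : ℕ) =
        if (k : ℕ) = r + 1 then m + 1 else if (k : ℕ) ≤ j then m + 1 - (k : ℕ) else
        if (k : ℕ) = j + 1 then m - r else if (k : ℕ) ≤ m + 1 then m + 2 - (k : ℕ) else k := by
      intro k
      rw [mul_tr_succ_coe]
      simp only [hu, Nat.succPNat_coe, Nat.succ_eq_add_one]
      grind
    have h := ih (by omega) _ hspec
    have hfix : FixedAbove (m + 1) (u * tr j.succPNat (j + 1).succPNat) := by
      intro k hk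
      apply PNat.coe_injective
      rw [hspec]
      split_ifs <;> omega
    have := schubert_eq_xPow_of_descent hS (a := j) hfix
      (c' := fun a => if a = r then m - a else if a < j + 1 then m - 1 - a else m - a)
      (by omega) (by
        rw [← PNat.coe_lt_coe, hspec, hspec]
        simp only [Nat.succPNat_coe, Nat.succ_eq_add_one]
        grind) h
      (by split_ifs <;> omega) (by intro b hb; split_ifs <;> omega)
      (by split_ifs <;> omega)
    rwa [mul_tr_mul_tr] at this

theorem monk_staircase {S : PPerm → MvPolynomial ℕ+ ℤ} (hS : IsSchubertFamily S) {m : ℕ}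
    {N : ℕ+} (hN : (N : ℕ) = m + 1) {w : PPerm} (hw : FixedAbove m w)
    (hk : ∀ k : ℕ+, (k : ℕ) ≤ m → (w k : ℕ) = m + 1 - (k : ℕ)) {r : ℕ+} (hr : (r : ℕ) ≤ m) :
    MvPolynomial.X r * S w =
      ∑ q ∈ Finset.Iic N, (covTerm S w r q - covTerm S w q r) := by
  have hval : ∀ k : ℕ+, (w k : ℕ) = if (k : ℕ) ≤ m then m + 1 - (k : ℕ) else k := by
    intro k
    split_ifs with h
    · exact hk k h
    · rw [hw k (by omega)]
  have hrN : r < N := by rw [← PNat.coe_lt_coe]; omega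
  have hr0 := r.pos
  rw [Finset.sum_eq_single N]
  · have h1 : Cov w r N := by
      refine ⟨hrN, ?_, fun z hz1 hz2 => ?_⟩ <;> simp only [← PNat.coe_lt_coe, hval] at *
      · split_ifs <;> omega
      · split_ifs <;> omega
    have h2 : ¬ Cov w N r := fun h => absurd h.1 (not_lt.mpr hrN.le)
    rw [covTerm, covTerm, if_pos h1, if_neg h2, sub_zero]
    have h3 := schubert_staircase_move_value hS m (r - 1) m (by omega) le_rfl (w * tr r N)
      (by
        intro k
        rw [mul_tr_apply]
        have e1 := @PNat.coe_inj k r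
        have e2 := @PNat.coe_inj k N
        rcases tr_cases r N k with ⟨h1, h2⟩ | ⟨h1, h2⟩ | ⟨h1, h1', h2⟩
        · rw [h2, hval, h1]; split_ifs <;> omega
        · rw [h2, hval, h1]; split_ifs <;> omega
        · rw [h2, hval]
          have := mt e1.mp h1
          have := mt e2.mp h1'
          split_ifs <;> omega)
    have h4 : r.natPred.succPNat = r := PNat.succPNat_natPred r
    have h5 : schubBase m = xPow (m + 1) fun a => m - 1 - a := by
      unfold schubBase xPow
      rw [Finset.prod_range_succ]
      simp
    have h6 : r.natPred = (r : ℕ) - 1 := rfl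
    rw [h3, hS.1 m w hk hw, h5]
    conv_lhs => rw [← h4]
    refine (xPow_add_single (by omega) ?_ fun b hb => ?_).symm
    · rw [if_pos h6]; omega
    · rw [if_neg (by omega)]; split_ifs <;> omega
  · intro q hq hqN
    have hq' := PNat.coe_le_coe _ _ |>.mpr (Finset.mem_Iic.mp hq)
    have hqN' : (q : ℕ) ≠ N := fun h => hqN (PNat.coe_injective h)
    have h1 : ¬ Cov w r q := by
      rintro ⟨h1, h2, -⟩
      simp only [← PNat.coe_lt_coe, hval] at h1 h2
      split_ifs at h2 <;> omega
    have h2 : ¬ Cov w q r := by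
      rintro ⟨h1, h2, -⟩
      simp only [← PNat.coe_lt_coe, hval] at h1 h2
      split_ifs at h2 <;> omega
    rw [covTerm, covTerm, if_neg h1, if_neg h2, sub_zero]
  · intro h
    exact absurd (Finset.mem_Iic.mpr le_rfl) h

theorem FixedAbove.exists_ascent_or_staircase {m : ℕ} {w : PPerm} (hw : FixedAbove m w) :
    (∃ k : ℕ+, (k : ℕ) + 1 ≤ m ∧ w k < w (k + 1)) ∨
      ∀ k : ℕ+, (k : ℕ) ≤ m → (w k : ℕ) = m + 1 - (k : ℕ) := by
  by_cases h : ∃ k : ℕ+, (k : ℕ) + 1 ≤ m ∧ w k < w (k + 1)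
  · exact Or.inl h
  · right
    push Not at h
    have hd : ∀ k : ℕ+, (k : ℕ) + 1 ≤ m → (w (k + 1) : ℕ) + 1 ≤ w k := by
      intro k hk
      have h1 : (w (k + 1) : ℕ) ≤ w k := h k hk
      have h2 : (w (k + 1) : ℕ) ≠ w k := fun e =>
        (PNat.lt_add_right k 1).ne (w.injective (PNat.coe_injective e)).symm
      omega
    have hup : ∀ k : ℕ+, (k : ℕ) ≤ m → (w k : ℕ) + k ≤ m + 1 := by
      intro k
      induction k using PNat.recOn with
      | one => intro hk; have := hw.apply_le hk; simpa using this
      | succ k ih =>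
        intro hk
        rw [PNat.add_coe, PNat.one_coe] at hk ⊢
        have := hd k hk
        have := ih (by omega)
        omega
    have hlow : ∀ j : ℕ, ∀ k : ℕ+, (k : ℕ) + j = m → j + 1 ≤ (w k : ℕ) := by
      intro j
      induction j with
      | zero => intro k _; exact (w k).pos
      | succ j ih =>
        intro k hk
        have h1 := ih (k + 1) (by rw [PNat.add_coe, PNat.one_coe]; omega)
        have := hd k (by omega)
        omega
    intro k hk
    have := hup k hk
    have := hlow (m - k) k (by omega)
    omega

theorem covTerm_sub_rename {S : PPerm → MvPolynomial ℕ+ ℤ} (hS : IsSchubertFamily S) {n : ℕ}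
    {w : PPerm} (hw : FixedAbove n w) {k : ℕ+} (hk : w k < w (k + 1)) (a b : ℕ+) :
    covTerm S (w * tr k (k + 1)) (tr k (k + 1) a) (tr k (k + 1) b) -
      MvPolynomial.rename (tr k (k + 1))
        (covTerm S (w * tr k (k + 1)) (tr k (k + 1) a) (tr k (k + 1) b)) =
      (MvPolynomial.X k - MvPolynomial.X (k + 1)) *
        (covTerm S w a b - if a = k ∧ b = k + 1 then S (w * tr k (k + 1)) else 0) := by
  by_cases hab : a = k ∧ b = k + 1
  · have h1 : ¬ Cov (w * tr k (k + 1)) (tr k (k + 1) a) (tr k (k + 1) b) := by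
      rintro ⟨h, -⟩
      rw [hab.1, hab.2, tr_left, tr_right] at h
      exact absurd h (not_lt.mpr (PNat.lt_add_right k 1).le)
    have h2 : Cov w a b := by
      rw [hab.1, hab.2]
      refine ⟨PNat.lt_add_right k 1, hk, fun z h1 h2 => ?_⟩
      exact absurd h1 (not_lt.mpr (PNat.lt_add_one_iff.mp h2))
    rw [covTerm, covTerm, if_neg h1, if_pos h2, if_pos hab, hab.1, hab.2]
    simp
  · rw [if_neg hab, sub_zero]
    exact covTerm_tr_succ hS hw hk hab

theorem sum_Iic_tr {N k : ℕ+} (hk : k + 1 ≤ N) (f : ℕ+ → MvPolynomial ℕ+ ℤ) :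
    ∑ q ∈ Finset.Iic N, f (tr k (k + 1) q) = ∑ q ∈ Finset.Iic N, f q := by
  refine Finset.sum_equiv (tr k (k + 1)) (fun q => ?_) fun _ _ => rfl
  rw [Finset.mem_Iic, Finset.mem_Iic]
  have h := (PNat.lt_add_right k 1).le.trans hk
  rcases tr_cases k (k + 1) q with ⟨h1, h2⟩ | ⟨h1, h2⟩ | ⟨h1, h1', h2⟩ <;> rw [h2]
  · exact iff_of_true (h1 ▸ h) hk
  · exact iff_of_true (h1 ▸ hk) h

/-- **Monk rule** for multiplication by a single variable. -/
theorem monk {S : PPerm → MvPolynomial ℕ+ ℤ} (hS : IsSchubertFamily S) {m : ℕ}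
    {N : ℕ+} (hN : (N : ℕ) = m + 1) {w : PPerm} (hw : FixedAbove m w) {r : ℕ+}
    (hr : (r : ℕ) ≤ m) :
    MvPolynomial.X r * S w = ∑ q ∈ Finset.Iic N, (covTerm S w r q - covTerm S w q r) := by
  have hlen : ∀ w, FixedAbove m w →
      len w ≤ (Set.Iic m.succPNat ×ˢ Set.Iic m.succPNat : Set (ℕ+ × ℕ+)).ncard := fun w hw =>
    Set.ncard_le_ncard hw.invSet_subset ((Set.finite_Iic _).prod (Set.finite_Iic _))
  generalize (Set.Iic m.succPNat ×ˢ Set.Iic m.succPNat : Set (ℕ+ × ℕ+)).ncard = B at hlen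
  induction hj : B - len w using Nat.strong_induction_on generalizing w r with
  | _ j ih =>
    rcases hw.exists_ascent_or_staircase with ⟨k, hkm, hk⟩ | h
    swap
    · exact monk_staircase hS hN hw h hr
    have hk1 : ((k + 1 : ℕ+) : ℕ) = k + 1 := rfl
    have hw' : FixedAbove m (w * tr k (k + 1)) := hw.mul_tr (by omega) (by omega)
    have hsr : (tr k (k + 1) r : ℕ) ≤ m := by
      rcases tr_cases k (k + 1) r with ⟨h1, h2⟩ | ⟨h1, h2⟩ | ⟨h1, h1', h2⟩ <;> rw [h2] <;> omega
    have hl := len_lt_len_mul_tr hw (PNat.lt_add_right k 1) hk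
    have hlB := hlen _ hw'
    have h := ih _ (by omega) hw' hsr rfl
    rw [← sum_Iic_tr (k := k) (by rw [← PNat.coe_le_coe]; omega)] at h
    have hΔ := congrArg (fun f => f - MvPolynomial.rename (tr k (k + 1)) f) h
    simp only [map_sum, ← Finset.sum_sub_distrib, map_mul, map_sub, MvPolynomial.rename_X,
      tr_tr] at hΔ
    have hterm : ∀ q, (covTerm S (w * tr k (k + 1)) (tr k (k + 1) r) (tr k (k + 1) q) -
          covTerm S (w * tr k (k + 1)) (tr k (k + 1) q) (tr k (k + 1) r)) -
        (MvPolynomial.rename (tr k (k + 1))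
          (covTerm S (w * tr k (k + 1)) (tr k (k + 1) r) (tr k (k + 1) q)) -
        MvPolynomial.rename (tr k (k + 1))
          (covTerm S (w * tr k (k + 1)) (tr k (k + 1) q) (tr k (k + 1) r))) =
        (MvPolynomial.X k - MvPolynomial.X (k + 1)) *
        ((covTerm S w r q - covTerm S w q r) -
          ((if r = k ∧ q = k + 1 then S (w * tr k (k + 1)) else 0) -
          if q = k ∧ r = k + 1 then S (w * tr k (k + 1)) else 0)) := by
      intro q
      have h1 := covTerm_sub_rename hS hw hk r q
      have h2 := covTerm_sub_rename hS hw hk q r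
      linear_combination h1 - h2
    rw [Finset.sum_congr rfl fun q _ => hterm q, ← Finset.mul_sum, Finset.sum_sub_distrib] at hΔ
    have hdesc := schubert_descent hS hw' (k := k)
      (by simpa only [mul_tr_apply, tr_left, tr_right] using hk)
    rw [mul_tr_mul_tr] at hdesc
    have hkN : k ∈ Finset.Iic N := by rw [Finset.mem_Iic, ← PNat.coe_le_coe]; omega
    have hkN' : k + 1 ∈ Finset.Iic N := by rw [Finset.mem_Iic, ← PNat.coe_le_coe]; omega
    have hc : ∑ q ∈ Finset.Iic N, ((if r = k ∧ q = k + 1 then S (w * tr k (k + 1)) else 0) -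
          if q = k ∧ r = k + 1 then S (w * tr k (k + 1)) else 0) =
        (if r = k then S (w * tr k (k + 1)) else 0) -
          if r = k + 1 then S (w * tr k (k + 1)) else 0 := by
      rw [Finset.sum_sub_distrib]
      congr 1
      · by_cases hrk : r = k <;> simp [hrk, -Finset.mem_Iic, hkN']
      · by_cases hrk : r = k + 1 <;> simp [hrk, -Finset.mem_Iic, hkN]
    rw [hc] at hΔ
    apply mul_left_cancel₀ (X_sub_X_ne_zero k)
    rcases tr_cases k (k + 1) r with ⟨h1, h2⟩ | ⟨h1, h2⟩ | ⟨h1, h1', h2⟩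
    · rw [h2, if_pos h1, if_neg (h1 ▸ (PNat.lt_add_right k 1).ne), h1] at hΔ
      rw [h1]
      linear_combination hΔ - MvPolynomial.X k * hdesc
    · rw [h2, if_pos h1, if_neg (h1 ▸ (PNat.lt_add_right k 1).ne'), h1] at hΔ
      rw [h1]
      linear_combination hΔ - MvPolynomial.X (k + 1) * hdesc
    · rw [h2, if_neg h1, if_neg h1'] at hΔ
      linear_combination hΔ - MvPolynomial.X r * hdesc

theorem cov_swap_overlap {w : PPerm} {s r q : ℕ+} (hsr : s < r) (hrq : r < q) (hw : w s < w r) :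
    Cov w r q ∧ Cov (w * tr r q) s r ↔ Cov w s r ∧ Cov (w * tr s r) s q := by
  have e1 : ∀ z, z < r → tr r q z = z := fun z hz => tr_ne hz.ne (hz.trans hrq).ne
  have e2 : tr s r q = q := tr_ne (hsr.trans hrq).ne' hrq.ne'
  have e3 : ∀ z, s < z → z ≠ r → tr s r z = z := fun z hz hz' => tr_ne hz.ne' hz'
  constructor
  · rintro ⟨⟨h1, h2, h3⟩, ⟨h4, h5, h6⟩⟩
    simp only [mul_tr_apply, tr_left, e1 s hsr] at h5 h6
    refine ⟨⟨hsr, hw, fun z hz1 hz2 => ?_⟩, hsr.trans hrq, ?_, fun z hz1 hz2 => ?_⟩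
    · have := h6 z hz1 hz2
      rw [e1 z hz2] at this
      exact fun h => this ⟨h.1, h.2.trans h2⟩
    · simpa only [mul_tr_apply, tr_left, e2] using h2
    · simp only [mul_tr_apply, tr_left, e2]
      rcases lt_trichotomy z r with h | rfl | h
      · rw [e3 z hz1 h.ne]
        have := h6 z hz1 h
        rw [e1 z h] at this
        exact fun h => this ⟨hw.trans h.1, h.2⟩
      · rw [tr_right]
        exact fun h => absurd hw (not_lt.mpr h.1.le)
      · rw [e3 z hz1 h.ne']
        exact h3 z h hz2
  · rintro ⟨⟨h1, h2, h3⟩, ⟨h4, h5, h6⟩⟩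
    simp only [mul_tr_apply, tr_left, e2] at h5 h6
    refine ⟨⟨hrq, h5, fun z hz1 hz2 => ?_⟩, hsr, ?_, fun z hz1 hz2 => ?_⟩
    · have := h6 z (hsr.trans hz1) hz2
      rwa [e3 z (hsr.trans hz1) hz1.ne'] at this
    · simp only [mul_tr_apply, tr_left, e1 s hsr]
      exact hw.trans h5
    · simp only [mul_tr_apply, tr_left, e1 s hsr, e1 z hz2]
      have a1 := h6 z hz1 (hz2.trans hrq)
      rw [e3 z hz1 hz2.ne] at a1
      have a2 := h3 z hz1 hz2
      rintro ⟨b1, b2⟩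
      rcases lt_trichotomy (w z) (w r) with h | h | h
      · exact a2 ⟨b1, h⟩
      · exact hz2.ne (w.injective h)
      · exact a1 ⟨h, b2⟩

theorem cov_swap_nested {w : PPerm} {p r q : ℕ+} (hpr : p < r) (hrq : r < q) (hw : w r < w p) :
    Cov w p q ∧ Cov (w * tr p q) r q ↔ Cov w r q ∧ Cov (w * tr r q) p r := by
  have e1 : ∀ z, p < z → z < q → tr p q z = z := fun z hz hz' => tr_ne hz.ne' hz'.ne
  have e2 : ∀ z, z < r → tr r q z = z := fun z hz => tr_ne hz.ne (hz.trans hrq).ne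
  constructor
  · rintro ⟨⟨h1, h2, h3⟩, ⟨h4, h5, h6⟩⟩
    simp only [mul_tr_apply, tr_right, e1 r hpr hrq] at h5 h6
    refine ⟨⟨hrq, hw.trans h2, fun z hz1 hz2 => ?_⟩, hpr, ?_, fun z hz1 hz2 => ?_⟩
    · have a1 := h6 z hz1 hz2
      rw [e1 z (hpr.trans hz1) hz2] at a1
      have a2 := h3 z (hpr.trans hz1) hz2
      rintro ⟨b1, b2⟩
      rcases lt_trichotomy (w z) (w p) with h | h | h
      · exact a1 ⟨b1, h⟩
      · exact (hpr.trans hz1).ne' (w.injective h)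
      · exact a2 ⟨h, b2⟩
    · simpa only [mul_tr_apply, tr_left, e2 p hpr] using h2
    · simp only [mul_tr_apply, tr_left, e2 p hpr, e2 z hz2]
      exact h3 z hz1 (hz2.trans hrq)
  · rintro ⟨⟨h1, h2, h3⟩, ⟨h4, h5, h6⟩⟩
    simp only [mul_tr_apply, tr_left, e2 p hpr] at h5 h6
    refine ⟨⟨hpr.trans hrq, h5, fun z hz1 hz2 => ?_⟩, hrq, ?_, fun z hz1 hz2 => ?_⟩
    · rcases lt_trichotomy z r with h | rfl | h
      · have := h6 z hz1 h
        rwa [e2 z h] at this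
      · exact fun h => absurd hw (not_lt.mpr h.1.le)
      · exact fun h' => h3 z h hz2 ⟨hw.trans h'.1, h'.2⟩
    · simpa only [mul_tr_apply, tr_right, e1 r hpr hrq] using hw
    · simp only [mul_tr_apply, tr_right, e1 r hpr hrq, e1 z (hpr.trans hz1) hz2]
      exact fun h => h3 z hz1 hz2 ⟨h.1, h.2.trans h5⟩

theorem cov_iff_split (w : PPerm) (p q s r : ℕ+) : Cov w s r ↔
    (∀ z, s < z → z < r → z ≠ p → z ≠ q → ¬ (w s < w z ∧ w z < w r)) ∧ s < r ∧ w s < w r ∧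
      (s < p → p < r → ¬ (w s < w p ∧ w p < w r)) ∧
      (s < q → q < r → ¬ (w s < w q ∧ w q < w r)) := by
  constructor
  · rintro ⟨h1, h2, h3⟩
    exact ⟨fun z h h' _ _ => h3 z h h', h1, h2, h3 p, h3 q⟩
  · rintro ⟨h1, h2, h3, h4, h5⟩
    refine ⟨h2, h3, fun z hz hz' => ?_⟩
    by_cases hp : z = p
    · subst hp; exact h4 hz hz'
    by_cases hq : z = q
    · subst hq; exact h5 hz hz'
    exact h1 z hz hz' hp hq

theorem cov_mul_tr_iff_split (w : PPerm) {p q s r : ℕ+} (h1 : s ≠ p) (h2 : s ≠ q) (h3 : r ≠ p)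
    (h4 : r ≠ q) : Cov (w * tr p q) s r ↔
    (∀ z, s < z → z < r → z ≠ p → z ≠ q → ¬ (w s < w z ∧ w z < w r)) ∧ s < r ∧ w s < w r ∧
      (s < p → p < r → ¬ (w s < w q ∧ w q < w r)) ∧
      (s < q → q < r → ¬ (w s < w p ∧ w p < w r)) := by
  rw [cov_iff_split _ p q s r]
  simp only [mul_tr_apply, tr_left, tr_right, tr_ne h1 h2, tr_ne h3 h4]
  refine and_congr_left fun _ => forall_congr' fun z => ?_
  by_cases hp : z = p
  · simp [hp]
  by_cases hq : z = q
  · simp [hq]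
  rw [tr_ne hp hq]

theorem cov_swap_low {w : PPerm} {s p r q : ℕ+} (hpr : p < r) (hsr : s < r) (hrq : r < q)
    (hw : w s < w p) :
    Cov w p q ∧ Cov (w * tr p q) s r ↔ Cov w s r ∧ Cov (w * tr s r) p q := by
  have hsp : s ≠ p := by rintro rfl; exact lt_irrefl _ hw
  have hsq : s ≠ q := (hsr.trans hrq).ne
  have h1 : (w r : ℕ) ≠ w p := fun h => hpr.ne' (w.injective (PNat.coe_injective h))
  have h2 : (w r : ℕ) ≠ w q := fun h => hrq.ne (w.injective (PNat.coe_injective h))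
  rw [cov_iff_split w s r p q, cov_iff_split w p q s r,
    cov_mul_tr_iff_split w hsp hsq hpr.ne' hrq.ne,
    cov_mul_tr_iff_split w hsp.symm hpr.ne hsq.symm hrq.ne']
  simp only [← PNat.coe_lt_coe, ← PNat.coe_inj, ne_eq] at *
  constructor
  · rintro ⟨⟨h1, h2, h3, h4, h5⟩, h6, h7, h8, h9, h10⟩
    exact ⟨⟨h6, by omega, by omega, by omega, by omega⟩, h1, by omega, by omega, by omega, by omega⟩
  · rintro ⟨⟨h1, h2, h3, h4, h5⟩, h6, h7, h8, h9, h10⟩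
    exact ⟨⟨h6, by omega, by omega, by omega, by omega⟩, h1, by omega, by omega, by omega, by omega⟩

theorem cov_swap_high {w : PPerm} {p r q q' : ℕ+} (hpr : p < r) (hrq : r < q) (hrq' : r < q')
    (hqq' : q ≠ q') (hw : w r < w p) :
    Cov w p q ∧ Cov (w * tr p q) r q' ↔ Cov w r q' ∧ Cov (w * tr r q') p q := by
  have hpq' : p ≠ q' := (hpr.trans hrq').ne
  have h1 : (w q' : ℕ) ≠ w p := fun h => hpq' (w.injective (PNat.coe_injective h)).symm
  have h2 : (w q' : ℕ) ≠ w q := fun h => hqq' (w.injective (PNat.coe_injective h)).symm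
  rw [cov_iff_split w r q' p q, cov_iff_split w p q r q',
    cov_mul_tr_iff_split w hpr.ne' hrq.ne hpq'.symm hqq'.symm,
    cov_mul_tr_iff_split w hpr.ne hpq' hrq.ne' hqq']
  simp only [← PNat.coe_lt_coe, ← PNat.coe_inj, ne_eq] at *
  constructor
  · rintro ⟨⟨h1, h2, h3, h4, h5⟩, h6, h7, h8, h9, h10⟩
    exact ⟨⟨h6, by omega, by omega, by omega, by omega⟩, h1, by omega, by omega, by omega, by omega⟩
  · rintro ⟨⟨h1, h2, h3, h4, h5⟩, h6, h7, h8, h9, h10⟩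
    exact ⟨⟨h6, by omega, by omega, by omega, by omega⟩, h1, by omega, by omega, by omega, by omega⟩

theorem inv_mul_tr_apply (w : PPerm) (p q c : ℕ+) : (w * tr p q)⁻¹ c = tr p q (w⁻¹ c) := by
  simp [mul_inv_rev, tr]

theorem mul_tr_mul_tr_of_ne (w : PPerm) {p q s r : ℕ+} (h1 : s ≠ p) (h2 : s ≠ q) (h3 : r ≠ p)
    (h4 : r ≠ q) : w * tr p q * tr s r = w * tr s r * tr p q := by
  refine Equiv.ext fun x => congrArg w ?_
  change tr p q (tr s r x) = tr s r (tr p q x)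
  simp only [tr, Equiv.swap_apply_def]
  grind

theorem mul_tr_mul_tr_overlap (w : PPerm) {s r q : ℕ+} (h1 : s ≠ r) (h2 : r ≠ q) (h3 : s ≠ q) :
    w * tr r q * tr s r = w * tr s r * tr s q := by
  refine Equiv.ext fun x => congrArg w ?_
  change tr r q (tr s r x) = tr s r (tr s q x)
  simp only [tr, Equiv.swap_apply_def]
  grind

theorem mul_tr_mul_tr_nested (w : PPerm) {p r q : ℕ+} (h1 : p ≠ r) (h3 : p ≠ q) :
    w * tr p q * tr r q = w * tr r q * tr p r := by
  refine Equiv.ext fun x => congrArg w ?_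
  change tr p q (tr r q x) = tr r q (tr p r x)
  simp only [tr, Equiv.swap_apply_def]
  grind

/-- Move the value `v` from a position `≤ i` along a cover to a position in `(i, N]`. -/
def moveOp {R : Type*} [AddCommGroup R] (N : ℕ+) (i : ℕ) (v : ℕ+) (φ : PPerm → R) (w : PPerm) :
    R :=
  ∑ q ∈ Finset.Iic N, if ((w⁻¹ v : ℕ+) : ℕ) ≤ i ∧ i < (q : ℕ) ∧ Cov w (w⁻¹ v) q then
    φ (w * tr (w⁻¹ v) q) else 0

/-- The part of the Monk rule at position `r` that involves the value `a` as the smaller value. -/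
def monkOp {R : Type*} [AddCommGroup R] (N r a : ℕ+) (φ : PPerm → R) (w : PPerm) : R :=
  (if w⁻¹ a = r then ∑ q ∈ Finset.Iic N, if Cov w r q then φ (w * tr r q) else 0 else 0) -
    if Cov w (w⁻¹ a) r then φ (w * tr (w⁻¹ a) r) else 0

theorem Cov.irrefl {w : PPerm} {p : ℕ+} (h : Cov w p p) : False := lt_irrefl _ h.1

theorem moveOp_succ {R : Type*} [AddCommGroup R] {N r : ℕ+} {i : ℕ} (hr : (r : ℕ) = i + 1)
    (hrN : r ≤ N) (v : ℕ+) (φ : PPerm → R) (w : PPerm) :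
    moveOp N (i + 1) v φ w = moveOp N i v φ w + monkOp N r v φ w := by
  unfold moveOp monkOp
  generalize w⁻¹ v = p
  by_cases hp : p = r
  · subst hp
    rw [if_pos rfl, if_neg fun h => h.irrefl, sub_zero, ← Finset.sum_add_distrib]
    refine Finset.sum_congr rfl fun q _ => ?_
    by_cases c : Cov w p q
    · have : (p : ℕ) < q := c.1
      rw [if_pos ⟨by omega, by omega, c⟩, if_neg (by omega), if_pos c, zero_add]
    · simp [c]
  · have hp' : (p : ℕ) ≠ r := fun h => hp (PNat.coe_injective h)
    rw [if_neg hp, zero_sub, ← sub_eq_add_neg, eq_sub_iff_add_eq]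
    have h2 : (if Cov w p r then φ (w * tr p r) else 0) =
        ∑ q ∈ Finset.Iic N, if q = r ∧ Cov w p r then φ (w * tr p r) else 0 := by
      rw [Finset.sum_eq_single r]
      · simp
      · intro b _ hb
        simp [hb]
      · intro h
        exact absurd (Finset.mem_Iic.mpr hrN) h
    rw [h2, ← Finset.sum_add_distrib]
    refine Finset.sum_congr rfl fun q _ => ?_
    by_cases hq : q = r
    · subst hq
      by_cases c : Cov w p q
      · have : (p : ℕ) < q := c.1
        rw [if_neg (by omega), if_pos ⟨rfl, c⟩, if_pos ⟨by omega, by omega, c⟩, zero_add]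
      · simp [c]
    · have hq' : (q : ℕ) ≠ r := fun h => hq (PNat.coe_injective h)
      rw [if_neg (c := q = r ∧ _) (fun h => hq h.1), add_zero]
      refine if_congr ?_ rfl rfl
      constructor
      · rintro ⟨h1, h2, h3⟩
        exact ⟨by omega, by omega, h3⟩
      · rintro ⟨h1, h2, h3⟩
        exact ⟨by omega, by omega, h3⟩

theorem moveOp_monkOp_self {R : Type*} [AddCommGroup R] {N r : ℕ+} (v : ℕ+) (φ : PPerm → R)
    (w : PPerm) : moveOp N r v (monkOp N r v φ) w = 0 := by
  unfold moveOp
  refine Finset.sum_eq_zero fun q _ => ?_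
  split_ifs with h
  · obtain ⟨h1, h2, h3⟩ := h
    have hrq : r < q := h2
    unfold monkOp
    rw [inv_mul_tr_apply, tr_left, if_neg hrq.ne', if_neg fun h => absurd h.1 (not_lt.mpr hrq.le),
      sub_zero]
  · rfl

theorem ite_zero_congr {R : Type*} [Zero R] {a b : Prop} [Decidable a] [Decidable b] {x y : R} (h : a ↔ b)
    (hxy : a → x = y) : (if a then x else 0) = if b then y else 0 := by
  by_cases ha : a
  · rw [if_pos ha, if_pos (h.mp ha), hxy ha]
  · rw [if_neg ha, if_neg fun hb => ha (h.mpr hb)]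

theorem moveOp_monkOp {R : Type*} [AddCommGroup R] {N r : ℕ+} {i : ℕ} (hr : (r : ℕ) = i + 1)
    (hrN : r ≤ N) {a v : ℕ+} (hav : a < v) (φ : PPerm → R) (w : PPerm) :
    moveOp N (i + 1) v (monkOp N r a φ) w = monkOp N r a (moveOp N i v φ) w := by
  have hws : w (w⁻¹ a) < w (w⁻¹ v) := by simpa using hav
  unfold moveOp monkOp
  simp only [inv_mul_tr_apply]
  generalize w⁻¹ v = p at *
  generalize w⁻¹ a = s at *
  have hsp : s ≠ p := by rintro rfl; exact lt_irrefl _ hws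
  have key : ∀ q : ℕ+, (if (p : ℕ) ≤ i + 1 ∧ i + 1 < (q : ℕ) ∧ Cov w p q then
      (if tr p q s = r then ∑ q' ∈ Finset.Iic N,
        if Cov (w * tr p q) r q' then φ (w * tr p q * tr r q') else 0 else 0) -
        (if Cov (w * tr p q) (tr p q s) r then φ (w * tr p q * tr (tr p q s) r) else 0) else 0) =
      (if s = r then ∑ q' ∈ Finset.Iic N,
        if (p : ℕ) ≤ i + 1 ∧ i + 1 < (q : ℕ) ∧ Cov w p q ∧ Cov (w * tr p q) r q' then
          φ (w * tr p q * tr r q') else 0 else 0) -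
      if (p : ℕ) ≤ i + 1 ∧ i + 1 < (q : ℕ) ∧ Cov w p q ∧ Cov (w * tr p q) s r then
        φ (w * tr p q * tr s r) else 0 := by
    intro q
    by_cases c : (p : ℕ) ≤ i + 1 ∧ i + 1 < (q : ℕ) ∧ Cov w p q
    · obtain ⟨c1, c2, c3⟩ := c
      have hsq : s ≠ q := by rintro rfl; exact absurd c3.2.1 (not_lt.mpr hws.le)
      simp only [tr_ne hsp hsq, c1, c2, c3, true_and, if_true]
    · have c' : ∀ P : Prop, ¬ ((p : ℕ) ≤ i + 1 ∧ i + 1 < (q : ℕ) ∧ Cov w p q ∧ P) :=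
        fun P h => c ⟨h.1, h.2.1, h.2.2.1⟩
      simp only [c, c', if_false, Finset.sum_const_zero, sub_zero, ite_self]
  rw [Finset.sum_congr rfl fun q _ => key q, Finset.sum_sub_distrib]
  by_cases hsr : s = r
  · subst hsr
    have z1 : ∀ q : ℕ+, (if (p : ℕ) ≤ i + 1 ∧ i + 1 < (q : ℕ) ∧ Cov w p q ∧ Cov (w * tr p q) s s then
        φ (w * tr p q * tr s s) else 0) = 0 := fun q => if_neg fun h => h.2.2.2.irrefl
    simp only [if_true, z1, Finset.sum_const_zero, sub_zero, if_neg fun h : Cov w s s => h.irrefl]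
    rw [Finset.sum_comm]
    refine Finset.sum_congr rfl fun q' hq' => ?_
    by_cases hsq' : s < q'
    swap
    · rw [if_neg fun h => hsq' h.1]
      exact Finset.sum_eq_zero fun q _ => if_neg fun h => hsq' h.2.2.2.1
    rw [← Finset.sum_equiv (tr s q') (s := Finset.Iic N) (t := Finset.Iic N)
      (f := fun q => if (p : ℕ) ≤ i + 1 ∧ i + 1 < (tr s q' q : ℕ) ∧ Cov w p (tr s q' q) ∧
        Cov (w * tr p (tr s q' q)) s q' then φ (w * tr p (tr s q' q) * tr s q') else 0)
      (fun q => ?_) fun _ _ => rfl]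
    swap
    · have hq'N := Finset.mem_Iic.mp hq'
      rw [Finset.mem_Iic, Finset.mem_Iic]
      rcases tr_cases s q' q with ⟨h1, h2⟩ | ⟨h1, h2⟩ | ⟨h1, h1', h2⟩ <;> rw [h2]
      · exact iff_of_true (h1 ▸ hrN) hq'N
      · exact iff_of_true (h1 ▸ hq'N) hrN
    have hps : (p : ℕ) ≠ s := fun h => hsp (PNat.coe_injective h).symm
    have nsq' : (s : ℕ) < q' := hsq'
    split_ifs with hc
    swap
    · refine Finset.sum_eq_zero fun q _ => if_neg ?_
      generalize tr s q' q = q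
      rintro ⟨h1, h2, h3, h4⟩
      have hps' : p < s := by rw [← PNat.coe_lt_coe]; omega
      have hsq : s < q := by rw [← PNat.coe_lt_coe]; omega
      by_cases hqq' : q = q'
      · subst hqq'
        exact hc ((cov_swap_nested hps' hsq hws).mp ⟨h3, h4⟩).1
      · exact hc ((cov_swap_high hps' hsq hsq' hqq' hws).mp ⟨h3, h4⟩).1
    refine Finset.sum_congr rfl fun q _ => ?_
    by_cases hps' : p < s
    swap
    · have hsp' : s < p := lt_of_le_of_ne (not_lt.mp hps') hsp
      have nsp : (s : ℕ) < p := hsp'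
      rw [if_neg (by omega), if_neg]
      rintro ⟨hle, -⟩
      rcases tr_cases s q' p with ⟨h1, h2⟩ | ⟨h1, h2⟩ | ⟨h1, h1', h2⟩ <;> rw [h2] at hle
      · exact hsp h1.symm
      · omega
      · omega
    have nps : (p : ℕ) < s := hps'
    rw [tr_ne (x := p) hps'.ne (hps'.trans hsq').ne]
    rcases tr_cases s q' q with ⟨h1, h2⟩ | ⟨h1, h2⟩ | ⟨h1, h1', h2⟩ <;> rw [h2]
    · rw [h1]
      refine ite_zero_congr ?_ fun _ => ?_
      · rw [cov_swap_nested hps' hsq' hws]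
        exact ⟨fun h => ⟨by omega, by omega, h.2.2.2⟩, fun h => ⟨by omega, by omega, hc, h.2.2⟩⟩
      · rw [mul_tr_mul_tr_nested w hps'.ne (hps'.trans hsq').ne]
    · rw [h1, if_neg (by omega), if_neg]
      rintro ⟨-, -, -, h, -⟩
      rw [mul_tr_apply, mul_tr_apply, tr_right, tr_ne hps'.ne (hps'.trans hsq').ne] at h
      exact absurd h (not_lt.mpr hws.le)
    · have hqs : (q : ℕ) ≠ s := fun h => h1 (PNat.coe_injective h)
      by_cases hsq : s < q
      · have nsq : (s : ℕ) < q := hsq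
        refine ite_zero_congr ?_ fun _ => ?_
        · rw [cov_swap_high hps' hsq hsq' h1' hws]
          exact ⟨fun h => ⟨by omega, by omega, h.2.2.2⟩, fun h => ⟨by omega, by omega, hc, h.2.2⟩⟩
        · rw [mul_tr_mul_tr_of_ne w hps'.ne' hsq.ne (hps'.trans hsq').ne' (Ne.symm h1')]
      · have nsq : ¬ (s : ℕ) < q := hsq
        rw [if_neg (by omega), if_neg (by omega)]
  · simp only [if_neg hsr, Finset.sum_const_zero, zero_sub]
    rw [neg_inj]
    by_cases hlt : s < r
    swap
    · rw [if_neg fun h => hlt h.1]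
      exact Finset.sum_eq_zero fun q _ => if_neg fun h => hlt h.2.2.2.1
    have hlt' : (s : ℕ) < r := hlt
    have hpull : (if Cov w s r then ∑ q ∈ Finset.Iic N,
          if (tr s r p : ℕ) ≤ i ∧ i < (q : ℕ) ∧ Cov (w * tr s r) (tr s r p) q then
            φ (w * tr s r * tr (tr s r p) q) else 0 else 0) =
        ∑ q ∈ Finset.Iic N,
          if (tr s r p : ℕ) ≤ i ∧ i < (q : ℕ) ∧ Cov w s r ∧ Cov (w * tr s r) (tr s r p) q then
            φ (w * tr s r * tr (tr s r p) q) else 0 := by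
      by_cases hc : Cov w s r
      · simp only [hc, if_true, true_and]
      · simp only [hc, if_false, false_and, and_false, Finset.sum_const_zero]
    rw [hpull]
    refine Finset.sum_congr rfl fun q _ => ?_
    by_cases hpr : p = r
    · subst hpr
      rw [tr_right]
      by_cases hq : p < q
      · have hq' : (p : ℕ) < q := hq
        refine ite_zero_congr ?_ fun _ => ?_
        · rw [cov_swap_overlap hlt hq hws]
          exact ⟨fun h => ⟨by omega, by omega, h.2.2⟩, fun h => ⟨by omega, by omega, h.2.2⟩⟩
        · rw [mul_tr_mul_tr_overlap w hlt.ne hq.ne (hlt.trans hq).ne]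
      · have hq' : ¬ (p : ℕ) < q := hq
        rw [if_neg (by omega), if_neg]
        rintro ⟨h1, h2, h3, h4⟩
        have : q = p := PNat.coe_injective (by omega)
        subst this
        have := h4.2.1
        rw [mul_tr_apply, mul_tr_apply, tr_left, tr_right] at this
        exact absurd this (not_lt.mpr hws.le)
    · have hpr' : (p : ℕ) ≠ r := fun h => hpr (PNat.coe_injective h)
      rw [tr_ne (Ne.symm hsp) hpr]
      by_cases hlt_pr : p < r
      swap
      · have : ¬ (p : ℕ) < r := hlt_pr
        rw [if_neg (by omega), if_neg (by omega)]
      have npr : (p : ℕ) < r := hlt_pr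
      by_cases hq : r < q
      · have hq' : (r : ℕ) < q := hq
        refine ite_zero_congr ?_ fun _ => ?_
        · rw [cov_swap_low hlt_pr hlt hq hws]
          exact ⟨fun h => ⟨by omega, by omega, h.2.2⟩, fun h => ⟨by omega, by omega, h.2.2⟩⟩
        · rw [mul_tr_mul_tr_of_ne w hsp (hlt.trans hq).ne hlt_pr.ne' hq.ne]
      · have hq' : ¬ (r : ℕ) < q := hq
        rw [if_neg (by omega), if_neg]
        rintro ⟨h1, h2, h3, h4⟩
        have : q = r := PNat.coe_injective (by omega)
        subst this
        have := h4.2.1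
        rw [mul_tr_apply, mul_tr_apply, tr_right, tr_ne (Ne.symm hsp) hpr] at this
        exact absurd this (not_lt.mpr hws.le)

section PieriOp

variable {R : Type*}

theorem moveOp_sub [AddCommGroup R] (N : ℕ+) (i : ℕ) (v : ℕ+) (φ ψ : PPerm → R) :
    moveOp N i v (φ - ψ) = moveOp N i v φ - moveOp N i v ψ := by
  funext w
  simp only [moveOp, Pi.sub_apply, ← Finset.sum_sub_distrib]
  refine Finset.sum_congr rfl fun q _ => ?_
  split_ifs <;> simp

theorem moveOp_sum [AddCommGroup R] (N : ℕ+) (i : ℕ) (v : ℕ+) (s : Finset ℕ+)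
    (f : ℕ+ → PPerm → R) : moveOp N i v (∑ a ∈ s, f a) = ∑ a ∈ s, moveOp N i v (f a) := by
  funext w
  simp only [moveOp, Finset.sum_apply]
  rw [Finset.sum_comm]
  refine Finset.sum_congr rfl fun q _ => ?_
  split_ifs <;> simp

theorem monkOp_zero [AddCommGroup R] (N r a : ℕ+) : monkOp N r a (0 : PPerm → R) = 0 := by
  funext w
  simp [monkOp]

theorem monkOp_add [AddCommGroup R] (N r a : ℕ+) (φ ψ : PPerm → R) :
    monkOp N r a (φ + ψ) = monkOp N r a φ + monkOp N r a ψ := by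
  funext w
  have h : ∀ q, (if Cov w r q then φ (w * tr r q) + ψ (w * tr r q) else 0) =
      (if Cov w r q then φ (w * tr r q) else 0) + if Cov w r q then ψ (w * tr r q) else 0 := by
    intro q
    split_ifs <;> simp
  simp only [monkOp, Pi.add_apply, h, Finset.sum_add_distrib]
  split_ifs <;> abel

/-- The sum of the operators `monkOp N r a` over the values `a < v`. -/
def monkSum [AddCommGroup R] (N r v : ℕ+) (φ : PPerm → R) : PPerm → R :=
  ∑ a ∈ Finset.Iio v, monkOp N r a φ

theorem monkSum_zero [AddCommGroup R] (N r v : ℕ+) : monkSum N r v (0 : PPerm → R) = 0 := by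
  simp [monkSum, monkOp_zero]

theorem monkSum_add [AddCommGroup R] (N r v : ℕ+) (φ ψ : PPerm → R) :
    monkSum N r v (φ + ψ) = monkSum N r v φ + monkSum N r v ψ := by
  simp [monkSum, monkOp_add, Finset.sum_add_distrib]

theorem sum_Iio_succ {R : Type*} [AddCommMonoid R] (v : ℕ+) (f : ℕ+ → R) :
    ∑ a ∈ Finset.Iio (v + 1), f a = f v + ∑ a ∈ Finset.Iio v, f a := by
  have : Finset.Iio (v + 1) = insert v (Finset.Iio v) := by
    ext a
    rw [Finset.mem_insert, Finset.mem_Iio, Finset.mem_Iio, PNat.lt_add_one_iff, le_iff_eq_or_lt]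
  rw [this, Finset.sum_insert (by simp)]

theorem monkSum_succ [AddCommGroup R] (N r v : ℕ+) (φ : PPerm → R) :
    monkSum N r (v + 1) φ = monkOp N r v φ + monkSum N r v φ :=
  sum_Iio_succ v fun a => monkOp N r a φ

theorem moveOp_monkSum [AddCommGroup R] {N r : ℕ+} {i : ℕ} (hr : (r : ℕ) = i + 1) (hrN : r ≤ N)
    (v : ℕ+) (φ : PPerm → R) :
    moveOp N (i + 1) v (monkSum N r (v + 1) φ) = monkSum N r v (moveOp N i v φ) := by
  have h0 : moveOp N (i + 1) v (monkOp N r v φ) = 0 := by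
    rw [← hr]
    exact funext (moveOp_monkOp_self v φ)
  rw [monkSum, moveOp_sum, sum_Iio_succ, h0, zero_add]
  exact Finset.sum_congr rfl fun a ha =>
    funext (moveOp_monkOp hr hrN (Finset.mem_Iio.mp ha) φ)

/-- The operator summing over Pieri chains of length `d` whose values increase within
`[v, v + k)`. -/
def pieriOp [AddCommGroup R] (N : ℕ+) (i : ℕ) : ℕ → ℕ+ → ℕ → (PPerm → R) → PPerm → R
  | 0, _, 0, φ => φ
  | 0, _, _ + 1, _ => 0
  | k + 1, v, 0, φ => pieriOp N i k (v + 1) 0 φ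
  | k + 1, v, d + 1, φ =>
      pieriOp N i k (v + 1) (d + 1) φ + moveOp N i v (pieriOp N i k (v + 1) d φ)

theorem pieriOp_zero_right [AddCommGroup R] (N : ℕ+) (i k : ℕ) (v : ℕ+) (φ : PPerm → R) :
    pieriOp N i k v 0 φ = φ := by
  induction k generalizing v with
  | zero => rfl
  | succ k ih => exact ih (v + 1)

theorem pieriOp_succ_sub [AddCommGroup R] {N r : ℕ+} {i : ℕ} (hr : (r : ℕ) = i + 1)
    (hrN : r ≤ N) (M : ℕ+) (φ : PPerm → R) (k : ℕ) (v : ℕ+) (hM : (M : ℕ) = v + k) (d : ℕ) :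
    pieriOp N (i + 1) k v (d + 1) φ - pieriOp N (i + 1) k v d (monkSum N r M φ) =
      pieriOp N i k v (d + 1) φ - monkSum N r v (pieriOp N i k v d φ) := by
  have hmove : ∀ (v : ℕ+) (ψ : PPerm → R),
      moveOp N (i + 1) v ψ = moveOp N i v ψ + monkOp N r v ψ :=
    fun v ψ => funext (moveOp_succ hr hrN v ψ)
  induction k generalizing v d with
  | zero =>
    obtain rfl : M = v := PNat.coe_injective hM
    cases d with
    | zero => simp [pieriOp]
    | succ d => simp [pieriOp, monkSum_zero]
  | succ k ih =>
    have hM' : (M : ℕ) = (v + 1 : ℕ+) + k := by rw [hM, PNat.add_coe, PNat.one_coe]; omega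
    have h1 := ih (v + 1) hM' d
    cases d with
    | zero =>
      simp only [pieriOp, pieriOp_zero_right, zero_add] at h1 ⊢
      rw [add_sub_right_comm, h1, monkSum_succ, hmove]
      abel
    | succ d =>
      have h0 := ih (v + 1) hM' d
      have h2 := ih (v + 1) hM' (d + 1)
      simp only [pieriOp]
      have h3 : moveOp N (i + 1) v (pieriOp N (i + 1) k (v + 1) (d + 1) φ) -
          moveOp N (i + 1) v (pieriOp N (i + 1) k (v + 1) d (monkSum N r M φ)) =
          moveOp N i v (pieriOp N i k (v + 1) (d + 1) φ) +
            monkOp N r v (pieriOp N i k (v + 1) (d + 1) φ) -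
            monkSum N r v (moveOp N i v (pieriOp N i k (v + 1) d φ)) := by
        rw [← moveOp_sub, h0, moveOp_sub, moveOp_monkSum hr hrN, hmove]
      rw [add_sub_add_comm, h2, h3, monkSum_succ, monkSum_add]
      abel

theorem pieriOp_succ [AddCommGroup R] {N r : ℕ+} {i : ℕ} (hr : (r : ℕ) = i + 1)
    (hrN : r ≤ N) (φ : PPerm → R) (d : ℕ) :
    pieriOp N (i + 1) N 1 (d + 1) φ =
      pieriOp N i N 1 (d + 1) φ + pieriOp N (i + 1) N 1 d (monkSum N r (N + 1) φ) := by
  have h := pieriOp_succ_sub hr hrN (N + 1) φ N 1 (by rw [PNat.add_coe, add_comm]) d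
  have h0 : ∀ ψ : PPerm → R, monkSum N r 1 ψ = 0 := fun ψ =>
    Finset.sum_eq_zero fun a ha => absurd (Finset.mem_Iio.mp ha) (not_lt.mpr (one_le (a := a)))
  rw [h0, sub_zero] at h
  exact sub_eq_iff_eq_add.mp h

theorem moveOp_mul [Ring R] (N : ℕ+) (i : ℕ) (v : ℕ+) (c : R) (φ : PPerm → R) :
    moveOp N i v (fun u => c * φ u) = fun u => c * moveOp N i v φ u := by
  funext w
  simp only [moveOp, Finset.mul_sum, mul_ite, mul_zero]

theorem pieriOp_mul [Ring R] (N : ℕ+) (i k : ℕ) (v : ℕ+) (d : ℕ) (c : R) (φ : PPerm → R) :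
    pieriOp N i k v d (fun u => c * φ u) = fun u => c * pieriOp N i k v d φ u := by
  induction k generalizing v d with
  | zero =>
    cases d with
    | zero => rfl
    | succ d => simp [pieriOp, Pi.zero_def]
  | succ k ih =>
    cases d with
    | zero => exact ih (v + 1) 0
    | succ d =>
      simp only [pieriOp, ih, moveOp_mul]
      funext u
      simp [mul_add]

theorem Cov.le_succ {w : PPerm} {p q : ℕ+} (h : Cov w p q) {n : ℕ} (hw : FixedAbove n w)
    (hp : (p : ℕ) ≤ n) : (q : ℕ) ≤ n + 1 := by
  by_contra hq
  push Not at hq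
  have h1 : (w p : ℕ) ≤ n := hw.apply_le hp
  have h2 : w q = q := hw q (by omega)
  have h3 : w n.succPNat = n.succPNat := hw _ (by simp)
  have h4 : (n.succPNat : ℕ) = n + 1 := rfl
  refine h.2.2 n.succPNat ?_ ?_ ⟨?_, ?_⟩
  · rw [← PNat.coe_lt_coe]; omega
  · rw [← PNat.coe_lt_coe]; omega
  · rw [h3, ← PNat.coe_lt_coe]; omega
  · rw [h3, h2, ← PNat.coe_lt_coe]; omega

theorem Cov.fixedAbove {w : PPerm} {p q : ℕ+} (h : Cov w p q) {n : ℕ} (hw : FixedAbove n w)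
    (hp : (p : ℕ) ≤ n) : FixedAbove (n + 1) (w * tr p q) :=
  (hw.mono n.le_succ).mul_tr (by omega) (h.le_succ hw hp)

theorem moveOp_congr [AddCommGroup R] {N : ℕ+} {i n : ℕ} (hin : i ≤ n) {v : ℕ+}
    {φ ψ : PPerm → R} (h : ∀ u, FixedAbove (n + 1) u → φ u = ψ u) {w : PPerm}
    (hw : FixedAbove n w) : moveOp N i v φ w = moveOp N i v ψ w := by
  refine Finset.sum_congr rfl fun q _ => ite_zero_congr Iff.rfl fun hc => ?_
  exact h _ (hc.2.2.fixedAbove hw (hc.1.trans hin))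

theorem pieriOp_congr [AddCommGroup R] {N : ℕ+} {i n d : ℕ} (hin : i ≤ n) {φ ψ : PPerm → R}
    (h : ∀ u, FixedAbove (n + d) u → φ u = ψ u) (k : ℕ) (v : ℕ+) {w : PPerm}
    (hw : FixedAbove n w) : pieriOp N i k v d φ w = pieriOp N i k v d ψ w := by
  induction k generalizing v d n w with
  | zero =>
    cases d with
    | zero => exact h w hw
    | succ d => rfl
  | succ k ih =>
    cases d with
    | zero => exact ih hin h (v + 1) hw
    | succ d =>
      simp only [pieriOp, Pi.add_apply]
      rw [ih hin h (v + 1) hw]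
      congr 1
      exact moveOp_congr hin (fun u hu => ih (by omega)
        (fun x hx => h x (hx.mono (by omega))) (v + 1) hu) hw

end PieriOp

theorem monkSum_schubert {S : PPerm → MvPolynomial ℕ+ ℤ} (hS : IsSchubertFamily S) {m : ℕ}
    {N : ℕ+} (hN : (N : ℕ) = m + 1) {w : PPerm} (hw : FixedAbove m w) {r : ℕ+}
    (hr : (r : ℕ) ≤ m) : monkSum N r (N + 1) S w = MvPolynomial.X r * S w := by
  rw [monk hS hN hw hr, monkSum, Finset.sum_apply]
  have hinv : ∀ x, w⁻¹ (w x) = x := w.symm_apply_apply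
  have hw' : FixedAbove N w := hw.mono (by omega)
  have hset : Finset.Iio (N + 1) = Finset.Iic N := by
    ext a
    rw [Finset.mem_Iio, Finset.mem_Iic, PNat.lt_add_one_iff]
  rw [hset, ← Finset.sum_equiv w (s := Finset.Iic N) (t := Finset.Iic N)
    (f := fun p => monkOp N r (w p) S w) (fun p => ?_) fun _ _ => rfl]
  · simp only [monkOp, hinv]
    rw [Finset.sum_sub_distrib, Finset.sum_sub_distrib, Finset.sum_ite_eq', if_pos]
    · rfl
    · rw [Finset.mem_Iic, ← PNat.coe_le_coe]; omega
  · rw [Finset.mem_Iic, Finset.mem_Iic]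
    refine ⟨fun h => hw'.apply_le h, fun h => ?_⟩
    have := hw'.inv.apply_le h
    rwa [hinv] at this

theorem sum_sym_option {α R : Type*} [CommSemiring R] (d : ℕ) [Fintype (Sym (Option α) (d + 1))]
    [Fintype (Sym (Option α) d)] [Fintype (Sym α (d + 1))] (f : Option α → R) :
    ∑ m : Sym (Option α) (d + 1), ((m : Multiset (Option α)).map f).prod =
      f none * ∑ m : Sym (Option α) d, ((m : Multiset (Option α)).map f).prod +
        ∑ m : Sym α (d + 1), ((m : Multiset α).map fun a => f (some a)).prod := by
  rw [← Equiv.sum_comp (symOptionSuccEquiv (α := α) (n := d)).symm, Fintype.sum_sum_type,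
    Finset.mul_sum]
  congr 1
  · refine Finset.sum_congr rfl fun m _ => ?_
    change (Multiset.map f ((none ::ₛ m : Sym (Option α) (d + 1)) : Multiset (Option α))).prod = _
    rw [Sym.coe_cons, Multiset.map_cons, Multiset.prod_cons]
  · refine Finset.sum_congr rfl fun m _ => ?_
    change (Multiset.map f ((m.map some : Sym (Option α) (d + 1)) : Multiset (Option α))).prod = _
    rw [Sym.coe_map, Multiset.map_map]
    rfl

theorem sum_sym_equiv {α β R : Type*} [CommSemiring R] (d : ℕ) [Fintype (Sym α d)]
    [Fintype (Sym β d)] (e : α ≃ β) (f : β → R) : ∑ m : Sym β d, ((m : Multiset β).map f).prod =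
      ∑ m : Sym α d, ((m : Multiset α).map fun a => f (e a)).prod := by
  rw [← Equiv.sum_comp (Sym.equivCongr e)]
  refine Finset.sum_congr rfl fun m _ => ?_
  change (Multiset.map f ((m.map e : Sym β d) : Multiset β)).prod = _
  rw [Sym.coe_map, Multiset.map_map]
  rfl

theorem hPoly_zero_right (i : ℕ) : hPoly i 0 = 1 := by
  simp [hPoly, Sym.eq_nil_of_card_zero]

theorem hPoly_zero_left (d : ℕ) : hPoly 0 (d + 1) = 0 := by
  simp [hPoly]

theorem hPoly_succ_succ (i d : ℕ) :
    hPoly (i + 1) (d + 1) =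
      hPoly i (d + 1) + MvPolynomial.X i.succPNat * hPoly (i + 1) d := by
  unfold hPoly
  rw [sum_sym_equiv (d + 1) (finSuccEquivLast (n := i)).symm, sum_sym_option,
    sum_sym_equiv d (finSuccEquivLast (n := i)).symm, add_comm]
  simp

theorem pieriOp_schubert {S : PPerm → MvPolynomial ℕ+ ℤ} (hS : IsSchubertFamily S) {N : ℕ+}
    {i n d : ℕ} (hin : i ≤ n) (hN : n + d ≤ N) {w : PPerm} (hw : FixedAbove n w) :
    pieriOp N i N 1 d S w = S w * hPoly i d := by
  induction i generalizing d with
  | zero =>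
    cases d with
    | zero => rw [pieriOp_zero_right, hPoly_zero_right, mul_one]
    | succ d =>
      rw [hPoly_zero_left, mul_zero]
      have hmove : ∀ (v : ℕ+) (ψ : PPerm → MvPolynomial ℕ+ ℤ), moveOp N 0 v ψ = 0 := by
        refine fun v ψ => funext fun u => Finset.sum_eq_zero fun q _ => if_neg fun h => ?_
        exact absurd h.1 (not_le.mpr (PNat.pos _))
      have h : ∀ (k : ℕ) (v : ℕ+), pieriOp N 0 k v (d + 1) S = 0 := by
        intro k
        induction k with
        | zero => exact fun v => rfl
        | succ k ih => intro v; rw [pieriOp, ih, hmove, add_zero]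
      rw [h]
      rfl
  | succ i ih =>
    induction d with
    | zero => rw [pieriOp_zero_right, hPoly_zero_right, mul_one]
    | succ d ihd =>
      obtain ⟨m, hm⟩ : ∃ m, (N : ℕ) = m + 1 := ⟨N - 1, by have := N.pos; omega⟩
      have hr : (i.succPNat : ℕ) = i + 1 := rfl
      rw [pieriOp_succ hr (by rw [← PNat.coe_le_coe]; omega), Pi.add_apply, ih (by omega) hN,
        pieriOp_congr hin (ψ := fun u => MvPolynomial.X i.succPNat * S u)
          (fun u hu => monkSum_schubert hS hm (hu.mono (by omega)) (by omega)) N 1 hw,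
        pieriOp_mul, hPoly_succ_succ]
      beta_reduce
      rw [ihd (by omega)]
      ring

/-- `Chain i v d w u` says that `u` is reached from `w` by `d` covers, each exchanging a position
`≤ i` with a position `> i`, such that the successive values moved out of the positions `≤ i`
increase and are at least `v`. -/
inductive Chain (i : ℕ) : ℕ+ → ℕ → PPerm → PPerm → Prop
  | nil (v : ℕ+) (w : PPerm) : Chain i v 0 w w
  | cons {v : ℕ+} {d : ℕ} {w u : PPerm} {p q : ℕ+} (hp : (p : ℕ) ≤ i) (hq : i < (q : ℕ))
      (hc : Cov w p q) (hv : v ≤ w p) (h : Chain i (w p + 1) d (w * tr p q) u) :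
      Chain i v (d + 1) w u

theorem chain_zero_iff {i : ℕ} {v : ℕ+} {w u : PPerm} : Chain i v 0 w u ↔ u = w := by
  constructor
  · rintro ⟨⟩
    rfl
  · rintro rfl
    exact .nil v u

theorem chain_succ_iff {i d : ℕ} {v : ℕ+} {w u : PPerm} :
    Chain i v (d + 1) w u ↔ ∃ p q : ℕ+, ((p : ℕ) ≤ i ∧ i < (q : ℕ) ∧ Cov w p q ∧ v ≤ w p) ∧
      Chain i (w p + 1) d (w * tr p q) u := by
  constructor
  · rintro ⟨⟩
    exact ⟨_, _, ⟨‹_›, ‹_›, ‹_›, ‹_›⟩, ‹_›⟩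
  · rintro ⟨p, q, ⟨h1, h2, h3, h4⟩, h5⟩
    exact .cons h1 h2 h3 h4 h5

theorem Chain.apply_eq_or {i d : ℕ} {v : ℕ+} {w u : PPerm} (h : Chain i v d w u) (q : ℕ+)
    (hq : i < (q : ℕ)) : u q = w q ∨ v ≤ u q ∧ u q < w q := by
  induction h with
  | nil v w => exact Or.inl rfl
  | @cons v d w u p q' hp hq' hc hv h ih =>
    have hqp : q ≠ p := by
      rintro rfl
      omega
    by_cases hqq : q = q'
    · subst hqq
      rw [mul_tr_apply, tr_right] at ih
      refine Or.inr ?_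
      rcases ih with h1 | ⟨h1, h2⟩
      · rw [h1]
        exact ⟨hv, hc.2.1⟩
      · exact absurd h2 (not_lt.mpr ((PNat.lt_add_right _ 1).le.trans h1))
    · rw [mul_tr_apply, tr_ne hqp hqq] at ih
      exact ih.imp_right fun h => ⟨(hv.trans (PNat.lt_add_right _ 1).le).trans h.1, h.2⟩

theorem chain_succ_iff_or {i d : ℕ} {v : ℕ+} {w u : PPerm} :
    Chain i v (d + 1) w u ↔ Chain i (v + 1) (d + 1) w u ∨
      ∃ q : ℕ+, (((w⁻¹ v : ℕ+) : ℕ) ≤ i ∧ i < (q : ℕ) ∧ Cov w (w⁻¹ v) q) ∧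
        Chain i (v + 1) d (w * tr (w⁻¹ v) q) u := by
  have hwv : w (w⁻¹ v) = v := w.apply_symm_apply v
  rw [chain_succ_iff, chain_succ_iff]
  constructor
  · rintro ⟨p, q, ⟨h1, h2, h3, h4⟩, h5⟩
    rcases h4.eq_or_lt with h | h
    · right
      obtain rfl : p = w⁻¹ v := by rw [h]; exact (w.symm_apply_apply p).symm
      rw [hwv] at h5
      exact ⟨q, ⟨h1, h2, h3⟩, h5⟩
    · left
      exact ⟨p, q, ⟨h1, h2, h3, PNat.add_one_le_iff.mpr h⟩, h5⟩
  · rintro (⟨p, q, ⟨h1, h2, h3, h4⟩, h5⟩ | ⟨q, ⟨h1, h2, h3⟩, h5⟩)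
    · exact ⟨p, q, ⟨h1, h2, h3, (PNat.lt_add_right _ 1).le.trans h4⟩, h5⟩
    · exact ⟨_, q, ⟨h1, h2, h3, hwv.ge⟩, by rwa [hwv]⟩

theorem Chain.apply_eq {i d : ℕ} {v q : ℕ+} {w u : PPerm} (hq : i < (q : ℕ))
    (h : Chain i (v + 1) d (w * tr (w⁻¹ v) q) u) : u q = v := by
  have hwv : w (w⁻¹ v) = v := w.apply_symm_apply v
  have := h.apply_eq_or q hq
  rw [mul_tr_apply, tr_right, hwv] at this
  rcases this with h1 | ⟨h1, h2⟩
  · exact h1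
  · exact absurd h2 (not_lt.mpr ((PNat.lt_add_right _ 1).le.trans h1))

theorem pieriOp_eq_finsum {R : Type*} [AddCommGroup R] {N : ℕ+} {i : ℕ} (φ : PPerm → R) (k : ℕ)
    {n d : ℕ} {v : ℕ+} (hv : (v : ℕ) + k = N + 1) (hin : i ≤ n) (hN : n + d ≤ N) {w : PPerm}
    (hw : FixedAbove n w) :
    {u | Chain i v d w u}.Finite ∧ pieriOp N i k v d φ w = ∑ᶠ u ∈ {u | Chain i v d w u}, φ u := by
  induction k generalizing n d v w with
  | zero =>
    cases d with
    | zero =>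
      simp only [chain_zero_iff, pieriOp]
      exact ⟨Set.finite_singleton w, (finsum_mem_singleton (f := φ) (a := w)).symm⟩
    | succ d =>
      have he : {u | Chain i v (d + 1) w u} = ∅ := by
        ext u
        rw [Set.mem_ofPred_eq, chain_succ_iff]
        simp only [Set.mem_empty_iff_false, iff_false]
        rintro ⟨p, q, ⟨h1, h2, h3, h4⟩, h5⟩
        have h6 := hw.apply_le (h1.trans hin)
        have h7 : (v : ℕ) ≤ w p := h4
        omega
      rw [he]
      exact ⟨Set.finite_empty, by rw [finsum_mem_empty]; rfl⟩
  | succ k ih =>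
    have hv' : ((v + 1 : ℕ+) : ℕ) + k = N + 1 := by rw [PNat.add_coe, PNat.one_coe]; omega
    cases d with
    | zero =>
      simp only [chain_zero_iff, pieriOp_zero_right]
      exact ⟨Set.finite_singleton w, (finsum_mem_singleton (f := φ) (a := w)).symm⟩
    | succ d =>
      obtain ⟨hA, hA'⟩ := ih hv' hin hN hw
      set A := {u | Chain i (v + 1) (d + 1) w u}
      let B : ℕ+ → Set PPerm := fun q => {u | (((w⁻¹ v : ℕ+) : ℕ) ≤ i ∧ i < (q : ℕ) ∧
        Cov w (w⁻¹ v) q) ∧ Chain i (v + 1) d (w * tr (w⁻¹ v) q) u}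
      have hB : ∀ q, (B q).Finite ∧ (if ((w⁻¹ v : ℕ+) : ℕ) ≤ i ∧ i < (q : ℕ) ∧
          Cov w (w⁻¹ v) q then pieriOp N i k (v + 1) d φ (w * tr (w⁻¹ v) q) else 0) =
          ∑ᶠ u ∈ B q, φ u := by
        intro q
        by_cases hc : ((w⁻¹ v : ℕ+) : ℕ) ≤ i ∧ i < (q : ℕ) ∧ Cov w (w⁻¹ v) q
        · have hBq : B q = {u | Chain i (v + 1) d (w * tr (w⁻¹ v) q) u} := by
            ext u
            exact and_iff_right hc
          rw [hBq, if_pos hc]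
          exact ih hv' (by omega) (by omega) (hc.2.2.fixedAbove hw (hc.1.trans hin))
        · have hBq : B q = ∅ := by
            ext u
            exact iff_of_false (fun h => hc h.1) id
          rw [hBq, if_neg hc, finsum_mem_empty]
          exact ⟨Set.finite_empty, rfl⟩
      have hset : {u | Chain i v (d + 1) w u} =
          A ∪ ⋃ q ∈ ((Finset.Iic N : Finset ℕ+) : Set ℕ+), B q := by
        ext u
        rw [Set.mem_ofPred_eq, chain_succ_iff_or, Set.mem_union, Set.mem_iUnion₂]
        refine or_congr Iff.rfl ⟨?_, ?_⟩
        · rintro ⟨q, h1, h2⟩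
          refine ⟨q, ?_, h1, h2⟩
          have := h1.2.2.le_succ hw (h1.1.trans hin)
          rw [Finset.mem_coe, Finset.mem_Iic, ← PNat.coe_le_coe]
          omega
        · rintro ⟨q, -, h⟩
          exact ⟨q, h⟩
      have hfin : (⋃ q ∈ ((Finset.Iic N : Finset ℕ+) : Set ℕ+), B q).Finite :=
        (Finset.finite_toSet _).biUnion fun q _ => (hB q).1
      have hdisj : Disjoint A (⋃ q ∈ ((Finset.Iic N : Finset ℕ+) : Set ℕ+), B q) := by
        rw [Set.disjoint_left]
        intro u hu hu'
        obtain ⟨q, -, h1, h2⟩ := Set.mem_iUnion₂.mp hu'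
        have h3 := h2.apply_eq h1.2.1
        have h4 := h1.2.2.2.1
        rw [show w (w⁻¹ v) = v from w.apply_symm_apply v] at h4
        rcases Chain.apply_eq_or hu q h1.2.1 with h5 | ⟨h5, -⟩
        · exact h4.ne (h3.symm.trans h5)
        · rw [h3] at h5
          exact absurd h5 (not_le.mpr (PNat.lt_add_right v 1))
      have hpair : ((Finset.Iic N : Finset ℕ+) : Set ℕ+).PairwiseDisjoint B := by
        intro q _ q' _ hne
        refine Set.disjoint_left.mpr fun u hu hu' => hne (u.injective ?_)
        rw [hu.2.apply_eq hu.1.2.1, hu'.2.apply_eq hu'.1.2.1]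
      rw [hset]
      refine ⟨hA.union hfin, ?_⟩
      rw [finsum_mem_union hdisj hA hfin, finsum_mem_biUnion hpair (Finset.finite_toSet _)
        fun q _ => (hB q).1, finsum_mem_coe_finset, pieriOp, Pi.add_apply, hA', moveOp]
      congr 1
      exact Finset.sum_congr rfl fun q _ => (hB q).2

theorem wSeq_zero (w : PPerm) (d : ℕ) (p q : Fin d → ℕ+) : wSeq w d p q 0 = w := by
  simp [wSeq]

theorem trList_succ (d : ℕ) (p q : Fin (d + 1) → ℕ+) :
    trList (d + 1) p q = tr (p 0) (q 0) :: trList d (Fin.tail p) (Fin.tail q) :=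
  List.ofFn_succ

theorem wSeq_succ (w : PPerm) (d : ℕ) (p q : Fin (d + 1) → ℕ+) (j : ℕ) :
    wSeq w (d + 1) p q (j + 1) =
      wSeq (w * tr (p 0) (q 0)) d (Fin.tail p) (Fin.tail q) j := by
  rw [wSeq, trList_succ, List.take_succ_cons, List.prod_cons, ← mul_assoc, wSeq]

theorem isXFact_succ {w : PPerm} {i d : ℕ} {p q : Fin (d + 1) → ℕ+} :
    IsXFact w i (d + 1) p q ↔
      ((p 0 : ℕ) ≤ i ∧ i < (q 0 : ℕ) ∧ len (w * tr (p 0) (q 0)) = len w + 1) ∧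
      IsXFact (w * tr (p 0) (q 0)) i d (Fin.tail p) (Fin.tail q) ∧
      ∀ j : Fin d, w (p 0) < wSeq (w * tr (p 0) (q 0)) d (Fin.tail p) (Fin.tail q) j
        (Fin.tail p j) := by
  unfold IsXFact
  simp only [Fin.forall_fin_succ (n := d), Fin.val_zero, Fin.val_succ, wSeq_succ, wSeq_zero,
    Fin.succ_lt_succ_iff, Fin.succ_pos, Fin.not_lt_zero, forall_true_left,
    false_imp_iff, true_and]
  simp only [Fin.tail]
  tauto

theorem chain_iff_exists_isXFact {n : ℕ} {i d : ℕ} {v : ℕ+} {w ζ : PPerm} (hw : FixedAbove n w) :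
    Chain i v d w (w * ζ) ↔ ∃ p q : Fin d → ℕ+, ζ = (trList d p q).prod ∧ IsXFact w i d p q ∧
      ∀ j : Fin d, v ≤ wSeq w d p q j (p j) := by
  induction d generalizing n v w ζ with
  | zero =>
    rw [chain_zero_iff, mul_eq_left]
    constructor
    · rintro rfl
      exact ⟨Fin.elim0, Fin.elim0, by simp [trList], by simp [IsXFact], fun j => j.elim0⟩
    · rintro ⟨p, q, h, -⟩
      simpa [trList] using h
  | succ d ih =>
    rw [chain_succ_iff]
    constructor
    · rintro ⟨p, q, ⟨h1, h2, h3, h4⟩, h5⟩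
      obtain ⟨m, hm⟩ := hw.exists_mul_tr p q
      have hζ : w * ζ = w * tr p q * (tr p q * ζ) := by
        rw [← mul_assoc, mul_tr_mul_tr]
      rw [hζ, ih hm] at h5
      obtain ⟨p', q', h6, h7, h8⟩ := h5
      refine ⟨Fin.cons p p', Fin.cons q q', ?_, ?_, ?_⟩
      · rw [trList_succ, List.prod_cons, Fin.tail_cons, Fin.tail_cons, ← h6]
        simp [tr]
      · rw [isXFact_succ]
        simp only [Fin.tail_cons, Fin.cons_zero]
        exact ⟨⟨h1, h2, (len_mul_tr_eq_iff_cov hw h3.1).mpr h3⟩, h7,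
          fun j => PNat.add_one_le_iff.mp (h8 j)⟩
      · rw [Fin.forall_fin_succ]
        simp only [Fin.val_zero, Fin.val_succ, wSeq_succ, wSeq_zero, Fin.tail_cons, Fin.cons_zero,
          Fin.cons_succ]
        exact ⟨h4, fun j => h4.trans (PNat.add_one_le_iff.mp (h8 j)).le⟩
    · rintro ⟨p, q, h1, h2, h3⟩
      rw [isXFact_succ] at h2
      obtain ⟨⟨h4, h5, h6⟩, h7, h8⟩ := h2
      obtain ⟨m, hm⟩ := hw.exists_mul_tr (p 0) (q 0)
      have hlt : p 0 < q 0 := by rw [← PNat.coe_lt_coe]; omega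
      refine ⟨p 0, q 0, ⟨h4, h5, (len_mul_tr_eq_iff_cov hw hlt).mp h6, ?_⟩, ?_⟩
      · simpa [wSeq_zero] using h3 0
      · rw [h1, trList_succ, List.prod_cons, ← mul_assoc, ih hm]
        exact ⟨Fin.tail p, Fin.tail q, rfl, h7, fun j => PNat.add_one_le_iff.mpr (h8 j)⟩

theorem mem_XSet_iff {n : ℕ} {i d : ℕ} {w ζ : PPerm} (hw : FixedAbove n w) :
    ζ ∈ XSet w i d ↔ Chain i 1 d w (w * ζ) := by
  rw [chain_iff_exists_isXFact hw]
  exact exists₂_congr fun p q => and_congr_right fun _ =>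
    ⟨fun h => ⟨h, fun j => one_le⟩, fun h => h.1⟩

theorem finsum_XSet {R : Type*} [AddCommMonoid R] {n : ℕ} {i d : ℕ} {w : PPerm}
    (hw : FixedAbove n w) (φ : PPerm → R) :
    ∑ᶠ ζ ∈ XSet w i d, φ (w * ζ) = ∑ᶠ u ∈ {u | Chain i 1 d w u}, φ u := by
  refine finsum_mem_eq_of_bijOn (fun ζ => w * ζ) ⟨fun ζ hζ => (mem_XSet_iff hw).mp hζ,
    (mul_right_injective w).injOn, fun u hu => ?_⟩ fun _ _ => rfl
  refine ⟨w⁻¹ * u, (mem_XSet_iff hw).mpr ?_, mul_inv_cancel_left w u⟩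
  rwa [mul_inv_cancel_left]

end Pieri

/-- **Pieri rule for Schubert polynomials**:
`𝔖_w · h_d(x₁, …, x_i) = Σ_{ζ ∈ X_{i,d}(w)} 𝔖_{wζ}`. -/
theorem pieri_rule_for_schubert_polynomials
    (S : PPerm → MvPolynomial ℕ+ ℤ) (hS : IsSchubertFamily S)
    (w : PPerm) (hw : HasFinSupp w) (i d : ℕ) (hi : 1 ≤ i) :
    S w * hPoly i d = ∑ᶠ ζ ∈ XSet w i d, S (w * ζ) := by
  obtain ⟨m, hm⟩ := hw.exists_fixedAbove
  have hn : Pieri.FixedAbove (max m i) w := hm.mono (le_max_left m i)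
  have hin : i ≤ max m i := le_max_right m i
  have hN : max m i + d ≤ ((max m i + d).succPNat : ℕ) := Nat.le_succ _
  rw [Pieri.finsum_XSet hn, ← Pieri.pieriOp_schubert hS hin hN hn]
  refine (Pieri.pieriOp_eq_finsum S _ ?_ hin hN hn).2
  rw [PNat.one_coe, add_comm]

end
end

section
/- (Dual Pieri rule for Schubert polynomials) For every permutation w and all integers i ≥ 1, d ≥ 0, one has 𝔖_w · e_d(x₁,…,x_i) = Σ_{ζ ∈ Y_{i,d}(w)} 𝔖_{wζ}, where e_d is the elementary symmetric polynomial of degree d. -/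
open scoped Classical

noncomputable section

/-- All positions from `N` on are fixed by `w`. -/
def FixesFrom (N : ℕ) (w : PPerm) : Prop := ∀ k : ℕ+, N ≤ (k : ℕ) → w k = k

/-- The combinatorial form of the covering relation `w t_{pq} ⋗ w`. -/
def Cov (w : PPerm) (p q : ℕ+) : Prop :=
  p < q ∧ w p < w q ∧ ∀ c, p < c → c < q → ¬(w p < w c ∧ w c < w q)

lemma tr_apply (p q c : ℕ+) : tr p q c = if c = p then q else if c = q then p else c :=
  Equiv.swap_apply_def p q c

lemma tr_left (p q : ℕ+) : tr p q p = q := Equiv.swap_apply_left p q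

lemma tr_right (p q : ℕ+) : tr p q q = p := Equiv.swap_apply_right p q

lemma tr_of_ne {p q c : ℕ+} (hp : c ≠ p) (hq : c ≠ q) : tr p q c = c :=
  Equiv.swap_apply_of_ne_of_ne hp hq

lemma tr_tr (p q c : ℕ+) : tr p q (tr p q c) = c := Equiv.swap_apply_self p q c

lemma tr_mul_self (p q : ℕ+) : tr p q * tr p q = 1 := Equiv.swap_mul_self p q

lemma mul_tr_mul_tr (w : PPerm) (p q : ℕ+) : w * tr p q * tr p q = w := by
  rw [mul_assoc, tr_mul_self, mul_one]

lemma inv_mul_tr (w : PPerm) (p q n : ℕ+) : (w * tr p q)⁻¹ n = tr p q (w⁻¹ n) := by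
  rw [mul_inv_rev, tr, Equiv.swap_inv, Equiv.Perm.mul_apply]

lemma not_lt_and_lt_add_one (j c : ℕ+) : ¬(j < c ∧ c < j + 1) := by
  rintro ⟨h, h'⟩
  exact absurd (PNat.lt_add_one_iff.1 h') (not_le.2 h)

lemma tr_succ_lt {j a b : ℕ+} (h : a < b) (hne : ¬(a = j ∧ b = j + 1)) :
    tr j (j + 1) a < tr j (j + 1) b := by
  have h1 := not_lt_and_lt_add_one j a
  have h2 := not_lt_and_lt_add_one j b
  have h3 : j < j + 1 := PNat.lt_add_right j 1
  simp only [tr_apply]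
  grind

lemma FixesFrom.mono {N N' : ℕ} {w : PPerm} (h : FixesFrom N w) (hN : N ≤ N') :
    FixesFrom N' w := fun k hk => h k (hN.trans hk)

lemma FixesFrom.apply_lt {N : ℕ} {w : PPerm} (h : FixesFrom N w) {k : ℕ+} {m : ℕ} (hm : N ≤ m)
    (hk : (k : ℕ) < m) : (w k : ℕ) < m := by
  by_contra! hc
  have := w.injective (h (w k) (hm.trans hc))
  rw [this] at hc
  omega

lemma FixesFrom.mul_tr {N : ℕ} {w : PPerm} (h : FixesFrom N w) {p q : ℕ+} (hp : (p : ℕ) < N)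
    (hq : (q : ℕ) < N) : FixesFrom N (w * tr p q) := by
  intro k hk
  have h1 : k ≠ p := by rintro rfl; omega
  have h2 : k ≠ q := by rintro rfl; omega
  rw [Equiv.Perm.mul_apply, tr_apply, if_neg h1, if_neg h2, h k hk]

lemma HasFinSupp.exists_fixesFrom {w : PPerm} (h : HasFinSupp w) : ∃ N, FixesFrom N w := by
  obtain ⟨B, hB⟩ := h.bddAbove
  refine ⟨B + 1, fun k hk => ?_⟩
  by_contra hc
  have : (k : ℕ) ≤ B := hB hc
  omega

lemma FixesFrom.finite_invSet {N : ℕ} {w : PPerm} (h : FixesFrom N w) : (invSet w).Finite := by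
  have hf : {k : ℕ+ | (k : ℕ) < N}.Finite :=
    Set.Finite.of_finite_image ((Set.finite_lt_nat N).subset (by rintro _ ⟨k, hk, rfl⟩; exact hk))
      (f := ((↑) : ℕ+ → ℕ)) PNat.coe_injective.injOn
  refine (hf.prod hf).subset ?_
  rintro ⟨a, b⟩ ⟨hab, hw⟩
  have hab' : (a : ℕ) < b := hab
  have hw' : (w b : ℕ) < w a := hw
  have hb : (b : ℕ) < N := by
    by_contra! hc
    rw [h b hc] at hw'
    have := h.apply_lt hc hab'
    omega
  exact ⟨by simp only [Set.mem_ofPred_eq]; omega, hb⟩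

lemma HasFinSupp.mul_tr {w : PPerm} (h : HasFinSupp w) (p q : ℕ+) : HasFinSupp (w * tr p q) := by
  refine (h.union (Set.toFinite {p, q})).subset fun k hk => ?_
  by_contra hc
  simp only [Set.mem_union, Set.mem_ofPred_eq, Set.mem_insert_iff, Set.mem_singleton_iff,
    not_or, not_not] at hc
  exact hk (by rw [Equiv.Perm.mul_apply, tr_apply, if_neg hc.2.1, if_neg hc.2.2, hc.1])

lemma HasFinSupp.finite_invSet {w : PPerm} (h : HasFinSupp w) : (invSet w).Finite :=
  h.exists_fixesFrom.choose_spec.finite_invSet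

lemma FixesFrom.hasFinSupp {N : ℕ} {w : PPerm} (h : FixesFrom N w) : HasFinSupp w := by
  refine Set.Finite.of_finite_image (f := ((↑) : ℕ+ → ℕ)) ((Set.finite_lt_nat N).subset ?_)
    PNat.coe_injective.injOn
  rintro _ ⟨k, hk, rfl⟩
  by_contra hc
  exact hk (h k (not_lt.1 hc))

lemma len_mul_tr_of_asc {w : PPerm} (hw : HasFinSupp w) {j : ℕ+} (h : w j < w (j + 1)) :
    len (w * tr j (j + 1)) = len w + 1 := by
  have h3 : j < j + 1 := PNat.lt_add_right j 1
  have key : invSet (w * tr j (j + 1)) =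
      insert (j, j + 1) (Prod.map (tr j (j + 1)) (tr j (j + 1)) '' invSet w) := by
    ext ⟨a, b⟩
    simp only [invSet, Set.mem_ofPred_eq, Set.mem_insert_iff, Set.mem_image, Prod.exists,
      Prod.map_apply, Prod.mk.injEq, Equiv.Perm.mul_apply]
    constructor
    · rintro ⟨hab, hlt⟩
      by_cases hj : a = j ∧ b = j + 1
      · exact Or.inl hj
      · exact Or.inr ⟨_, _, ⟨tr_succ_lt hab hj, hlt⟩, tr_tr .., tr_tr ..⟩
    · rintro (⟨rfl, rfl⟩ | ⟨c, d, ⟨hcd, hlt⟩, rfl, rfl⟩)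
      · refine ⟨h3, ?_⟩
        simpa [tr, Equiv.swap_apply_left, Equiv.swap_apply_right] using h
      · refine ⟨tr_succ_lt hcd ?_, by rwa [tr_tr, tr_tr]⟩
        rintro ⟨rfl, rfl⟩
        exact absurd h (not_lt.2 hlt.le)
  rw [len, key, Set.ncard_insert_of_notMem _ (hw.finite_invSet.image _),
    Set.ncard_image_of_injective _ ((tr j (j + 1)).injective.prodMap (tr j (j + 1)).injective), len]
  rintro ⟨⟨c, d⟩, ⟨hcd, -⟩, heq⟩
  simp only [Prod.map_apply, Prod.mk.injEq, tr_apply] at heq hcd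
  grind

lemma len_mul_tr_of_desc {w : PPerm} (hw : HasFinSupp w) {j : ℕ+} (h : w (j + 1) < w j) :
    len w = len (w * tr j (j + 1)) + 1 := by
  have := len_mul_tr_of_asc (hw.mul_tr j (j + 1)) (j := j)
    (by simpa [tr, Equiv.swap_apply_left, Equiv.swap_apply_right] using h)
  rwa [mul_tr_mul_tr] at this

lemma cov_succ_iff {w : PPerm} {p q : ℕ+} (hpq : p + 1 < q) :
    Cov w p q ↔ Cov (w * tr p (p + 1)) (p + 1) q ∧ ¬(w p < w (p + 1) ∧ w (p + 1) < w q) := by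
  have h1 := not_lt_and_lt_add_one p
  have h3 : p < p + 1 := PNat.lt_add_right p 1
  simp only [Cov, Equiv.Perm.mul_apply, tr_apply]
  grind

lemma exists_len_mul_tr {w : PPerm} (hw : HasFinSupp w) {p q : ℕ+} (hpq : p < q)
    (h : w p < w q) : ∃ n, len (w * tr p q) = len w + 1 + 2 * n ∧ (n = 0 ↔ Cov w p q) := by
  obtain ⟨k, hk⟩ : ∃ k : ℕ, (q : ℕ) = p + 1 + k := ⟨q - (p + 1), by
    have : (p : ℕ) < q := hpq
    omega⟩
  induction k generalizing w p with
  | zero =>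
    obtain rfl : q = p + 1 := PNat.eq (by simpa using hk)
    exact ⟨0, by rw [len_mul_tr_of_asc hw h], by
      simpa only [true_iff] using
        ⟨hpq, h, fun c h1 h2 => absurd ⟨h1, h2⟩ (not_lt_and_lt_add_one p c)⟩⟩
  | succ k ih =>
    have hpq' : p + 1 < q := by
      rw [← PNat.coe_lt_coe, PNat.add_coe, PNat.one_coe]; omega
    have h3 : p < p + 1 := PNat.lt_add_right p 1
    obtain ⟨n, hn, hn0⟩ := ih (w := w * tr p (p + 1)) (hw.mul_tr _ _) hpq'
      (by simp only [Equiv.Perm.mul_apply, tr_apply]; grind)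
      (by rw [PNat.add_coe, PNat.one_coe]; omega)
    have hconj : w * tr p q = w * tr p (p + 1) * tr (p + 1) q * tr p (p + 1) := by
      ext c
      simp only [Equiv.Perm.mul_apply, tr_apply]
      grind
    have hv : HasFinSupp (w * tr p (p + 1) * tr (p + 1) q) := (hw.mul_tr _ _).mul_tr _ _
    have hv1 : (w * tr p (p + 1) * tr (p + 1) q) p = w (p + 1) := by
      simp only [Equiv.Perm.mul_apply, tr_apply]; grind
    have hv2 : (w * tr p (p + 1) * tr (p + 1) q) (p + 1) = w q := by
      simp only [Equiv.Perm.mul_apply, tr_apply]; grind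
    rw [cov_succ_iff hpq', hconj]
    rcases lt_trichotomy (w p) (w (p + 1)) with h1 | h1 | h1
    · have l1 := len_mul_tr_of_asc hw h1
      rcases lt_trichotomy (w (p + 1)) (w q) with h2 | h2 | h2
      · have l2 := len_mul_tr_of_asc hv (j := p) (by rwa [hv1, hv2])
        exact ⟨n + 1, by omega, by simp [h1, h2]⟩
      · exact absurd (w.injective h2) hpq'.ne
      · have l2 := len_mul_tr_of_desc hv (j := p) (by rwa [hv1, hv2])
        exact ⟨n, by omega, by simp [h2.le, hn0]⟩
    · exact absurd (w.injective h1) h3.ne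
    · have l1 := len_mul_tr_of_desc hw h1
      have l2 := len_mul_tr_of_asc hv (j := p) (by rw [hv1, hv2]; exact h1.trans h)
      exact ⟨n, by omega, by simp [h1.le, hn0]⟩

lemma len_mul_tr_eq_iff_cov {w : PPerm} (hw : HasFinSupp w) {p q : ℕ+} (hpq : p < q) :
    len (w * tr p q) = len w + 1 ↔ Cov w p q := by
  rcases lt_trichotomy (w p) (w q) with h | h | h
  · obtain ⟨n, hn, hn0⟩ := exists_len_mul_tr hw hpq h
    rw [← hn0]; omega
  · exact absurd (w.injective h) hpq.ne
  · obtain ⟨n, hn, -⟩ := exists_len_mul_tr (hw.mul_tr p q) hpq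
      (by simpa [tr, Equiv.swap_apply_left, Equiv.swap_apply_right] using h)
    rw [mul_tr_mul_tr] at hn
    exact ⟨fun h' => by omega, fun h' => absurd h'.2.1 (not_lt.2 h.le)⟩

lemma homogeneousComponent_mul_of_isHomogeneous {l : MvPolynomial ℕ+ ℤ} {k : ℕ}
    (hl : l.IsHomogeneous k) (g : MvPolynomial ℕ+ ℤ) (n : ℕ) :
    MvPolynomial.homogeneousComponent (k + n) (l * g) =
      l * MvPolynomial.homogeneousComponent n g := by
  let := MvPolynomial.gradedAlgebra (σ := ℕ+) (R := ℤ)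
  rw [← MvPolynomial.decomposition.decompose'_apply, ← MvPolynomial.decomposition.decompose'_apply]
  exact DirectSum.coe_decompose_mul_add_of_left_mem (MvPolynomial.homogeneousSubmodule ℕ+ ℤ)
    ((MvPolynomial.mem_homogeneousSubmodule k l).2 hl) (b := g) (j := n)

lemma isHomogeneous_of_mul_left {l g : MvPolynomial ℕ+ ℤ} {k n : ℕ} (hl0 : l ≠ 0)
    (hl : l.IsHomogeneous k) (h : (l * g).IsHomogeneous (k + n)) : g.IsHomogeneous n := by
  have h1 := homogeneousComponent_mul_of_isHomogeneous hl g n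
  rw [MvPolynomial.homogeneousComponent_eq_self h] at h1
  rw [mul_left_cancel₀ hl0 h1]
  exact MvPolynomial.homogeneousComponent_isHomogeneous n g

lemma eq_C_of_forall_rename_swap_eq {f : MvPolynomial ℕ+ ℤ}
    (h : ∀ j : ℕ+, MvPolynomial.rename (Equiv.swap j (j + 1)) f = f) :
    f = MvPolynomial.C (f.coeff 0) := by
  rw [← MvPolynomial.vars_eq_empty_iff_eq_C, Finset.eq_empty_iff_forall_notMem]
  intro k hk
  have step : ∀ k ∈ f.vars, k + 1 ∈ f.vars := by
    intro k hk
    rw [← h k] at hk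
    obtain ⟨c, hc, hck⟩ := MvPolynomial.mem_vars_rename _ _ hk
    rw [Equiv.swap_apply_eq_iff, Equiv.swap_apply_left] at hck
    rwa [hck] at hc
  obtain ⟨M, hM⟩ : ∃ M, ∀ c ∈ f.vars, c ≤ M := ⟨f.vars.max' ⟨k, hk⟩, f.vars.le_max'⟩
  have hmax := f.vars.max'_mem ⟨k, hk⟩
  exact absurd (f.vars.le_max' _ (step _ hmax)) (not_le.2 (PNat.lt_add_right _ 1))

lemma X_sub_X_succ_ne_zero (j : ℕ+) :
    (MvPolynomial.X j - MvPolynomial.X (j + 1) : MvPolynomial ℕ+ ℤ) ≠ 0 := by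
  rw [sub_ne_zero]
  exact fun h => (PNat.lt_add_right j 1).ne (MvPolynomial.X_injective h)

lemma isHomogeneous_X_sub_X (a b : ℕ+) :
    (MvPolynomial.X a - MvPolynomial.X b : MvPolynomial ℕ+ ℤ).IsHomogeneous 1 :=
  (MvPolynomial.isHomogeneous_X _ _).sub (MvPolynomial.isHomogeneous_X _ _)

namespace IsSchubertFamily

variable {S : PPerm → MvPolynomial ℕ+ ℤ}

lemma rename_eq_self (hS : IsSchubertFamily S) {w : PPerm} (hw : HasFinSupp w) {j : ℕ+}
    (h : w j < w (j + 1)) : MvPolynomial.rename (Equiv.swap j (j + 1)) (S w) = S w := by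
  have h1 := hS.2 (w * tr j (j + 1)) j
    (by rw [mul_tr_mul_tr, len_mul_tr_of_asc hw h]; exact Nat.lt_succ_self _)
  rw [mul_tr_mul_tr] at h1
  have h2 := congrArg (MvPolynomial.rename (Equiv.swap j (j + 1))) h1
  simp only [map_mul, map_sub, MvPolynomial.rename_X, Equiv.swap_apply_left,
    Equiv.swap_apply_right, MvPolynomial.rename_rename] at h2
  have h3 : (Equiv.swap j (j + 1) ∘ Equiv.swap j (j + 1) : ℕ+ → ℕ+) = id := by
    ext c; simp
  rw [h3, MvPolynomial.rename_id_apply] at h2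
  refine mul_left_cancel₀ (X_sub_X_succ_ne_zero j) ?_
  linear_combination -h2 - h1

lemma rename_of_desc (hS : IsSchubertFamily S) {w : PPerm} (hw : HasFinSupp w) {j : ℕ+}
    (h : w (j + 1) < w j) : MvPolynomial.rename (Equiv.swap j (j + 1)) (S w) =
      S w - (MvPolynomial.X j - MvPolynomial.X (j + 1)) * S (w * tr j (j + 1)) := by
  rw [hS.2 w j (by rw [len_mul_tr_of_desc hw h]; exact Nat.lt_succ_self _)]
  ring

end IsSchubertFamily

/-- The positions `1, …, m`. -/
def posUpTo (m : ℕ) : Finset ℕ+ :=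
  (Finset.range m).map ⟨Nat.succPNat, Nat.succPNat_injective⟩

lemma mem_posUpTo {m : ℕ} {p : ℕ+} : p ∈ posUpTo m ↔ (p : ℕ) ≤ m := by
  simp only [posUpTo, Finset.mem_map, Finset.mem_range, Function.Embedding.coeFn_mk]
  constructor
  · rintro ⟨k, hk, rfl⟩
    exact hk
  · intro h
    exact ⟨p.natPred, by rw [PNat.natPred]; have := p.pos; omega, PNat.succPNat_natPred p⟩

lemma posUpTo_succ (m : ℕ) : posUpTo (m + 1) = insert m.succPNat (posUpTo m) := by
  rw [posUpTo, Finset.range_add_one, Finset.map_insert]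
  rfl

lemma succPNat_notMem_posUpTo (m : ℕ) : m.succPNat ∉ posUpTo m := by
  rw [mem_posUpTo, Nat.succPNat_coe]
  omega

/-- The pairs `(a, b)` with `a < b ≤ m`. -/
def pairsUpTo (m : ℕ) : Finset (ℕ+ × ℕ+) :=
  (posUpTo m ×ˢ posUpTo m).filter fun x => x.1 < x.2

lemma card_pairsUpTo (m : ℕ) : (pairsUpTo m).card = ∑ k ∈ Finset.range m, (m - 1 - k) := by
  rw [pairsUpTo, Finset.card_filter, Finset.sum_product, posUpTo, Finset.sum_map]
  refine Finset.sum_congr rfl fun k hk => ?_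
  rw [Finset.sum_map, ← Finset.card_filter]
  have : (Finset.range m).filter (fun l => k.succPNat < l.succPNat) = Finset.Ico (k + 1) m := by
    ext l
    simp only [Finset.mem_filter, Finset.mem_range, Finset.mem_Ico, Nat.succPNat_lt_succPNat]
    omega
  simp only [Function.Embedding.coeFn_mk]
  rw [this, Nat.card_Ico]
  omega

lemma FixesFrom.invSet_subset {m : ℕ} {w : PPerm} (h : FixesFrom (m + 1) w) :
    invSet w ⊆ pairsUpTo m := by
  rintro ⟨a, b⟩ ⟨hab, hw⟩
  have hab' : (a : ℕ) < b := hab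
  have hw' : (w b : ℕ) < w a := hw
  have hb : (b : ℕ) ≤ m := by
    by_contra! hc
    rw [h b hc] at hw'
    have := h.apply_lt hc hab'
    omega
  simp only [pairsUpTo, Finset.coe_filter, Finset.mem_product, mem_posUpTo, Set.mem_ofPred_eq]
  exact ⟨⟨by omega, hb⟩, hab⟩

lemma FixesFrom.len_le {m : ℕ} {w : PPerm} (h : FixesFrom (m + 1) w) :
    len w ≤ (pairsUpTo m).card := by
  rw [len, ← Set.ncard_coe_finset]
  exact Set.ncard_le_ncard h.invSet_subset (Finset.finite_toSet _)

lemma FixesFrom.apply_eq_of_forall_desc {m : ℕ} {w : PPerm} (h : FixesFrom (m + 1) w)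
    (hd : ∀ j : ℕ+, (j : ℕ) + 1 ≤ m → w (j + 1) < w j) (k : ℕ+) (hk : (k : ℕ) ≤ m) :
    (w k : ℕ) = m + 1 - k := by
  have hd' : ∀ j : ℕ+, (j : ℕ) + 1 ≤ m → (w (j + 1) : ℕ) < w j := hd
  have upper : ∀ k : ℕ+, (k : ℕ) ≤ m → (w k : ℕ) + k ≤ m + 1 := by
    intro k
    induction k with
    | one =>
      intro hk
      have := h.apply_lt le_rfl (k := 1) (by rw [PNat.one_coe] at *; omega)
      rw [PNat.one_coe]
      omega
    | succ k ih =>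
      intro hk
      rw [PNat.add_coe, PNat.one_coe] at *
      have := hd' k hk
      have := ih (by omega)
      omega
  have lower : ∀ (n : ℕ) (k : ℕ+), (k : ℕ) + n = m → n + 1 ≤ (w k : ℕ) := by
    intro n
    induction n with
    | zero => exact fun k _ => (w k).pos
    | succ n ih =>
      intro k hk
      have := hd' k (by omega)
      have := ih (k + 1) (by rw [PNat.add_coe, PNat.one_coe]; omega)
      omega
  have := upper k hk
  have := lower (m - k) k (by omega)
  omega

lemma isHomogeneous_schubBase (m : ℕ) : (schubBase m).IsHomogeneous (pairsUpTo m).card := by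
  rw [card_pairsUpTo]
  refine MvPolynomial.IsHomogeneous.prod _ _ _ fun k _ => ?_
  exact MvPolynomial.isHomogeneous_X_pow _ _

lemma len_eq_card_pairsUpTo {m : ℕ} {w : PPerm} (h : FixesFrom (m + 1) w)
    (hw : ∀ k : ℕ+, (k : ℕ) ≤ m → (w k : ℕ) = m + 1 - k) : len w = (pairsUpTo m).card := by
  rw [len, ← Set.ncard_coe_finset]
  congr 1
  refine h.invSet_subset.antisymm ?_
  rintro ⟨a, b⟩ hab
  simp only [pairsUpTo, Finset.coe_filter, Finset.mem_product, mem_posUpTo,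
    Set.mem_ofPred_eq] at hab
  refine ⟨hab.2, ?_⟩
  have h1 := hw a hab.1.1
  have h2 := hw b hab.1.2
  have h3 : (a : ℕ) < b := hab.2
  rw [← PNat.coe_lt_coe]
  simp only
  omega

namespace IsSchubertFamily

variable {S : PPerm → MvPolynomial ℕ+ ℤ}

lemma isHomogeneous_of_fixesFrom (hS : IsSchubertFamily S) {m : ℕ} (n : ℕ) {w : PPerm}
    (hw : FixesFrom (m + 1) w) (hn : len w + n = (pairsUpTo m).card) :
    (S w).IsHomogeneous (len w) := by
  induction n generalizing w with
  | zero =>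
    have hd : ∀ j : ℕ+, (j : ℕ) + 1 ≤ m → w (j + 1) < w j := by
      intro j hj
      by_contra! hc
      have hlt : w j < w (j + 1) :=
        lt_of_le_of_ne hc fun he => (PNat.lt_add_right j 1).ne (w.injective he)
      have h1 := len_mul_tr_of_asc hw.hasFinSupp hlt
      have h2 := (hw.mul_tr (p := j) (q := j + 1) (by omega)
        (by rw [PNat.add_coe, PNat.one_coe]; omega)).len_le
      omega
    rw [hS.1 m w (hw.apply_eq_of_forall_desc hd) fun k hk => hw k hk, ← add_zero (len w), hn]
    exact isHomogeneous_schubBase m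
  | succ n ih =>
    obtain ⟨j, hj, hlt⟩ : ∃ j : ℕ+, (j : ℕ) + 1 ≤ m ∧ w j < w (j + 1) := by
      by_contra! hc
      have := len_eq_card_pairsUpTo hw (hw.apply_eq_of_forall_desc fun j hj =>
        lt_of_le_of_ne (hc j hj) fun he => (PNat.lt_add_right j 1).ne' (w.injective he))
      omega
    have h1 := len_mul_tr_of_asc hw.hasFinSupp hlt
    have h2 := ih (hw.mul_tr (p := j) (q := j + 1) (by omega)
        (by rw [PNat.add_coe, PNat.one_coe]; omega)) (by omega)
    have h3 := hS.2 (w * tr j (j + 1)) j (by rw [mul_tr_mul_tr]; omega)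
    rw [mul_tr_mul_tr] at h3
    refine isHomogeneous_of_mul_left (X_sub_X_succ_ne_zero j) (isHomogeneous_X_sub_X j (j + 1)) ?_
    rw [h3, add_comm 1 (len w), ← h1]
    exact h2.sub h2.rename_isHomogeneous

lemma isHomogeneous (hS : IsSchubertFamily S) {w : PPerm} (hw : HasFinSupp w) :
    (S w).IsHomogeneous (len w) := by
  obtain ⟨m, hm⟩ := hw.exists_fixesFrom
  have hm' := hm.mono m.le_succ
  exact hS.isHomogeneous_of_fixesFrom _ hm' (Nat.add_sub_of_le hm'.len_le)

end IsSchubertFamily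

section BruhatOperators

variable {R : Type*} [AddCommGroup R]

/-- The operator on functions of permutations given by going up along the cover `w ⋖ w t_{pq}`. -/
def bruhatOp (p q : ℕ+) (g : PPerm → R) (w : PPerm) : R :=
  if Cov w p q then g (w * tr p q) else 0

/-- The operator on functions of permutations given by going down along a descent at `j`. -/
def descOp (j : ℕ+) (g : PPerm → R) (w : PPerm) : R :=
  if w (j + 1) < w j then g (w * tr j (j + 1)) else 0

/-- Monk's operator `∑_{a < q ≤ N} (w ↦ w t_{aq}) - ∑_{q < a} (w ↦ w t_{qa})`, over covers. -/
def monkOp (a : ℕ+) (N : ℕ) (g : PPerm → R) (w : PPerm) : R :=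
  ∑ q ∈ posUpTo N, (bruhatOp a q g w - bruhatOp q a g w)

lemma bruhatOp_of_not_lt {p q : ℕ+} (h : ¬p < q) (g : PPerm → R) (w : PPerm) :
    bruhatOp p q g w = 0 :=
  if_neg fun hc => h hc.1

lemma cov_mul_tr_iff {w : PPerm} {j a b : ℕ+} :
    Cov (w * tr j (j + 1)) (tr j (j + 1) a) (tr j (j + 1) b) ↔
      tr j (j + 1) a < tr j (j + 1) b ∧ w a < w b ∧
        ∀ c, tr j (j + 1) a < tr j (j + 1) c → tr j (j + 1) c < tr j (j + 1) b →
          ¬(w a < w c ∧ w c < w b) := by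
  simp only [Cov, Equiv.Perm.mul_apply, tr_tr]
  refine and_congr_right fun _ => and_congr_right fun _ => ⟨fun h c h1 h2 => ?_, fun h c h1 h2 => ?_⟩
  · simpa only [tr_tr] using h _ h1 h2
  · exact h _ (by rwa [tr_tr]) (by rwa [tr_tr])

lemma cov_and_desc_iff {w : PPerm} {j a b : ℕ+} (h1 : ¬(a = j ∧ b = j + 1))
    (h2 : ¬(a = j + 1 ∧ b = j)) :
    (Cov w a b ∧ (w * tr a b) (j + 1) < (w * tr a b) j) ↔
      w (j + 1) < w j ∧
        Cov (w * tr j (j + 1)) (tr j (j + 1) a) (tr j (j + 1) b) := by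
  rw [cov_mul_tr_iff]
  have hj : j < j + 1 := PNat.lt_add_right j 1
  have hn := not_lt_and_lt_add_one j
  have hna := hn a
  have hnb := hn b
  have hinj : ∀ c d, w c = w d → c = d := fun c d h => w.injective h
  have hi1 := hinj j (j + 1)
  have hi2 := hinj j b
  have hi3 := hinj (j + 1) a
  have hi4 := hinj j a
  have hi5 := hinj (j + 1) b
  simp only [Cov, Equiv.Perm.mul_apply]
  constructor
  · rintro ⟨⟨hab, hw, hc⟩, hd⟩
    have hs := tr_succ_lt hab h1
    simp only [tr_apply] at *
    refine ⟨?_, hs, hw, fun c hc1 hc2 => ?_⟩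
    · have := hc j
      have := hc (j + 1)
      clear hc hinj
      grind
    · have := hn c
      grind
  · rintro ⟨hd, hs, hw, hc⟩
    have hab : a < b := by
      have := tr_succ_lt (j := j) hs
      simp only [tr_apply] at *
      grind
    refine ⟨⟨hab, hw, fun c hc1 hc2 => ?_⟩, ?_⟩
    · have := hn c
      have := hc c
      simp only [tr_apply] at *
      grind
    · have := hc j
      have := hc (j + 1)
      clear hc hinj
      simp only [tr_apply] at *
      grind

lemma bruhatOp_descOp {j a b : ℕ+} (h1 : ¬(a = j ∧ b = j + 1)) (h2 : ¬(a = j + 1 ∧ b = j))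
    (g : PPerm → R) (w : PPerm) :
    bruhatOp a b (descOp j g) w =
      descOp j (bruhatOp (tr j (j + 1) a) (tr j (j + 1) b) g) w := by
  have hconj : w * tr j (j + 1) * tr (tr j (j + 1) a) (tr j (j + 1) b) =
      w * tr a b * tr j (j + 1) := by
    have h : tr (tr j (j + 1) a) (tr j (j + 1) b) = tr j (j + 1) * tr a b * (tr j (j + 1))⁻¹ :=
      Equiv.swap_apply_apply _ a b
    rw [h, show (tr j (j + 1))⁻¹ = tr j (j + 1) from Equiv.swap_inv j (j + 1), ← mul_assoc,
      ← mul_assoc, mul_tr_mul_tr]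
  simp only [bruhatOp, descOp, ← ite_and, hconj]
  exact if_congr (cov_and_desc_iff h1 h2) rfl rfl

lemma cov_self_succ {w : PPerm} {j : ℕ+} : Cov w j (j + 1) ↔ w j < w (j + 1) :=
  ⟨fun h => h.2.1, fun h => ⟨PNat.lt_add_right j 1, h, fun c h1 h2 =>
    absurd ⟨h1, h2⟩ (not_lt_and_lt_add_one j c)⟩⟩

lemma bruhatOp_descOp_self (j : ℕ+) (g : PPerm → R) (w : PPerm) :
    bruhatOp j (j + 1) (descOp j g) w + descOp j (bruhatOp j (j + 1) g) w = g w := by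
  have hne : w j ≠ w (j + 1) := fun he => (PNat.lt_add_right j 1).ne (w.injective he)
  simp only [bruhatOp, descOp, cov_self_succ, mul_tr_mul_tr, Equiv.Perm.mul_apply, tr_left,
    tr_right]
  rcases lt_or_gt_of_ne hne with h | h
  · simp [h, not_lt.2 h.le]
  · simp [h, not_lt.2 h.le]

lemma descOp_monkOp {j : ℕ+} {N : ℕ} (hj : (j : ℕ) + 1 ≤ N) (a : ℕ+) (g : PPerm → R)
    (w : PPerm) :
    descOp j (monkOp (tr j (j + 1) a) N g) w = ∑ q ∈ posUpTo N,
      (descOp j (bruhatOp (tr j (j + 1) a) (tr j (j + 1) q) g) w -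
        descOp j (bruhatOp (tr j (j + 1) q) (tr j (j + 1) a) g) w) := by
  have hmem : ∀ q : ℕ+, q ∈ posUpTo N ↔ tr j (j + 1) q ∈ posUpTo N := by
    intro q
    rw [tr_apply, mem_posUpTo, mem_posUpTo]
    have h3 : ((j + 1 : ℕ+) : ℕ) = j + 1 := rfl
    split_ifs with h h'
    · subst h; omega
    · subst h'; omega
    · rfl
  by_cases h : w (j + 1) < w j
  · simp only [descOp, if_pos h, monkOp]
    exact (Finset.sum_equiv (tr j (j + 1)) hmem fun q _ => rfl).symm
  · simp only [descOp, if_neg h, sub_zero, Finset.sum_const_zero]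

lemma monkOp_descOp {j : ℕ+} {N : ℕ} (hj : (j : ℕ) + 1 ≤ N) (a : ℕ+) (g : PPerm → R)
    (w : PPerm) :
    monkOp a N (descOp j g) w = descOp j (monkOp (tr j (j + 1) a) N g) w +
      ((if a = j then g w else 0) - if a = j + 1 then g w else 0) := by
  have hlt : j < j + 1 := PNat.lt_add_right j 1
  have hj' : ((j + 1 : ℕ+) : ℕ) = j + 1 := rfl
  have hself := bruhatOp_descOp_self j g w
  rw [descOp_monkOp hj, ← sub_eq_iff_eq_add', monkOp, ← Finset.sum_sub_distrib]
  have hzero : ∀ q, ¬(a = j ∧ q = j + 1) → ¬(a = j + 1 ∧ q = j) →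
      bruhatOp a q (descOp j g) w - bruhatOp q a (descOp j g) w -
        (descOp j (bruhatOp (tr j (j + 1) a) (tr j (j + 1) q) g) w -
          descOp j (bruhatOp (tr j (j + 1) q) (tr j (j + 1) a) g) w) = 0 := by
    intro q h1 h2
    rw [bruhatOp_descOp h1 h2, bruhatOp_descOp (by tauto) (by tauto), sub_self]
  have hdz : ∀ v : PPerm, descOp j (bruhatOp (j + 1) j g) v = 0 := fun v => by
    simp [descOp, bruhatOp_of_not_lt (not_lt.2 hlt.le)]
  by_cases h1 : a = j
  · subst h1
    rw [Finset.sum_eq_single (a + 1) (fun q _ hq => hzero q (by tauto) (by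
      rintro ⟨h, -⟩; exact hlt.ne h)) fun h => absurd (mem_posUpTo.2 (by omega)) h]
    simp only [tr_left, tr_right, if_neg hlt.ne, if_true, hdz,
      bruhatOp_of_not_lt (not_lt.2 hlt.le)]
    rw [← hself]
    abel
  by_cases h2 : a = j + 1
  · subst h2
    rw [Finset.sum_eq_single j (fun q _ hq => hzero q (by tauto) (by tauto))
      fun h => absurd (mem_posUpTo.2 (by omega)) h]
    simp only [tr_left, tr_right, if_neg hlt.ne', if_true, hdz,
      bruhatOp_of_not_lt (not_lt.2 hlt.le)]
    rw [← hself]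
    abel
  · rw [if_neg h1, if_neg h2, Finset.sum_eq_zero fun q _ => hzero q (by tauto) (by tauto), sub_self]

end BruhatOperators

namespace IsSchubertFamily

variable {S : PPerm → MvPolynomial ℕ+ ℤ}

lemma rename_eq_sub_descOp (hS : IsSchubertFamily S) {w : PPerm} (hw : HasFinSupp w) (j : ℕ+) :
    MvPolynomial.rename (Equiv.swap j (j + 1)) (S w) =
      S w - (MvPolynomial.X j - MvPolynomial.X (j + 1)) * descOp j S w := by
  rcases lt_trichotomy (w j) (w (j + 1)) with h | h | h
  · rw [hS.rename_eq_self hw h, descOp, if_neg (not_lt.2 h.le), mul_zero, sub_zero]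
  · exact absurd (w.injective h) (PNat.lt_add_right j 1).ne
  · rw [hS.rename_of_desc hw h, descOp, if_pos h]

lemma rename_bruhatOp (hS : IsSchubertFamily S) {w : PPerm} (hw : HasFinSupp w) (j p q : ℕ+) :
    MvPolynomial.rename (Equiv.swap j (j + 1)) (bruhatOp p q S w) =
      bruhatOp p q S w -
        (MvPolynomial.X j - MvPolynomial.X (j + 1)) * bruhatOp p q (descOp j S) w := by
  unfold bruhatOp
  split_ifs
  · exact hS.rename_eq_sub_descOp (hw.mul_tr p q) j
  · simp

lemma rename_monkOp (hS : IsSchubertFamily S) {w : PPerm} (hw : HasFinSupp w) (j a : ℕ+) (N : ℕ) :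
    MvPolynomial.rename (Equiv.swap j (j + 1)) (monkOp a N S w) =
      monkOp a N S w -
        (MvPolynomial.X j - MvPolynomial.X (j + 1)) * monkOp a N (descOp j S) w := by
  simp only [monkOp, map_sum, map_sub, hS.rename_bruhatOp hw, Finset.mul_sum,
    ← Finset.sum_sub_distrib]
  exact Finset.sum_congr rfl fun q _ => by ring

lemma constantCoeff_bruhatOp (hS : IsSchubertFamily S) {w : PPerm} (hw : HasFinSupp w)
    (p q : ℕ+) : MvPolynomial.constantCoeff (bruhatOp p q S w) = 0 := by
  unfold bruhatOp
  split_ifs with h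
  · have hlen := (len_mul_tr_eq_iff_cov hw h.1).2 h
    exact (hS.isHomogeneous (hw.mul_tr p q)).coeff_eq_zero (d := 0) (by
      rw [hlen, map_zero]; exact (Nat.succ_ne_zero _).symm)
  · exact map_zero _

lemma constantCoeff_monkOp (hS : IsSchubertFamily S) {w : PPerm} (hw : HasFinSupp w)
    (a : ℕ+) (N : ℕ) : MvPolynomial.constantCoeff (monkOp a N S w) = 0 := by
  rw [monkOp, map_sum]
  refine Finset.sum_eq_zero fun q _ => ?_
  rw [map_sub, hS.constantCoeff_bruhatOp hw, hS.constantCoeff_bruhatOp hw, sub_zero]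

/-- **Monk's rule**, in the form giving the product with a single variable. -/
lemma monkOp_eq (hS : IsSchubertFamily S) {N : ℕ} {w : PPerm} (hw : FixesFrom N w) {a : ℕ+}
    (ha : (a : ℕ) < N) : monkOp a N S w = MvPolynomial.X a * S w := by
  obtain ⟨n, hn⟩ : ∃ n, len w = n := ⟨_, rfl⟩
  induction n using Nat.strong_induction_on generalizing w a with
  | _ n ih =>
  have hws := hw.hasFinSupp
  suffices h : monkOp a N S w - MvPolynomial.X a * S w =
      MvPolynomial.C ((monkOp a N S w - MvPolynomial.X a * S w).coeff 0) by
    rw [← MvPolynomial.constantCoeff_eq, map_sub, map_mul, MvPolynomial.constantCoeff_X, zero_mul,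
      hS.constantCoeff_monkOp hws, sub_zero, map_zero] at h
    exact sub_eq_zero.1 h
  refine eq_C_of_forall_rename_swap_eq fun j => ?_
  have hlt : j < j + 1 := PNat.lt_add_right j 1
  have hj' : ((j + 1 : ℕ+) : ℕ) = j + 1 := rfl
  rw [map_sub, map_mul, MvPolynomial.rename_X, hS.rename_monkOp hws, hS.rename_eq_sub_descOp hws]
  rcases le_or_gt ((j : ℕ) + 1) N with hj | hj
  · have hdesc : descOp j (monkOp (tr j (j + 1) a) N S) w =
        MvPolynomial.X (tr j (j + 1) a) * descOp j S w := by
      unfold descOp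
      split_ifs with hd
      · have hjN : (j : ℕ) + 1 < N := by
          refine lt_of_le_of_ne hj fun he => ?_
          have h1 := hw (j + 1) (by omega)
          have h2 := hw.apply_lt le_rfl (k := j) (by omega)
          rw [h1, ← PNat.coe_lt_coe] at hd
          omega
        refine ih _ ?_ (hw.mul_tr (by omega) (by omega)) ?_ rfl
        · rw [← hn, len_mul_tr_of_desc hws hd]; exact Nat.lt_succ_self _
        · rw [tr_apply]; split_ifs <;> omega
      · simp
    rw [monkOp_descOp hj, hdesc, ← tr, tr_apply]
    by_cases h1 : a = j
    · subst h1
      simp only [if_true, if_neg hlt.ne]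
      ring
    by_cases h2 : a = j + 1
    · subst h2
      simp only [if_true, if_neg hlt.ne']
      ring
    · simp only [if_neg h1, if_neg h2]
      ring
  · have haj : a ≠ j := by rintro rfl; omega
    have haj' : a ≠ j + 1 := by rintro rfl; omega
    rw [Equiv.swap_apply_of_ne_of_ne haj haj']
    have hz : ∀ {v : PPerm}, FixesFrom (N + 1) v → descOp j S v = 0 := by
      intro v hv
      have h1 := hv (j + 1) (by omega)
      have h2 := hv.apply_lt (m := j + 1) (k := j) (by omega) (by omega)
      refine if_neg (not_lt.2 ?_)
      rw [h1, ← PNat.coe_le_coe]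
      omega
    have hz' : ∀ p q : ℕ+, (p : ℕ) ≤ N → (q : ℕ) ≤ N → bruhatOp p q (descOp j S) w = 0 := by
      intro p q hp hq
      unfold bruhatOp
      rw [hz ((hw.mono N.le_succ).mul_tr (by omega) (by omega)), ite_self]
    have hm : monkOp a N (descOp j S) w = 0 :=
      Finset.sum_eq_zero fun q hq => by
        rw [hz' a q ha.le (mem_posUpTo.1 hq), hz' q a (mem_posUpTo.1 hq) ha.le, sub_zero]
    rw [hm, hz (hw.mono N.le_succ)]
    ring

end IsSchubertFamily

lemma apply_inv_apply (w : PPerm) (n : ℕ+) : w (w⁻¹ n) = n :=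
  w.apply_symm_apply n

lemma inv_apply_apply (w : PPerm) (p : ℕ+) : w⁻¹ (w p) = p :=
  w.symm_apply_apply p

section TransitionOperators

variable {R : Type*} [AddCommGroup R]

/-- The sum of the operators of the covers `w ⋖ w t_{pq}` with `p ≤ i < q` and `w q = n`. -/
def valueOp (i : ℕ) (n : ℕ+) (g : PPerm → R) (w : PPerm) : R :=
  if i < (w⁻¹ n : ℕ) then ∑ p ∈ posUpTo i, bruhatOp p (w⁻¹ n) g w else 0

/-- The part of Monk's operator at position `i + 1` going up to values at most `N`. -/
def monkValueOp (i N : ℕ) (g : PPerm → R) (w : PPerm) : R :=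
  if (w i.succPNat : ℕ) ≤ N then
    ∑ m ∈ posUpTo N, bruhatOp i.succPNat (w⁻¹ m) g w - ∑ b ∈ posUpTo i, bruhatOp b i.succPNat g w
  else 0

lemma bruhatOp_add (p q : ℕ+) (g h : PPerm → R) :
    bruhatOp p q (g + h) = bruhatOp p q g + bruhatOp p q h := by
  funext w
  simp only [bruhatOp, Pi.add_apply]
  split_ifs <;> simp

lemma valueOp_add (i : ℕ) (n : ℕ+) (g h : PPerm → R) :
    valueOp i n (g + h) = valueOp i n g + valueOp i n h := by
  funext w
  simp only [valueOp, bruhatOp_add, Pi.add_apply, Finset.sum_add_distrib]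
  split_ifs <;> simp

lemma monkValueOp_add (i N : ℕ) (g h : PPerm → R) :
    monkValueOp i N (g + h) = monkValueOp i N g + monkValueOp i N h := by
  funext w
  simp only [monkValueOp, bruhatOp_add, Pi.add_apply, Finset.sum_add_distrib]
  split_ifs
  · abel
  · simp

lemma valueOp_succ_add_monkValueOp (i N : ℕ) (g : PPerm → R) :
    valueOp (i + 1) N.succPNat g + monkValueOp i N g =
      monkValueOp i (N + 1) g + valueOp i N.succPNat g := by
  funext w
  simp only [Pi.add_apply, valueOp, monkValueOp, posUpTo_succ]
  rw [Finset.sum_insert (succPNat_notMem_posUpTo i), Finset.sum_insert (succPNat_notMem_posUpTo N)]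
  set a := i.succPNat with ha
  set n := N.succPNat with hn
  have ha' : (a : ℕ) = i + 1 := rfl
  have hn' : (n : ℕ) = N + 1 := rfl
  rcases lt_trichotomy n (w a) with h | h | h
  · have h1 : ¬(w a : ℕ) ≤ N := by rw [← PNat.coe_lt_coe] at h; omega
    have h2 : ¬(w a : ℕ) ≤ N + 1 := by rw [← PNat.coe_lt_coe] at h; omega
    have h3 : bruhatOp a (w⁻¹ n) g w = 0 := if_neg fun hc => by
      have := hc.2.1
      rw [apply_inv_apply] at this
      exact absurd h (not_lt.2 this.le)
    have h4 : w⁻¹ n ≠ a := by rintro h'; rw [← h', apply_inv_apply] at h; exact h.ne rfl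
    have h5 : ((w⁻¹ n : ℕ+) : ℕ) ≠ i + 1 := fun h => h4 (PNat.coe_injective h)
    have h6 : i + 1 < ((w⁻¹ n : ℕ+) : ℕ) ↔ i < ((w⁻¹ n : ℕ+) : ℕ) := by omega
    simp only [if_neg h1, if_neg h2, h3, h6, zero_add, add_zero]
  · have h1 : ¬(w a : ℕ) ≤ N := by rw [← h]; omega
    have h2 : (w a : ℕ) ≤ N + 1 := by rw [← h]; omega
    have h3 : w⁻¹ n = a := by rw [h, inv_apply_apply]
    have h4 : ∑ m ∈ posUpTo N, bruhatOp a (w⁻¹ m) g w = 0 :=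
      Finset.sum_eq_zero fun m hm => if_neg fun hc => by
        have := hc.2.1
        rw [apply_inv_apply, ← h, ← PNat.coe_lt_coe] at this
        have := mem_posUpTo.1 hm
        omega
    rw [if_neg h1, if_pos h2, h3, h4, bruhatOp_of_not_lt (lt_irrefl a), ha', if_neg (lt_irrefl _),
      if_pos (Nat.lt_succ_self i)]
    abel
  · have h1 : (w a : ℕ) ≤ N := by rw [← PNat.coe_lt_coe] at h; omega
    have h2 : (w a : ℕ) ≤ N + 1 := by omega
    have h4 : w⁻¹ n ≠ a := by rintro h'; rw [← h', apply_inv_apply] at h; exact h.ne rfl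
    have h5 : ((w⁻¹ n : ℕ+) : ℕ) ≠ i + 1 := fun h => h4 (PNat.coe_injective h)
    rw [if_pos h1, if_pos h2]
    by_cases h6 : i < ((w⁻¹ n : ℕ+) : ℕ)
    · rw [if_pos h6, if_pos (by omega)]
      abel
    · rw [if_neg h6, if_neg (by omega), bruhatOp_of_not_lt fun hl =>
        h6 (by rw [← PNat.coe_lt_coe] at hl; omega)]
      abel

end TransitionOperators

lemma tr_mul_tr_of_disjoint {p q c d : ℕ+} (h1 : p ≠ c) (h2 : p ≠ d) (h3 : q ≠ c) (h4 : q ≠ d) :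
    tr p q * tr c d = tr c d * tr p q := by
  ext e
  simp only [Equiv.Perm.mul_apply, tr_apply]
  grind

lemma Cov.swap_of_disjoint {w : PPerm} {p q c d : ℕ+} (h1 : p ≠ c) (h2 : p ≠ d) (h3 : q ≠ c)
    (h4 : q ≠ d) (hpq : Cov w p q) (hcd : Cov (w * tr p q) c d) :
    Cov w c d ∧ Cov (w * tr c d) p q := by
  have i1 := lt_or_gt_of_ne (w.injective.ne h4)
  have i2 := lt_or_gt_of_ne (w.injective.ne h1)
  have i3 := lt_or_gt_of_ne h4
  have i4 := lt_or_gt_of_ne h3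
  obtain ⟨hl, hv, hb⟩ := hpq
  obtain ⟨hl', hv', hb'⟩ := hcd
  simp only [Equiv.Perm.mul_apply] at hv' hb'
  rw [tr_of_ne h1.symm h3.symm, tr_of_ne h2.symm h4.symm] at hv'
  have b1 := hb c
  have b2 := hb d
  have b3 := hb' p
  have b4 := hb' q
  simp only [tr_left, tr_right, tr_of_ne h1.symm h3.symm, tr_of_ne h2.symm h4.symm] at b3 b4
  refine ⟨⟨hl', hv', fun e he1 he2 he => ?_⟩, hl, ?_, fun e he1 he2 he => ?_⟩
  · have b5 := hb' e he1 he2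
    simp only [tr_of_ne h1.symm h3.symm, tr_of_ne h2.symm h4.symm] at b5
    by_cases e1 : e = p
    · subst e1; clear hb hb'; grind
    by_cases e2 : e = q
    · subst e2; clear hb hb'; grind
    · rw [tr_of_ne e1 e2] at b5
      exact b5 he
  · simpa only [Equiv.Perm.mul_apply, tr_of_ne h1 h2, tr_of_ne h3 h4] using hv
  · simp only [Equiv.Perm.mul_apply, tr_of_ne h1 h2, tr_of_ne h3 h4] at he
    have b5 := hb e he1 he2
    by_cases e1 : e = c
    · subst e1; rw [tr_left] at he; clear hb hb'; grind
    by_cases e2 : e = d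
    · subst e2; rw [tr_right] at he; clear hb hb'; grind
    · rw [tr_of_ne e1 e2] at he
      exact b5 he

section TransitionOperators

variable {R : Type*} [AddCommGroup R]

lemma bruhatOp_comm {p q c d : ℕ+} (h1 : p ≠ c) (h2 : p ≠ d) (h3 : q ≠ c) (h4 : q ≠ d)
    (g : PPerm → R) (w : PPerm) :
    bruhatOp p q (bruhatOp c d g) w = bruhatOp c d (bruhatOp p q g) w := by
  simp only [bruhatOp, ← ite_and, mul_assoc, tr_mul_tr_of_disjoint h1 h2 h3 h4]
  exact if_congr ⟨fun h => h.1.swap_of_disjoint h1 h2 h3 h4 h.2,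
    fun h => h.1.swap_of_disjoint h1.symm h3.symm h2.symm h4.symm h.2⟩ rfl rfl

lemma bruhatOp_bruhatOp_add {w : PPerm} {p a q : ℕ+} (hpa : p < a) (haq : a < q) (hw : w a < w q)
    (g : PPerm → R) :
    bruhatOp p q (bruhatOp a q g) w + bruhatOp p a (bruhatOp p q g) w =
      bruhatOp a q (bruhatOp p a g) w := by
  have e1 : tr p q * tr a q = tr a q * tr p a := by
    ext e
    simp only [Equiv.Perm.mul_apply, tr_apply]
    grind
  have e2 : tr p a * tr p q = tr a q * tr p a := by
    ext e
    simp only [Equiv.Perm.mul_apply, tr_apply]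
    grind
  have hpq := hpa.trans haq
  have n1 := hpa.ne
  have n2 := haq.ne
  have n3 := hpq.ne
  have hne : w p ≠ w a := fun h => hpa.ne (w.injective h)
  simp only [bruhatOp, ← ite_and, mul_assoc, e1, e2]
  simp only [Cov, hpa, haq, hpq, true_and, Equiv.Perm.mul_apply, tr_left, tr_right,
    tr_of_ne n1.symm n2, tr_of_ne n1 n3, tr_of_ne n3.symm n2.symm, hw]
  have key : ∀ x y : ℕ+, ∀ e, e ≠ x → e ≠ y → w (tr x y e) = w e := fun x y e h1 h2 => by
    rw [tr_of_ne h1 h2]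
  rcases lt_or_gt_of_ne hne with h | h
  · rw [if_neg fun hc => hc.1.2 a hpa haq ⟨h, hw⟩, zero_add]
    refine if_congr ⟨fun hc => ⟨fun e h1 h2 h3 => ?_, h.trans hw, fun e h1 h2 h3 => ?_⟩,
      fun hc => ⟨⟨h, fun e h1 h2 h3 => ?_⟩, fun e h1 h2 h3 => ?_⟩⟩ rfl rfl
    · have := hc.2 e (hpa.trans h1) h2
      rw [key _ _ _ (hpa.trans h1).ne' h1.ne'] at this
      exact this h3
    · rw [key _ _ _ h2.ne (h2.trans haq).ne] at h3
      have t1 := hc.1.2 e h1 h2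
      have t2 := hc.2 e h1 (h2.trans haq)
      rw [key _ _ _ h1.ne' h2.ne] at t2
      have : w e ≠ w a := fun h => h2.ne (w.injective h)
      rcases lt_or_gt_of_ne this with t | t
      · exact t1 ⟨h3.1, t⟩
      · exact t2 ⟨t, h3.2⟩
    · have := hc.2.2 e h1 h2
      rw [key _ _ _ h2.ne (h2.trans haq).ne] at this
      exact this ⟨h3.1, h3.2.trans hw⟩
    · by_cases hea : e = a
      · subst hea
        rw [tr_right] at h3
        exact lt_asymm h h3.1
      rw [key _ _ _ h1.ne' hea] at h3
      rcases lt_or_gt_of_ne hea with t | t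
      · have := hc.2.2 e h1 t
        rw [key _ _ _ t.ne h2.ne] at this
        exact this ⟨h.trans h3.1, h3.2⟩
      · exact hc.1 e t h2 h3
  · rw [add_eq_left.2 (if_neg fun hc => lt_asymm h hc.1.1)]
    refine if_congr ⟨fun hc => ⟨fun e h1 h2 h3 => ?_, hc.1.1, fun e h1 h2 h3 => ?_⟩,
      fun hc => ⟨⟨hc.2.1, fun e h1 h2 h3 => ?_⟩, h, fun e h1 h2 h3 => ?_⟩⟩ rfl rfl
    · have t1 := hc.1.2 e (hpa.trans h1) h2
      have t2 := hc.2.2 e h1 h2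
      rw [key _ _ _ (hpa.trans h1).ne' h2.ne] at t2
      have : w e ≠ w p := fun h => (hpa.trans h1).ne' (w.injective h)
      rcases lt_or_gt_of_ne this with t | t
      · exact t2 ⟨h3.1, t⟩
      · exact t1 ⟨t, h3.2⟩
    · rw [key _ _ _ h2.ne (h2.trans haq).ne] at h3
      exact hc.1.2 e h1 (h2.trans haq) h3
    · by_cases hea : e = a
      · subst hea
        exact lt_asymm h h3.1
      rcases lt_or_gt_of_ne hea with t | t
      · have := hc.2.2 e h1 t
        rw [key _ _ _ t.ne h2.ne] at this
        exact this h3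
      · exact hc.1 e t h2 ⟨h.trans h3.1, h3.2⟩
    · rw [key _ _ _ (hpa.trans h1).ne' h2.ne] at h3
      exact hc.1 e h1 h2 ⟨h3.1, h3.2.trans hc.2.1⟩

lemma bruhatOp_bruhatOp_eq_zero {w : PPerm} {p a q : ℕ+} (hw : w a < w q) (haq : a < q)
    (g : PPerm → R) : bruhatOp p q (bruhatOp p a g) w = 0 := by
  simp only [bruhatOp, ← ite_and]
  refine if_neg fun hc => ?_
  have := hc.2.2.1
  simp only [Equiv.Perm.mul_apply, tr_left, tr_of_ne hc.2.1.ne' haq.ne] at this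
  exact lt_asymm this hw

end TransitionOperators

section TransitionOperators

variable {R : Type*} [AddCommGroup R]

lemma bruhatOp_valueOp {w : PPerm} {i : ℕ} {n x y r : ℕ+} (hr : tr x y (w⁻¹ n) = r)
    (hi : i < (r : ℕ)) (g : PPerm → R) :
    bruhatOp x y (valueOp i n g) w = ∑ p ∈ posUpTo i, bruhatOp x y (bruhatOp p r g) w := by
  by_cases hc : Cov w x y
  · simp only [bruhatOp, if_pos hc, valueOp, inv_mul_tr, hr, if_pos hi]
  · simp only [bruhatOp, if_neg hc, Finset.sum_const_zero]

lemma bruhatOp_valueOp_eq_zero {w : PPerm} {i : ℕ} {n x y r : ℕ+} (hr : tr x y (w⁻¹ n) = r)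
    (hi : (r : ℕ) ≤ i) (g : PPerm → R) : bruhatOp x y (valueOp i n g) w = 0 := by
  simp only [bruhatOp, valueOp, inv_mul_tr, hr, if_neg (not_lt.2 hi), ite_self]

lemma bruhatOp_monkValueOp_eq_zero {w : PPerm} {i N : ℕ} {x y r : ℕ+}
    (hr : tr x y i.succPNat = r) (hN : N < (w r : ℕ)) (g : PPerm → R) :
    bruhatOp x y (monkValueOp i N g) w = 0 := by
  simp only [bruhatOp, monkValueOp, Equiv.Perm.mul_apply, hr, if_neg (not_le.2 hN), ite_self]

lemma bruhatOp_monkValueOp {w : PPerm} {i N : ℕ} {x y r : ℕ+}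
    (hr : tr x y i.succPNat = r) (hN : (w r : ℕ) ≤ N) (g : PPerm → R) :
    bruhatOp x y (monkValueOp i N g) w =
      ∑ m ∈ posUpTo N,
        (if Cov w x y then bruhatOp i.succPNat (tr x y (w⁻¹ m)) g (w * tr x y) else 0) -
      ∑ b ∈ posUpTo i, bruhatOp x y (bruhatOp b i.succPNat g) w := by
  by_cases hc : Cov w x y
  · simp only [bruhatOp, if_pos hc, monkValueOp, Equiv.Perm.mul_apply, hr, if_pos hN, inv_mul_tr]
  · simp only [bruhatOp, if_neg hc, Finset.sum_const_zero, sub_zero]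

lemma ite_cov_bruhatOp {w : PPerm} {p a q m : ℕ+} (hpa : p < a) (haq : a < q) (hm : m ≠ w q)
    (g : PPerm → R) :
    (if Cov w p q then bruhatOp a (tr p q (w⁻¹ m)) g (w * tr p q) else 0) =
      bruhatOp a (w⁻¹ m) (bruhatOp p q g) w +
        if m = w p then bruhatOp p q (bruhatOp a q g) w else 0 := by
  by_cases h : m = w p
  · subst h
    rw [inv_apply_apply, if_pos rfl, bruhatOp_of_not_lt (not_lt.2 hpa.le), zero_add, tr_left]
    rfl
  · have h1 : w⁻¹ m ≠ p := fun h' => h (by rw [← h', apply_inv_apply])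
    have h2 : w⁻¹ m ≠ q := fun h' => hm (by rw [← h', apply_inv_apply])
    rw [if_neg h, add_zero, tr_of_ne h1 h2,
      ← bruhatOp_comm hpa.ne h1.symm haq.ne' h2.symm]
    rfl

lemma valueOp_monkValueOp (i N : ℕ) (g : PPerm → R) :
    valueOp (i + 1) N.succPNat (monkValueOp i N g) =
      monkValueOp i (N + 1) (valueOp i N.succPNat g) := by
  funext w
  have hrhs : monkValueOp i (N + 1) (valueOp i N.succPNat g) w =
      if (w i.succPNat : ℕ) ≤ N + 1 then
        bruhatOp i.succPNat (w⁻¹ N.succPNat) (valueOp i N.succPNat g) w +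
        ∑ m ∈ posUpTo N, bruhatOp i.succPNat (w⁻¹ m) (valueOp i N.succPNat g) w -
        ∑ b ∈ posUpTo i, bruhatOp b i.succPNat (valueOp i N.succPNat g) w else 0 := by
    rw [monkValueOp, posUpTo_succ, Finset.sum_insert (succPNat_notMem_posUpTo N)]
  have hlhs : valueOp (i + 1) N.succPNat (monkValueOp i N g) w =
      if i + 1 < (w⁻¹ N.succPNat : ℕ) then
        bruhatOp i.succPNat (w⁻¹ N.succPNat) (monkValueOp i N g) w +
        ∑ p ∈ posUpTo i, bruhatOp p (w⁻¹ N.succPNat) (monkValueOp i N g) w else 0 := by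
    rw [valueOp, posUpTo_succ, Finset.sum_insert (succPNat_notMem_posUpTo i)]
  have hmonk : ∀ x y r, tr x y i.succPNat = r → N < (w r : ℕ) →
      bruhatOp x y (monkValueOp i N g) w = 0 := fun x y r h h' =>
    bruhatOp_monkValueOp_eq_zero h h' g
  have hmonk' := fun x y r (h : tr x y i.succPNat = r) (h' : (w r : ℕ) ≤ N) =>
    bruhatOp_monkValueOp h h' g
  rw [hrhs, hlhs]
  clear hrhs hlhs
  set a := i.succPNat with ha
  set n := N.succPNat with hn
  have ha' : (a : ℕ) = i + 1 := rfl
  have hn' : (n : ℕ) = N + 1 := rfl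
  obtain ⟨q, hq⟩ : ∃ q, w⁻¹ n = q := ⟨_, rfl⟩
  have hwq : w q = n := by rw [← hq, apply_inv_apply]
  rw [hq]
  have hpa : ∀ p ∈ posUpTo i, p < a := fun p hp => by
    have := mem_posUpTo.1 hp
    rw [← PNat.coe_lt_coe]
    omega
  rcases lt_trichotomy n (w a) with h | h | h
  · have hN : N + 1 < (w a : ℕ) := by rw [← PNat.coe_lt_coe] at h; omega
    have hqa : q ≠ a := by rintro rfl; exact h.ne hwq.symm
    rw [if_neg (not_le.2 hN)]
    split_ifs with hiq
    · rw [hmonk a q q (tr_left a q) (by rw [hwq]; omega), zero_add]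
      exact Finset.sum_eq_zero fun p hp =>
        hmonk p q a (tr_of_ne (hpa p hp).ne' hqa.symm) (by omega)
    · rfl
  · have hqa : q = a := by rw [← hq, h, inv_apply_apply]
    rw [hqa, ha', if_neg (lt_irrefl _), if_pos (show (w a : ℕ) ≤ N + 1 by rw [← h, hn']),
      bruhatOp_of_not_lt (lt_irrefl a), zero_add,
      Finset.sum_eq_zero fun m hm => ?_, Finset.sum_eq_zero fun b hb => ?_, sub_zero]
    · exact bruhatOp_valueOp_eq_zero (by rw [hq, hqa, tr_right]) (mem_posUpTo.1 hb) g
    · refine if_neg fun hc => ?_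
      have h1 := hc.2.1
      rw [apply_inv_apply, ← h, ← PNat.coe_lt_coe] at h1
      have := mem_posUpTo.1 hm
      omega
  · have hN : (w a : ℕ) ≤ N := by rw [← PNat.coe_lt_coe] at h; omega
    have hqa : q ≠ a := by rintro rfl; exact h.ne hwq
    rw [if_pos (show (w a : ℕ) ≤ N + 1 by omega)]
    have hinv : ∀ m ∈ posUpTo N, w⁻¹ m ≠ q := fun m hm h' => by
      have := mem_posUpTo.1 hm
      have : m = n := by rw [← hwq, ← h', apply_inv_apply]
      subst this
      omega
    rcases lt_or_gt_of_ne hqa with hl | hl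
    · have hqi : (q : ℕ) ≤ i := by rw [← PNat.coe_lt_coe] at hl; omega
      rw [if_neg (by omega), bruhatOp_of_not_lt (not_lt.2 hl.le), zero_add,
        Finset.sum_eq_zero fun m hm =>
          bruhatOp_valueOp_eq_zero (by rw [hq, tr_of_ne hqa (hinv m hm).symm]) hqi g, zero_sub,
        eq_comm, neg_eq_zero]
      refine Finset.sum_eq_zero fun b hb => ?_
      by_cases hbq : b = q
      · subst hbq
        refine if_neg fun hc => ?_
        have := hc.2.1
        rw [hwq] at this
        exact lt_asymm h this
      · exact bruhatOp_valueOp_eq_zero (by rw [hq, tr_of_ne (Ne.symm hbq) hqa]) hqi g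
    · have hqi : i + 1 < (q : ℕ) := by rwa [← PNat.coe_lt_coe] at hl
      have hlt : w a < w q := by rwa [hwq]
      rw [if_pos hqi, hmonk a q q (tr_left a q) (by rw [hwq]; omega), zero_add,
        bruhatOp_valueOp (by rw [hq, tr_right]) (show i < (a : ℕ) by omega),
        Finset.sum_congr rfl fun m hm => bruhatOp_valueOp (x := a) (y := w⁻¹ m)
          (by rw [hq, tr_of_ne hqa (hinv m hm).symm]) (by omega) g]
      have hb : ∀ b ∈ posUpTo i, bruhatOp b a (valueOp i n g) w =
          ∑ p ∈ posUpTo i, bruhatOp b a (bruhatOp p q g) w := fun b hb =>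
        bruhatOp_valueOp (by rw [hq, tr_of_ne ((hpa b hb).trans hl).ne' hqa]) (by omega) g
      rw [Finset.sum_congr rfl hb, Finset.sum_comm (s := posUpTo N),
        Finset.sum_comm (s := posUpTo i) (t := posUpTo i), ← Finset.sum_add_distrib,
        ← Finset.sum_sub_distrib]
      refine Finset.sum_congr rfl fun p hp => ?_
      have hpa' := hpa p hp
      rw [hmonk' p q a (tr_of_ne hpa'.ne' hqa.symm) hN, ← bruhatOp_bruhatOp_add hpa' hl hlt]
      have h1 : ∑ m ∈ posUpTo N,
          (if Cov w p q then bruhatOp a (tr p q (w⁻¹ m)) g (w * tr p q) else 0) =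
          ∑ m ∈ posUpTo N, bruhatOp a (w⁻¹ m) (bruhatOp p q g) w +
            bruhatOp p q (bruhatOp a q g) w := by
        rw [Finset.sum_congr rfl fun m hm => ite_cov_bruhatOp hpa' hl
          (fun h' => hinv m hm (by rw [h', inv_apply_apply])) g, Finset.sum_add_distrib,
          Finset.sum_ite_eq']
        congr 1
        refine ite_eq_left_iff.2 fun hwp => (if_neg fun hc => hwp (mem_posUpTo.2 ?_)).symm
        have := hc.2.1
        rw [hwq, ← PNat.coe_lt_coe] at this
        omega
      have h2 : ∑ b ∈ posUpTo i, bruhatOp b a (bruhatOp p q g) w =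
          ∑ b ∈ posUpTo i, bruhatOp p q (bruhatOp b a g) w +
            bruhatOp p a (bruhatOp p q g) w := by
        rw [← Finset.sum_erase_add _ _ hp, ← Finset.sum_erase_add (posUpTo i) _ hp,
          bruhatOp_bruhatOp_eq_zero hlt hl, add_zero]
        congr 1
        refine Finset.sum_congr rfl fun b hb => ?_
        obtain ⟨hbp, hb⟩ := Finset.mem_erase.1 hb
        exact bruhatOp_comm hbp ((hpa b hb).trans hl).ne hpa'.ne' hl.ne g w
      rw [h1, h2]
      abel

/-- The sum over chains of covers `w ⋖ w t_{pq}` of length `d` with `p ≤ i < q` along which the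
values `w q ≤ N` decrease. -/
def chainOp (i : ℕ) : ℕ → ℕ → (PPerm → R) → PPerm → R
  | _, 0, g => g
  | 0, _ + 1, _ => 0
  | N + 1, d + 1, g => chainOp i N (d + 1) g + valueOp i N.succPNat (chainOp i N d g)

lemma chainOp_zero_right (i N : ℕ) (g : PPerm → R) : chainOp i N 0 g = g := by
  cases N <;> rfl

lemma chainOp_succ_succ (i N d : ℕ) (g : PPerm → R) : chainOp i (N + 1) (d + 1) g =
    chainOp i N (d + 1) g + valueOp i N.succPNat (chainOp i N d g) :=
  rfl

lemma monkValueOp_zero_right (i : ℕ) (g : PPerm → R) : monkValueOp i 0 g = 0 := by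
  funext w
  exact if_neg (not_le.2 (PNat.pos _))

lemma chainOp_succ_left (i N d : ℕ) (g : PPerm → R) : chainOp (i + 1) N (d + 1) g =
    chainOp i N (d + 1) g + monkValueOp i N (chainOp i N d g) := by
  induction N generalizing d with
  | zero =>
    rw [monkValueOp_zero_right, add_zero]
    rfl
  | succ N ih =>
    rw [chainOp_succ_succ, ih, chainOp_succ_succ]
    cases d with
    | zero =>
      simp only [chainOp_zero_right]
      rw [add_assoc, add_assoc, add_comm (monkValueOp i N g), valueOp_succ_add_monkValueOp,
        add_comm (valueOp i N.succPNat g)]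
    | succ d =>
      rw [ih d, chainOp_succ_succ i N d, valueOp_add, monkValueOp_add, valueOp_monkValueOp]
      have := valueOp_succ_add_monkValueOp i N (chainOp i N (d + 1) g)
      rw [add_assoc, ← add_assoc (monkValueOp i N _), add_comm (monkValueOp i N _), this]
      abel

end TransitionOperators

lemma ePoly_eq_esymm (i d : ℕ) : ePoly i d =
    Multiset.esymm ((Finset.univ : Finset (Fin i)).val.map
      fun k => (MvPolynomial.X k.val.succPNat : MvPolynomial ℕ+ ℤ)) d :=
  (Finset.esymm_map_val _ _ _).symm

lemma ePoly_succ_succ (i d : ℕ) : ePoly (i + 1) (d + 1) =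
    ePoly i (d + 1) + MvPolynomial.X i.succPNat * ePoly i d := by
  simp only [ePoly_eq_esymm]
  rw [Fin.univ_castSuccEmb, Finset.cons_val, Multiset.map_cons, Finset.map_val, Multiset.map_map]
  simp only [Multiset.esymm, Multiset.powersetCard_cons, Multiset.map_add, Multiset.sum_add,
    Multiset.map_map, Function.comp_def, Multiset.prod_cons, Multiset.sum_map_mul_left]
  rfl

lemma ePoly_zero_right (i : ℕ) : ePoly i 0 = 1 := by
  simp [ePoly]

lemma ePoly_zero_succ (d : ℕ) : ePoly 0 (d + 1) = 0 := by
  rw [ePoly, Finset.powersetCard_eq_empty.2 (by simp), Finset.sum_empty]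

lemma bruhatOp_mul_right {R : Type*} [Ring R] (p q : ℕ+) (g : PPerm → R) (e : R) (w : PPerm) :
    bruhatOp p q (fun v => g v * e) w = bruhatOp p q g w * e := by
  simp only [bruhatOp, ite_mul, zero_mul]

lemma monkValueOp_mul_right {R : Type*} [Ring R] (i N : ℕ) (g : PPerm → R) (e : R) (w : PPerm) :
    monkValueOp i N (fun v => g v * e) w = monkValueOp i N g w * e := by
  simp only [monkValueOp, bruhatOp_mul_right, ite_mul, zero_mul, sub_mul, Finset.sum_mul]

lemma Cov.le_of_fixesFrom {w : PPerm} {B : ℕ} (hw : FixesFrom B w) {p q : ℕ+} (hp : (p : ℕ) < B)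
    (h : Cov w p q) : (q : ℕ) ≤ B := by
  by_contra! hq
  obtain ⟨b, rfl⟩ : ∃ b : ℕ+, (b : ℕ) = B := ⟨⟨B, by omega⟩, rfl⟩
  have hpb : p < b := PNat.coe_lt_coe _ _ |>.1 hp
  have hbq : b < q := PNat.coe_lt_coe _ _ |>.1 hq
  refine h.2.2 b hpb hbq ⟨?_, ?_⟩
  · rw [hw b le_rfl]
    exact PNat.coe_lt_coe _ _ |>.1 (hw.apply_lt le_rfl hp)
  · rwa [hw b le_rfl, hw q hq.le]

lemma Cov.fixesFrom_mul_tr {w : PPerm} {B : ℕ} (hw : FixesFrom B w) {p q : ℕ+}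
    (hp : (p : ℕ) < B) (h : Cov w p q) : FixesFrom (B + 1) (w * tr p q) :=
  (hw.mono (Nat.le_succ B)).mul_tr (by omega) (by have := h.le_of_fixesFrom hw hp; omega)

lemma monkValueOp_congr {R : Type*} [AddCommGroup R] {i N B : ℕ} {w : PPerm}
    (hw : FixesFrom B w) (hi : i + 1 < B) {f g : PPerm → R}
    (hfg : ∀ v, FixesFrom (B + 1) v → f v = g v) :
    monkValueOp i N f w = monkValueOp i N g w := by
  have h : ∀ p q : ℕ+, (p : ℕ) ≤ i + 1 → bruhatOp p q f w = bruhatOp p q g w := fun p q hp => by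
    simp only [bruhatOp]
    split_ifs with hc
    · exact hfg _ (hc.fixesFrom_mul_tr hw (by omega))
    · rfl
  simp only [monkValueOp]
  rw [Finset.sum_congr rfl fun m _ => h _ _ (Nat.succPNat_coe i).le,
    Finset.sum_congr rfl fun b hb => h b _ ((mem_posUpTo.1 hb).trans (Nat.le_succ i))]

lemma monkValueOp_eq_monkOp {R : Type*} [AddCommGroup R] {i N : ℕ} {w : PPerm}
    (hw : FixesFrom N w) (hi : i + 1 < N) (g : PPerm → R) :
    monkValueOp i N g w = monkOp i.succPNat N g w := by
  have hmem : ∀ m : ℕ+, m ∈ posUpTo N ↔ w m ∈ posUpTo N := fun m => by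
    have hw' := hw.mono (Nat.le_succ N)
    rw [mem_posUpTo, mem_posUpTo]
    refine ⟨fun h => ?_, fun h => ?_⟩
    · have := hw'.apply_lt le_rfl (Nat.lt_succ_of_le h)
      omega
    · by_contra! hm
      rw [hw m hm.le] at h
      omega
  have ha : i.succPNat ∈ posUpTo N := mem_posUpTo.2 (by rw [Nat.succPNat_coe]; omega)
  rw [monkValueOp, if_pos (mem_posUpTo.1 ((hmem _).1 ha)), monkOp, Finset.sum_sub_distrib]
  congr 1
  · refine (Finset.sum_equiv w hmem fun m _ => ?_).symm
    rw [inv_apply_apply]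
  · refine Finset.sum_subset (fun b hb => ?_) fun b _ hb => bruhatOp_of_not_lt (fun hl => hb ?_) g w
    · have := mem_posUpTo.1 hb
      exact mem_posUpTo.2 (by omega)
    · rw [← PNat.coe_lt_coe, Nat.succPNat_coe] at hl
      exact mem_posUpTo.2 (by omega)

lemma chainOp_zero_succ {R : Type*} [AddCommGroup R] (N d : ℕ) (g : PPerm → R) :
    chainOp 0 N (d + 1) g = 0 := by
  have h : ∀ n (g : PPerm → R), valueOp 0 n g = 0 := fun n g => by
    funext w
    have : posUpTo 0 = ∅ := Finset.eq_empty_of_forall_notMem fun p hp =>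
      (PNat.pos p).ne' (Nat.le_zero.1 (mem_posUpTo.1 hp))
    simp [valueOp, this]
  induction N with
  | zero => rfl
  | succ N ih => rw [chainOp_succ_succ, ih, h, add_zero]

lemma IsSchubertFamily.chainOp_eq {S : PPerm → MvPolynomial ℕ+ ℤ} (hS : IsSchubertFamily S)
    {i d B N : ℕ} {w : PPerm} (hw : FixesFrom B w) (hi : i < B) (hN : B + i ≤ N) :
    chainOp i N d S w = S w * ePoly i d := by
  induction i generalizing d B w with
  | zero =>
    cases d with
    | zero => rw [chainOp_zero_right, ePoly_zero_right, mul_one]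
    | succ d => rw [chainOp_zero_succ, ePoly_zero_succ, mul_zero, Pi.zero_apply]
  | succ i ih =>
    cases d with
    | zero => rw [chainOp_zero_right, ePoly_zero_right, mul_one]
    | succ d =>
      have hwN : FixesFrom N w := hw.mono (by omega)
      rw [chainOp_succ_left, Pi.add_apply, ih hw (by omega) (by omega),
        monkValueOp_congr hw hi (g := fun v => S v * ePoly i d)
          fun v hv => ih hv (by omega) (by omega),
        monkValueOp_mul_right, monkValueOp_eq_monkOp hwN (by omega),
        hS.monkOp_eq hwN (by rw [Nat.succPNat_coe]; omega), ePoly_succ_succ]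
      ring

/-- The products `ζ = t_{p₁q₁} ⋯ t_{p_dq_d}` over chains of covers starting at `w` with
`p_j ≤ i < q_j` along which the values `w_j q_j ≤ N` decrease. -/
def chainSet (i : ℕ) : ℕ → ℕ → PPerm → Set PPerm
  | 0, _, _ => {1}
  | d + 1, N, w => {ζ | ∃ p q : ℕ+, ((p : ℕ) ≤ i ∧ i < (q : ℕ)) ∧ Cov w p q ∧ (w q : ℕ) ≤ N ∧
      ∃ η ∈ chainSet i d ((w q : ℕ) - 1) (w * tr p q), ζ = tr p q * η}

lemma wSeq_zero (w : PPerm) (d : ℕ) (p q : Fin d → ℕ+) : wSeq w d p q 0 = w := by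
  simp [wSeq]

lemma trList_cons (d : ℕ) (p₀ q₀ : ℕ+) (p q : Fin d → ℕ+) :
    trList (d + 1) (Fin.cons p₀ p) (Fin.cons q₀ q) = tr p₀ q₀ :: trList d p q := by
  simp [trList, List.ofFn_succ]

lemma wSeq_cons_succ (w : PPerm) (d : ℕ) (p₀ q₀ : ℕ+) (p q : Fin d → ℕ+) (j : ℕ) :
    wSeq w (d + 1) (Fin.cons p₀ p) (Fin.cons q₀ q) (j + 1) = wSeq (w * tr p₀ q₀) d p q j := by
  rw [wSeq, wSeq, trList_cons, List.take_succ_cons, List.prod_cons, mul_assoc]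

lemma isYFact_cons {w : PPerm} (hw : HasFinSupp w) {i d : ℕ} {p₀ q₀ : ℕ+} {p q : Fin d → ℕ+} :
    IsYFact w i (d + 1) (Fin.cons p₀ p) (Fin.cons q₀ q) ↔
      ((p₀ : ℕ) ≤ i ∧ i < (q₀ : ℕ)) ∧ Cov w p₀ q₀ ∧ IsYFact (w * tr p₀ q₀) i d p q ∧
        ∀ j : Fin d, wSeq (w * tr p₀ q₀) d p q j (q j) < w q₀ := by
  simp only [IsYFact, Fin.forall_fin_succ, Fin.cons_zero, Fin.cons_succ, Fin.val_zero, Fin.val_succ,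
    wSeq_cons_succ, wSeq_zero, Fin.succ_lt_succ_iff, Fin.succ_pos, Fin.not_lt_zero, false_imp_iff,
    true_and, forall_const]
  constructor
  · rintro ⟨⟨h2, h3⟩, ⟨h4, h5⟩, h6, h7⟩
    refine ⟨h2, ?_, ⟨h3, h5, h7⟩, h6⟩
    exact (len_mul_tr_eq_iff_cov hw (PNat.coe_lt_coe _ _ |>.1 (by omega))).1 h4
  · rintro ⟨h2, h4, ⟨h3, h5, h7⟩, h6⟩
    exact ⟨⟨h2, h3⟩, ⟨(len_mul_tr_eq_iff_cov hw h4.1).2 h4, h5⟩, h6, h7⟩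

lemma mem_chainSet_iff {i d N : ℕ} {w ζ : PPerm} (hw : HasFinSupp w) :
    ζ ∈ chainSet i d N w ↔ ∃ p q : Fin d → ℕ+, ζ = (trList d p q).prod ∧ IsYFact w i d p q ∧
      ∀ j : Fin d, (wSeq w d p q j (q j) : ℕ) ≤ N := by
  induction d generalizing N w ζ with
  | zero => simp [chainSet, trList, IsYFact]
  | succ d ih =>
    simp only [chainSet, Set.mem_ofPred_eq, Fin.exists_fin_succ_pi, trList_cons, List.prod_cons,
      isYFact_cons hw, Fin.forall_fin_succ, Fin.cons_zero, Fin.cons_succ, Fin.val_zero,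
      Fin.val_succ, wSeq_zero, wSeq_cons_succ]
    constructor
    · rintro ⟨p₀, q₀, h1, h2, h3, η, hη, rfl⟩
      obtain ⟨p, q, rfl, h4, h5⟩ := (ih (hw.mul_tr _ _)).1 hη
      have h6 : ∀ j : Fin d, (wSeq (w * tr p₀ q₀) d p q j (q j) : ℕ) < w q₀ := fun j => by
        have := h5 j
        have := (w q₀).pos
        omega
      exact ⟨p₀, p, q₀, q, rfl, ⟨h1, h2, h4, fun j => PNat.coe_lt_coe _ _ |>.1 (h6 j)⟩, h3,
        fun j => (h6 j).le.trans h3⟩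
    · rintro ⟨p₀, p, q₀, q, rfl, ⟨h1, h2, h4, h5⟩, h3, -⟩
      exact ⟨p₀, q₀, h1, h2, h3, _, (ih (hw.mul_tr _ _)).2 ⟨p, q, rfl, h4, fun j =>
        Nat.le_sub_one_of_lt (PNat.coe_lt_coe _ _ |>.2 (h5 j))⟩, rfl⟩

lemma YSet_eq_chainSet {i d B N : ℕ} {w : PPerm} (hw : FixesFrom B w) (hi : i < B) (hN : B ≤ N) :
    YSet w i d = chainSet i d N w := by
  ext ζ
  rw [mem_chainSet_iff hw.hasFinSupp]
  refine exists_congr fun p => exists_congr fun q => and_congr_right fun _ =>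
    ⟨fun h => ⟨h, fun j => ?_⟩, And.left⟩
  cases d with
  | zero => exact j.elim0
  | succ d =>
    have h1 := h.1 0
    have h2 := h.2.1 0
    have hc : Cov w (p 0) (q 0) := by
      rw [← len_mul_tr_eq_iff_cov hw.hasFinSupp (PNat.coe_lt_coe _ _ |>.1 (by omega))]
      simpa [wSeq, trList, List.ofFn_succ] using h2
    have h0 : (wSeq w (d + 1) p q 0 (q 0) : ℕ) ≤ N := by
      rw [wSeq_zero]
      have h3 := (hw.mono (Nat.le_succ B)).apply_lt le_rfl
        (Nat.lt_succ_of_le (hc.le_of_fixesFrom hw (by omega)))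
      omega
    rcases Fin.eq_zero_or_eq_succ j with rfl | ⟨k, rfl⟩
    · exact h0
    · exact (PNat.coe_lt_coe _ _ |>.2 (h.2.2 0 _ k.succ_pos)).le.trans h0

lemma apply_eq_of_mem_chainSet {i d N : ℕ} {w ζ : PPerm} (h : ζ ∈ chainSet i d N w) {n : ℕ+}
    (hn : N < (n : ℕ)) : ζ (w⁻¹ n) = w⁻¹ n := by
  induction d generalizing N w ζ with
  | zero =>
    obtain rfl : ζ = 1 := h
    rfl
  | succ d ih =>
    obtain ⟨p, q, -, hc, hN, η, hη, rfl⟩ := h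
    have hq : w⁻¹ n ≠ q := by
      rintro rfl
      rw [apply_inv_apply] at hN
      omega
    have hp : w⁻¹ n ≠ p := by
      rintro rfl
      have := PNat.coe_lt_coe _ _ |>.2 hc.2.1
      rw [apply_inv_apply] at this
      omega
    have := ih hη (by omega)
    rw [inv_mul_tr, tr_of_ne hp hq] at this
    rw [Equiv.Perm.mul_apply, this, tr_of_ne hp hq]

/-- The members of `chainSet i (d + 1) n w` whose first transposition is `t_{pq}`,
where `w q = n`. -/
def topChainSet (i d : ℕ) (n p : ℕ+) (w : PPerm) : Set PPerm :=
  if i < (w⁻¹ n : ℕ) ∧ Cov w p (w⁻¹ n) then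
    (tr p (w⁻¹ n) * ·) '' chainSet i d ((n : ℕ) - 1) (w * tr p (w⁻¹ n)) else ∅

lemma apply_eq_of_mem_topChainSet {i d : ℕ} {n p : ℕ+} {w ζ : PPerm}
    (h : ζ ∈ topChainSet i d n p w) : ζ p = w⁻¹ n := by
  rw [topChainSet] at h
  split_ifs at h with hc
  · obtain ⟨η, hη, rfl⟩ := h
    have := apply_eq_of_mem_chainSet hη (n := n) (by have := n.pos; omega)
    rw [inv_mul_tr, tr_right] at this
    rw [Equiv.Perm.mul_apply, this, tr_left]
  · exact absurd h (Set.notMem_empty _)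

lemma chainSet_succ_succ (i d N : ℕ) (w : PPerm) : chainSet i (d + 1) (N + 1) w =
    chainSet i (d + 1) N w ∪ ⋃ p ∈ (posUpTo i : Set ℕ+), topChainSet i d N.succPNat p w := by
  ext ζ
  simp only [Set.mem_union, Set.mem_iUnion, Finset.mem_coe, mem_posUpTo]
  constructor
  · rintro ⟨p, q, h1, hc, hN, η, hη, rfl⟩
    rcases Nat.lt_or_ge N (w q) with h | h
    · have hwq : w q = N.succPNat := PNat.coe_injective (by rw [Nat.succPNat_coe]; omega)
      have hq : w⁻¹ N.succPNat = q := by rw [← hwq, inv_apply_apply]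
      refine Or.inr ⟨p, h1.1, ?_⟩
      rw [topChainSet, hq, if_pos ⟨h1.2, hc⟩]
      exact ⟨η, by rwa [← hwq], rfl⟩
    · exact Or.inl ⟨p, q, h1, hc, h, η, hη, rfl⟩
  · rintro (⟨p, q, h1, hc, hN, h⟩ | ⟨p, hp, h⟩)
    · exact ⟨p, q, h1, hc, hN.trans (Nat.le_succ N), h⟩
    · rw [topChainSet] at h
      split_ifs at h with hc
      · obtain ⟨η, hη, rfl⟩ := h
        refine ⟨p, _, ⟨hp, hc.1⟩, hc.2, ?_, η, ?_, rfl⟩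
        · rw [apply_inv_apply, Nat.succPNat_coe]
        · rwa [apply_inv_apply]
      · exact absurd h (Set.notMem_empty _)

lemma chainSet_succ_zero (i d : ℕ) (w : PPerm) : chainSet i (d + 1) 0 w = ∅ :=
  Set.eq_empty_of_forall_notMem fun _ ⟨_, q, _, _, h, _⟩ => (w q).pos.ne' (Nat.le_zero.1 h)

lemma finite_topChainSet {i d N : ℕ} (h : ∀ w, (chainSet i d N w).Finite) (p : ℕ+) (w : PPerm) :
    (topChainSet i d N.succPNat p w).Finite := by
  rw [topChainSet]
  split_ifs
  · exact (h _).image _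
  · exact Set.finite_empty

lemma finite_chainSet (i d N : ℕ) (w : PPerm) : (chainSet i d N w).Finite := by
  induction N generalizing d w with
  | zero =>
    cases d with
    | zero => exact Set.finite_singleton 1
    | succ d => rw [chainSet_succ_zero]; exact Set.finite_empty
  | succ N ih =>
    cases d with
    | zero => exact Set.finite_singleton 1
    | succ d =>
      rw [chainSet_succ_succ]
      exact (ih _ w).union ((posUpTo i).finite_toSet.biUnion fun p _ =>
        finite_topChainSet (ih d) p w)

lemma chainOp_eq_finsum {R : Type*} [AddCommGroup R] (i N d : ℕ) (g : PPerm → R) (w : PPerm) :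
    chainOp i N d g w = ∑ᶠ ζ ∈ chainSet i d N w, g (w * ζ) := by
  induction N generalizing d w with
  | zero =>
    cases d with
    | zero => simp [chainSet, chainOp_zero_right]
    | succ d =>
      rw [chainSet_succ_zero, finsum_mem_empty]
      rfl
  | succ N ih =>
    cases d with
    | zero => simp [chainSet, chainOp_zero_right]
    | succ d =>
      have hdisj : Disjoint (chainSet i (d + 1) N w)
          (⋃ p ∈ (posUpTo i : Set ℕ+), topChainSet i d N.succPNat p w) := by
        simp only [Set.disjoint_iUnion_right]
        refine fun p hp => Set.disjoint_left.2 fun ζ h1 h2 => ?_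
        have h3 := apply_eq_of_mem_chainSet h1 (n := N.succPNat) (Nat.lt_succ_self N)
        have h4 := ζ.injective (h3.trans (apply_eq_of_mem_topChainSet h2).symm)
        rw [topChainSet] at h2
        split_ifs at h2 with hc
        · exact hc.2.1.ne' h4
        · exact absurd h2 (Set.notMem_empty _)
      have hpair : (posUpTo i : Set ℕ+).PairwiseDisjoint
          fun p => topChainSet i d N.succPNat p w := fun p _ p' _ hne =>
        Set.disjoint_left.2 fun ζ h1 h2 => hne (ζ.injective
          ((apply_eq_of_mem_topChainSet h1).trans (apply_eq_of_mem_topChainSet h2).symm))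
      rw [chainSet_succ_succ, finsum_mem_union hdisj (finite_chainSet _ _ _ _)
        ((posUpTo i).finite_toSet.biUnion fun p _ => finite_topChainSet (finite_chainSet i d N) p w),
        finsum_mem_biUnion hpair (posUpTo i).finite_toSet
          fun p _ => finite_topChainSet (finite_chainSet i d N) p w,
        finsum_mem_coe_finset, chainOp_succ_succ, Pi.add_apply, ih, valueOp]
      congr 1
      have htop : ∀ p : ℕ+, ∑ᶠ ζ ∈ topChainSet i d N.succPNat p w, g (w * ζ) =
          if i < (w⁻¹ N.succPNat : ℕ) then
            bruhatOp p (w⁻¹ N.succPNat) (chainOp i N d g) w else 0 := fun p => by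
        rw [topChainSet, bruhatOp, ← ite_and, ih]
        split_ifs with hc
        · rw [finsum_mem_image (mul_right_injective _).injOn]
          simp only [← mul_assoc]
          rfl
        · exact finsum_mem_empty
      rw [Finset.sum_congr rfl fun p _ => htop p]
      split_ifs
      · rfl
      · rw [Finset.sum_const_zero]

/-- **Dual Pieri rule for Schubert polynomials**:
`𝔖_w · e_d(x₁, …, x_i) = Σ_{ζ ∈ Y_{i,d}(w)} 𝔖_{wζ}`. -/
theorem dual_pieri_rule_for_schubert_polynomials
    (S : PPerm → MvPolynomial ℕ+ ℤ) (hS : IsSchubertFamily S)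
    (w : PPerm) (hw : HasFinSupp w) (i d : ℕ) (hi : 1 ≤ i) :
    S w * ePoly i d = ∑ᶠ ζ ∈ YSet w i d, S (w * ζ) := by
  obtain ⟨B, hB⟩ := hw.exists_fixesFrom
  have hB' : FixesFrom (B + i + 1) w := hB.mono (by omega)
  rw [YSet_eq_chainSet hB' (by omega) (Nat.le_add_right _ i), ← chainOp_eq_finsum,
    hS.chainOp_eq hB' (by omega) le_rfl]

end
end
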